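/- arXiv:1302.0336 — 4 statements merged into one kernel-verified Lean document; each statement's English description precedes it below -/
import Mathlib

section
/- Let f, f_1, …, f_m : (0,∞) → ℝ be convex with value 0 at 1 and let D_1,…,D_m ≥ 0. Then A(D_1,…,D_m) = sup{I_f(ψ) : ψ an extreme point of ∩_{i=1}^m C_1(f_i, D_i)}, and if moreover each divergence D_{f_i} is finite, then B(D_1,…,D_m) = inf{I_f(ψ) : ψ an extreme point of ∩_{i=1}^m C_2(f_i, D_i)}. (Here extreme points are taken in the convex set ∩_i C_1(f_i,D_i), respectively ∩_i C_2(f_i,D_i), viewed inside the vector space C[0,∞).) -/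
open MeasureTheory Filter Set
open scoped ENNReal NNReal Classical

noncomputable section

/-- The limit of `f` at `0` from the right, as an extended real number
(for `f` convex on `(0,∞)` the `limsup` below is the actual limit). -/
def limAtZero (f : ℝ → ℝ) : EReal :=
  Filter.limsup (fun x => (f x : EReal)) (nhdsWithin 0 (Set.Ioi 0))

/-- The limit of `f x / x` as `x → ∞`, as an extended real number
(for `f` convex on `(0,∞)` the `limsup` below is the actual limit). -/
def derivAtTop (f : ℝ → ℝ) : EReal :=
  Filter.limsup (fun x => ((f x / x : ℝ) : EReal)) Filter.atTop

/-- The `f`-divergence `D_f(P‖Q) = ∫_{q>0} f(p/q) dQ + f'(∞) P{q = 0}`, where the part of the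
integral over `{p = 0, q > 0}` is interpreted via the limit `f(0) := lim_{x↓0} f x`, and the part
over `{q = 0}` (the `Q`-singular part of `P`) via `f'(∞) := lim_{x→∞} f x / x`. -/
def fDiv (f : ℝ → ℝ) {Ω : Type*} [MeasurableSpace Ω] (P Q : Measure Ω) : EReal :=
  (if Integrable (fun x => f ((Measure.rnDeriv P Q x).toReal))
      (Q.restrict {x | Measure.rnDeriv P Q x ≠ 0})
   then ((∫ x in {x | Measure.rnDeriv P Q x ≠ 0},
       f ((Measure.rnDeriv P Q x).toReal) ∂Q : ℝ) : EReal)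
   else (⊤ : EReal))
  + limAtZero f * ((Q {x | Measure.rnDeriv P Q x = 0} : ℝ≥0∞) : EReal)
  + derivAtTop f * ((Measure.singularPart P Q Set.univ : ℝ≥0∞) : EReal)

/-- A pair of probability measures on an arbitrary measurable space. -/
structure PMPair where
  carrier : Type
  inst : MeasurableSpace carrier
  P : @Measure carrier inst
  Q : @Measure carrier inst
  probP : @IsProbabilityMeasure carrier inst P
  probQ : @IsProbabilityMeasure carrier inst Q

attribute [instance] PMPair.inst

/-- The total variation distance `V(P,Q) = (1/2) ∫ |p - q| dλ` (with `λ = P + Q`). -/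
def tvDist {Ω : Type*} [MeasurableSpace Ω] (P Q : Measure Ω) : ℝ :=
  (∫ x, |(Measure.rnDeriv P (P + Q) x).toReal - (Measure.rnDeriv Q (P + Q) x).toReal|
    ∂(P + Q)) / 2

/-- The function `ψ_{P,Q}(s) = ∫ min (p, q s) dλ` (with `λ = P + Q`). -/
def psiPQ {Ω : Type*} [MeasurableSpace Ω] (P Q : Measure Ω) (s : ℝ) : ℝ :=
  ∫ x, min ((Measure.rnDeriv P (P + Q) x).toReal)
    ((Measure.rnDeriv Q (P + Q) x).toReal * s) ∂(P + Q)

/-- The right derivative of `f`. -/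
def rightDeriv (f : ℝ → ℝ) (x : ℝ) : ℝ := derivWithin f (Set.Ioi x) x

/-- `ν` is the measure `ν_f` on `(0,∞)` with `ν (a,b] = ∂⁺f(b) - ∂⁺f(a)`. -/
def IsCurvatureMeasure (f : ℝ → ℝ) (ν : Measure ℝ) : Prop :=
  ∀ a b : ℝ, 0 < a → a ≤ b →
    ν (Set.Ioc a b) = ENNReal.ofReal (rightDeriv f b - rightDeriv f a)

/-- The functional `I_f(ψ) = ∫_{(0,∞)} (min(1,s) - ψ(s)) dν_f(s)`. -/
def Ifun (ν : Measure ℝ) (ψ : ℝ → ℝ) : ℝ≥0∞ :=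
  ∫⁻ s in Set.Ioi (0 : ℝ), ENNReal.ofReal (min 1 s - ψ s) ∂ν

/-- The class `C` of functions on `[0,∞)` (encoded as functions on `ℝ` vanishing on `(-∞,0)`)
that are nonnegative, concave, nondecreasing and bounded by `min(1,s)` on `[0,∞)`. -/
def Cclass : Set (ℝ → ℝ) :=
  {ψ | (∀ s, 0 ≤ s → 0 ≤ ψ s) ∧ ConcaveOn ℝ (Set.Ici 0) ψ ∧ MonotoneOn ψ (Set.Ici 0) ∧
    (∀ s, 0 ≤ s → ψ s ≤ min 1 s) ∧ ∀ s, s < 0 → ψ s = 0}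

open scoped Topology

lemma Cclass_zero {ψ : ℝ → ℝ} (h : ψ ∈ Cclass) : ψ 0 = 0 := by
  have h1 := h.1 0 le_rfl
  have h2 := h.2.2.2.1 0 le_rfl
  simp at h2
  linarith

lemma Cclass_monotone {ψ : ℝ → ℝ} (h : ψ ∈ Cclass) : Monotone ψ := by
  intro a b hab
  rcases lt_or_ge a 0 with ha | ha
  · rw [h.2.2.2.2 a ha]
    rcases lt_or_ge b 0 with hb | hb
    · rw [h.2.2.2.2 b hb]
    · exact h.1 b hb
  · exact h.2.2.1 ha (ha.trans hab) hab

lemma Cclass_continuousAt {ψ : ℝ → ℝ} (h : ψ ∈ Cclass) {s : ℝ} (hs : 0 < s) :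
    ContinuousAt ψ s := by
  have h1 : ConcaveOn ℝ (Set.Ioi 0) ψ := h.2.1.subset Set.Ioi_subset_Ici_self (convex_Ioi 0)
  exact (h1.continuousOn isOpen_Ioi).continuousAt (Ioi_mem_nhds hs)

lemma Cclass_mem_Icc {ψ : ℝ → ℝ} (h : ψ ∈ Cclass) (s : ℝ) : ψ s ∈ Set.Icc (0:ℝ) 1 := by
  rcases lt_or_ge s 0 with ha | ha
  · rw [h.2.2.2.2 s ha]; simp
  · exact ⟨h.1 s ha, (h.2.2.2.1 s ha).trans (min_le_left _ _)⟩

lemma Cclass_convex : Convex ℝ Cclass := by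
  intro x hx y hy a b ha hb hab
  refine ⟨fun s hs => ?_, ?_, ?_, fun s hs => ?_, fun s hs => ?_⟩
  · have := hx.1 s hs
    have := hy.1 s hs
    simp only [Pi.add_apply, Pi.smul_apply, smul_eq_mul]
    positivity
  · exact (hx.2.1.smul ha).add (hy.2.1.smul hb)
  · intro s hs t ht hst
    have h1 := hx.2.2.1 hs ht hst
    have h2 := hy.2.2.1 hs ht hst
    simp only [Pi.add_apply, Pi.smul_apply, smul_eq_mul]
    gcongr
  · have h1 := hx.2.2.2.1 s hs
    have h2 := hy.2.2.2.1 s hs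
    simp only [Pi.add_apply, Pi.smul_apply, smul_eq_mul]
    calc a * x s + b * y s ≤ a * min 1 s + b * min 1 s := by gcongr
      _ = min 1 s := by rw [← add_mul, hab, one_mul]
  · simp [hx.2.2.2.2 s hs, hy.2.2.2.2 s hs]

lemma Cclass_isClosed : IsClosed Cclass := by
  have e : Cclass = (⋂ s : ℝ, ⋂ (_ : 0 ≤ s), {ψ : ℝ → ℝ | 0 ≤ ψ s}) ∩
      ((⋂ x : ℝ, ⋂ (_ : 0 ≤ x), ⋂ y : ℝ, ⋂ (_ : 0 ≤ y), ⋂ a : ℝ, ⋂ b : ℝ,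
        ⋂ (_ : 0 ≤ a), ⋂ (_ : 0 ≤ b), ⋂ (_ : a + b = 1),
          {ψ : ℝ → ℝ | a * ψ x + b * ψ y ≤ ψ (a * x + b * y)}) ∩
      ((⋂ x : ℝ, ⋂ (_ : 0 ≤ x), ⋂ y : ℝ, ⋂ (_ : 0 ≤ y), ⋂ (_ : x ≤ y),
          {ψ : ℝ → ℝ | ψ x ≤ ψ y}) ∩
      ((⋂ s : ℝ, ⋂ (_ : 0 ≤ s), {ψ : ℝ → ℝ | ψ s ≤ min 1 s}) ∩
      (⋂ s : ℝ, ⋂ (_ : s < 0), {ψ : ℝ → ℝ | ψ s = 0})))) := by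
    ext ψ
    simp only [Cclass, Set.mem_inter_iff, Set.mem_iInter, Set.mem_ofPred_eq]
    refine and_congr Iff.rfl (and_congr ?_ (and_congr ?_ Iff.rfl))
    · constructor
      · intro h x hx y hy a b ha hb hab
        exact h.2 hx hy ha hb hab
      · intro h
        exact ⟨convex_Ici 0, fun x hx y hy a b ha hb hab => h x hx y hy a b ha hb hab⟩
    · constructor
      · intro h x hx y hy hxy
        exact h hx hy hxy
      · intro h x hx y hy hxy
        exact h x hx y hy hxy
  rw [e]
  refine IsClosed.inter ?_ (IsClosed.inter ?_ (IsClosed.inter ?_ (IsClosed.inter ?_ ?_)))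
  · exact isClosed_iInter fun s => isClosed_iInter fun _ =>
      isClosed_le continuous_const (continuous_apply s)
  · exact isClosed_iInter fun x => isClosed_iInter fun _ => isClosed_iInter fun y =>
      isClosed_iInter fun _ => isClosed_iInter fun a => isClosed_iInter fun b =>
      isClosed_iInter fun _ => isClosed_iInter fun _ => isClosed_iInter fun _ =>
      isClosed_le (by fun_prop) (by fun_prop)
  · exact isClosed_iInter fun x => isClosed_iInter fun _ => isClosed_iInter fun y =>
      isClosed_iInter fun _ => isClosed_iInter fun _ => isClosed_le (by fun_prop) (by fun_prop)
  · exact isClosed_iInter fun s => isClosed_iInter fun _ =>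
      isClosed_le (continuous_apply s) continuous_const
  · exact isClosed_iInter fun s => isClosed_iInter fun _ =>
      isClosed_eq (continuous_apply s) continuous_const

lemma Cclass_isCompact : IsCompact Cclass := by
  refine IsCompact.of_isClosed_subset
    (isCompact_univ_pi (fun _ : ℝ => isCompact_Icc (a := (0:ℝ)) (b := 1))) Cclass_isClosed ?_
  intro ψ hψ s _
  exact Cclass_mem_Icc hψ s

lemma Cclass_ext {ψ φ : ℝ → ℝ} (hψ : ψ ∈ Cclass) (hφ : φ ∈ Cclass)
    (h : ∀ q : ℚ, ψ q = φ q) : ψ = φ := by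
  funext s
  rcases lt_trichotomy s 0 with hs | hs | hs
  · rw [hψ.2.2.2.2 s hs, hφ.2.2.2.2 s hs]
  · rw [hs, Cclass_zero hψ, Cclass_zero hφ]
  · by_contra hne
    have hc : ContinuousAt (fun x => ψ x - φ x) s :=
      (Cclass_continuousAt hψ hs).sub (Cclass_continuousAt hφ hs)
    have hev : ∀ᶠ x in 𝓝 s, ψ x - φ x ≠ 0 := hc.eventually_ne (sub_ne_zero.2 hne)
    obtain ⟨x, ⟨q, rfl⟩, hx⟩ := (Rat.denseRange_cast (𝕜 := ℝ)).inter_nhds_nonempty hev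
    exact hx (by simp [h q])

lemma Cclass_metrizable : TopologicalSpace.MetrizableSpace Cclass := by
  have : CompactSpace Cclass := isCompact_iff_compactSpace.1 Cclass_isCompact
  have hc : Continuous (fun (ψ : Cclass) (q : ℚ) => (ψ : ℝ → ℝ) (q : ℝ)) :=
    continuous_pi fun q => (continuous_apply (q : ℝ)).comp continuous_subtype_val
  have hi : Function.Injective (fun (ψ : Cclass) (q : ℚ) => (ψ : ℝ → ℝ) (q : ℝ)) := by
    intro a b hab
    exact Subtype.ext (Cclass_ext a.2 b.2 fun q => congrFun hab q)
  exact (hc.isClosedEmbedding hi).isEmbedding.metrizableSpace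

/-- Sequential criterion for closedness of subsets of the class. -/
lemma Cclass_closed_of_seq (A : Set (ℝ → ℝ)) (hA : A ⊆ Cclass)
    (h : ∀ (u : ℕ → ℝ → ℝ) (ψ : ℝ → ℝ), (∀ n, u n ∈ A) → ψ ∈ Cclass →
      (∀ s, Tendsto (fun n => u n s) atTop (𝓝 (ψ s))) → ψ ∈ A) : IsClosed A := by
  have := Cclass_metrizable
  have h1 : IsClosed ((↑) ⁻¹' A : Set Cclass) := by
    apply IsSeqClosed.isClosed
    intro u ψ hu hψ
    refine h (fun n => u n) ψ hu ψ.2 fun s => ?_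
    exact ((continuous_apply s).comp continuous_subtype_val).continuousAt.tendsto.comp hψ
  have h2 := Cclass_isClosed.isClosedEmbedding_subtypeVal.isClosedMap _ h1
  rwa [Subtype.image_preimage_coe, Set.inter_eq_right.2 hA] at h2

lemma Ifun_meas {ψ : ℝ → ℝ} (h : ψ ∈ Cclass) :
    Measurable (fun s => ENNReal.ofReal (min 1 s - ψ s)) := by
  have := (Cclass_monotone h).measurable
  fun_prop

lemma Ifun_affine (ν : Measure ℝ) {x y : ℝ → ℝ} (hx : x ∈ Cclass) (hy : y ∈ Cclass)
    {a b : ℝ} (ha : 0 ≤ a) (hb : 0 ≤ b) (hab : a + b = 1) :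
    Ifun ν (a • x + b • y) = ENNReal.ofReal a * Ifun ν x + ENNReal.ofReal b * Ifun ν y := by
  unfold Ifun
  rw [← lintegral_const_mul _ (Ifun_meas hx), ← lintegral_const_mul _ (Ifun_meas hy),
    ← lintegral_add_left ((Ifun_meas hx).const_mul _)]
  refine setLIntegral_congr_fun measurableSet_Ioi fun s hs => ?_
  have hs' : (0:ℝ) ≤ s := le_of_lt hs
  have h1 := hx.2.2.2.1 s hs'
  have h2 := hy.2.2.2.1 s hs'
  simp only [Pi.add_apply, Pi.smul_apply, smul_eq_mul]
  rw [← ENNReal.ofReal_mul ha, ← ENNReal.ofReal_mul hb, ← ENNReal.ofReal_add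
    (mul_nonneg ha (by linarith)) (mul_nonneg hb (by linarith))]
  congr 1
  have : min 1 s = (a + b) * min 1 s := by rw [hab, one_mul]
  linear_combination this

lemma Ifun_fatou (ν : Measure ℝ) (u : ℕ → ℝ → ℝ) (ψ : ℝ → ℝ) (hu : ∀ n, u n ∈ Cclass)
    (h : ∀ s, Tendsto (fun n => u n s) atTop (𝓝 (ψ s))) :
    Ifun ν ψ ≤ liminf (fun n => Ifun ν (u n)) atTop := by
  unfold Ifun
  refine le_trans (le_of_eq ?_) (lintegral_liminf_le fun n => Ifun_meas (hu n))
  refine lintegral_congr fun s => ?_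
  have : Tendsto (fun n => ENNReal.ofReal (min 1 s - u n s)) atTop
      (𝓝 (ENNReal.ofReal (min 1 s - ψ s))) :=
    (ENNReal.continuous_ofReal.tendsto _).comp (tendsto_const_nhds.sub (h s))
  exact this.liminf_eq.symm

lemma Ifun_sublevel_closed (ν : Measure ℝ) (M : ℝ≥0∞) :
    IsClosed {ψ : ℝ → ℝ | ψ ∈ Cclass ∧ Ifun ν ψ ≤ M} := by
  refine Cclass_closed_of_seq _ (fun ψ h => h.1) fun u ψ hu hψ h => ⟨hψ, ?_⟩
  refine (Ifun_fatou ν u ψ (fun n => (hu n).1) h).trans ?_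
  refine liminf_le_of_le (by isBoundedDefault) fun b hb => ?_
  obtain ⟨n, hn⟩ := hb.exists
  exact hn.trans (hu n).2

lemma Ifun_superlevel_closed (ν : Measure ℝ) (hν : Ifun ν 0 ≠ ⊤) (M : ℝ≥0∞) :
    IsClosed {ψ : ℝ → ℝ | ψ ∈ Cclass ∧ M ≤ Ifun ν ψ} := by
  refine Cclass_closed_of_seq _ (fun ψ h => h.1) fun u ψ hu hψ h => ⟨hψ, ?_⟩
  have ht : Tendsto (fun n => Ifun ν (u n)) atTop (𝓝 (Ifun ν ψ)) := by
    unfold Ifun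
    refine tendsto_lintegral_of_dominated_convergence
      (fun s => ENNReal.ofReal (min 1 s - (0 : ℝ → ℝ) s)) (fun n => Ifun_meas (hu n).1)
      (fun n => ?_) hν ?_
    · refine Eventually.of_forall fun s => ENNReal.ofReal_le_ofReal ?_
      have := (Cclass_mem_Icc (hu n).1 s).1
      simp only [Pi.zero_apply]
      linarith
    · refine Eventually.of_forall fun s => ?_
      exact (ENNReal.continuous_ofReal.tendsto _).comp (tendsto_const_nhds.sub (h s))
  exact ge_of_tendsto' ht fun n => (hu n).2

lemma Ifun_sublevel_convex (ν : Measure ℝ) (M : ℝ≥0∞) :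
    Convex ℝ {ψ : ℝ → ℝ | ψ ∈ Cclass ∧ Ifun ν ψ ≤ M} := by
  intro x hx y hy a b ha hb hab
  refine ⟨Cclass_convex hx.1 hy.1 ha hb hab, ?_⟩
  rw [Ifun_affine ν hx.1 hy.1 ha hb hab]
  calc _ ≤ ENNReal.ofReal a * M + ENNReal.ofReal b * M := by gcongr; exacts [hx.2, hy.2]
    _ = M := by rw [← add_mul, ← ENNReal.ofReal_add ha hb, hab]; simp

lemma Ifun_superlevel_convex (ν : Measure ℝ) (M : ℝ≥0∞) :
    Convex ℝ {ψ : ℝ → ℝ | ψ ∈ Cclass ∧ M ≤ Ifun ν ψ} := by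
  intro x hx y hy a b ha hb hab
  refine ⟨Cclass_convex hx.1 hy.1 ha hb hab, ?_⟩
  rw [Ifun_affine ν hx.1 hy.1 ha hb hab]
  calc M = ENNReal.ofReal a * M + ENNReal.ofReal b * M := by
        rw [← add_mul, ← ENNReal.ofReal_add ha hb, hab]; simp
    _ ≤ _ := by gcongr; exacts [hx.2, hy.2]

/-- Supremum over a compact convex subset of the class is over extreme points. -/
lemma sup_ext (ν : Measure ℝ) (S : Set (ℝ → ℝ)) (hS : S ⊆ Cclass) (hc : IsCompact S)
    (hconv : Convex ℝ S) (M : ℝ≥0∞) (hM : ∀ ψ ∈ S.extremePoints ℝ, Ifun ν ψ ≤ M) :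
    ∀ ψ ∈ S, Ifun ν ψ ≤ M := by
  have h1 := closure_convexHull_extremePoints hc hconv
  have h2 : closure (convexHull ℝ (S.extremePoints ℝ)) ⊆
      {ψ : ℝ → ℝ | ψ ∈ Cclass ∧ Ifun ν ψ ≤ M} := by
    refine closure_minimal (convexHull_min ?_ (Ifun_sublevel_convex ν M))
      (Ifun_sublevel_closed ν M)
    intro ψ hψ
    exact ⟨hS hψ.1, hM ψ hψ⟩
  rw [h1] at h2
  exact fun ψ hψ => (h2 hψ).2

/-- The infimum over a compact subset of the class is attained at an extreme point. -/
lemma inf_ext (ν : Measure ℝ) (S : Set (ℝ → ℝ)) (hS : S ⊆ Cclass) (hc : IsCompact S)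
    (ψ₀ : ℝ → ℝ) (h₀ : ψ₀ ∈ S) :
    ∃ ψ ∈ S.extremePoints ℝ, ∀ φ ∈ S, Ifun ν ψ ≤ Ifun ν φ := by
  have hlsc : LowerSemicontinuousOn (Ifun ν) S := by
    rw [lowerSemicontinuousOn_iff_preimage_Iic]
    intro M
    refine ⟨_, Ifun_sublevel_closed ν M, ?_⟩
    ext ψ
    simp only [Set.mem_inter_iff, Set.mem_preimage, Set.mem_Iic, Set.mem_ofPred_eq]
    exact ⟨fun h => ⟨h.1, hS h.1, h.2⟩, fun h => ⟨h.1, h.2.2⟩⟩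
  obtain ⟨ψ₁, hψ₁, hmin⟩ := hlsc.exists_isMinOn ⟨ψ₀, h₀⟩ hc
  set M := Ifun ν ψ₁ with hM
  set T : Set (ℝ → ℝ) := S ∩ {ψ : ℝ → ℝ | ψ ∈ Cclass ∧ Ifun ν ψ ≤ M} with hT
  have hTc : IsCompact T := hc.inter_right (Ifun_sublevel_closed ν M)
  obtain ⟨ψ, hψ⟩ := hTc.extremePoints_nonempty ⟨ψ₁, hψ₁, hS hψ₁, le_rfl⟩
  have hex : IsExtreme ℝ S T := by
    refine ⟨Set.inter_subset_left, ?_⟩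
    rintro x hx y hy z hz ⟨a, b, ha, hb, hab, rfl⟩
    refine ⟨hx, hS hx, ?_⟩
    have h1 := hz.2.2
    rw [Ifun_affine ν (hS hx) (hS hy) ha.le hb.le hab] at h1
    have h2 : M ≤ Ifun ν y := hmin hy
    by_cases hMt : M = ⊤
    · rw [hMt]; exact le_top
    have h3 : ENNReal.ofReal a * Ifun ν x + ENNReal.ofReal b * M
        ≤ ENNReal.ofReal a * M + ENNReal.ofReal b * M := by
      calc _ ≤ ENNReal.ofReal a * Ifun ν x + ENNReal.ofReal b * Ifun ν y := by gcongr
        _ ≤ M := h1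
        _ = _ := by rw [← add_mul, ← ENNReal.ofReal_add ha.le hb.le, hab]; simp
    have h4 := (ENNReal.add_le_add_iff_right
      (ENNReal.mul_ne_top ENNReal.ofReal_ne_top hMt)).1 h3
    exact (ENNReal.mul_le_mul_iff_right (by simpa using ha) ENNReal.ofReal_ne_top).1 h4
  refine ⟨ψ, hex.extremePoints_subset_extremePoints hψ, fun φ hφ => ?_⟩
  exact hψ.1.2.2.trans (hmin hφ)

lemma rightDeriv_hasDeriv {f : ℝ → ℝ} (hf : ConvexOn ℝ (Set.Ioi 0) f) {x : ℝ} (hx : 0 < x) :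
    HasDerivWithinAt f (rightDeriv f x) (Set.Ioi x) x :=
  hf.hasDerivWithinAt_rightDeriv_of_mem_interior (by rw [interior_Ioi]; exact hx)

lemma rightDeriv_mono {f : ℝ → ℝ} (hf : ConvexOn ℝ (Set.Ioi 0) f) {x y : ℝ} (hx : 0 < x)
    (hxy : x ≤ y) : rightDeriv f x ≤ rightDeriv f y := by
  have := hf.monotoneOn_rightDeriv
  rw [interior_Ioi] at this
  exact this hx (lt_of_lt_of_le hx hxy : (0:ℝ) < y) hxy

lemma rightDeriv_intervalIntegrable {f : ℝ → ℝ} (hf : ConvexOn ℝ (Set.Ioi 0) f) {a b : ℝ}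
    (ha : 0 < a) (hab : a ≤ b) : IntervalIntegrable (rightDeriv f) volume a b := by
  apply MonotoneOn.intervalIntegrable
  intro x hx y hy hxy
  rw [uIcc_of_le hab] at hx
  exact rightDeriv_mono hf (ha.trans_le hx.1) hxy

lemma rightDeriv_ftc {f : ℝ → ℝ} (hf : ConvexOn ℝ (Set.Ioi 0) f) {a b : ℝ} (ha : 0 < a)
    (hab : a ≤ b) : ∫ t in a..b, rightDeriv f t = f b - f a := by
  apply intervalIntegral.integral_eq_sub_of_hasDeriv_right
  · rw [uIcc_of_le hab]
    exact (hf.continuousOn isOpen_Ioi).mono fun x hx => ha.trans_le hx.1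
  · intro x hx
    rw [min_eq_left hab] at hx
    exact rightDeriv_hasDeriv hf (ha.trans hx.1)
  · exact rightDeriv_intervalIntegrable hf ha hab

lemma curv_sigmaFinite {f : ℝ → ℝ} {ν : Measure ℝ} (hν : IsCurvatureMeasure f ν) :
    SigmaFinite (ν.restrict (Set.Ioi 0)) := by
  refine ⟨⟨⟨fun n => Set.Iic 0 ∪ Set.Ioc (1 / ((n:ℝ) + 1)) ((n:ℝ) + 1), fun _ => trivial,
    fun n => ?_, ?_⟩⟩⟩
  · refine lt_of_le_of_lt (measure_union_le _ _) (ENNReal.add_lt_top.2 ⟨?_, ?_⟩)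
    · rw [Measure.restrict_apply measurableSet_Iic, Set.Iic_inter_Ioi, Set.Ioc_self]
      simp
    · refine lt_of_le_of_lt (Measure.restrict_apply_le _ _) ?_
      rw [hν _ _ (by positivity)]
      · exact ENNReal.ofReal_lt_top
      · rw [div_le_iff₀ (by positivity)]
        nlinarith [(Nat.cast_nonneg n : (0:ℝ) ≤ n)]
  · rw [Set.eq_univ_iff_forall]
    intro x
    rcases le_or_gt x 0 with hx | hx
    · exact Set.mem_iUnion.2 ⟨0, Or.inl hx⟩
    · obtain ⟨n, hn⟩ := exists_nat_gt (max x (1 / x))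
      refine Set.mem_iUnion.2 ⟨n, Or.inr ⟨?_, ?_⟩⟩
      · have h1 : 1 / x < n := (le_max_right _ _).trans_lt hn
        rw [div_lt_iff₀ hx] at h1
        rw [div_lt_iff₀ (by positivity)]
        nlinarith
      · have h1 : x < n := (le_max_left _ _).trans_lt hn
        linarith

/-- The kernel. -/
def kE (x s : ℝ) : ℝ≥0∞ := if s ≤ 1 then ENNReal.ofReal (s - x) else ENNReal.ofReal (x - s)

lemma kE_measurable : Measurable (Function.uncurry kE) := by
  unfold kE Function.uncurry
  refine Measurable.ite (measurableSet_le measurable_snd measurable_const) ?_ ?_ <;> fun_prop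

lemma kE_measurable_right (x : ℝ) : Measurable (kE x) :=
  kE_measurable.comp (measurable_const.prodMk measurable_id)

lemma kE_repr_ge {f : ℝ → ℝ} (hf : ConvexOn ℝ (Set.Ioi 0) f) {ν : Measure ℝ}
    (hν : IsCurvatureMeasure f ν) {x : ℝ} (hx : 1 ≤ x) :
    ENNReal.ofReal (f x - f 1 - rightDeriv f 1 * (x - 1)) =
      ∫⁻ s in Set.Ioi 0, kE x s ∂ν := by
  have := curv_sigmaFinite hν
  have h1 : f x - f 1 - rightDeriv f 1 * (x - 1)
      = ∫ t in Set.Ioc 1 x, (rightDeriv f t - rightDeriv f 1) := by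
    rw [← intervalIntegral.integral_of_le hx, intervalIntegral.integral_sub
      (rightDeriv_intervalIntegrable hf one_pos hx) (by simp), rightDeriv_ftc hf one_pos hx]
    simp; ring
  have hi : IntegrableOn (fun t => rightDeriv f t - rightDeriv f 1) (Set.Ioc 1 x) := by
    rw [← intervalIntegrable_iff_integrableOn_Ioc_of_le hx]
    exact (rightDeriv_intervalIntegrable hf one_pos hx).sub (by simp)
  rw [h1, ofReal_integral_eq_lintegral_ofReal hi]
  swap
  · filter_upwards [ae_restrict_mem measurableSet_Ioc] with t ht
    exact sub_nonneg.2 (rightDeriv_mono hf one_pos ht.1.le)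
  set A : Set (ℝ × ℝ) := {p | 1 < p.2 ∧ p.2 ≤ p.1} with hA
  have hAm : MeasurableSet A :=
    (measurableSet_lt measurable_const measurable_snd).inter
      (measurableSet_le measurable_snd measurable_fst)
  calc ∫⁻ t in Set.Ioc 1 x, ENNReal.ofReal (rightDeriv f t - rightDeriv f 1)
      = ∫⁻ t in Set.Ioc 1 x, ∫⁻ s in Set.Ioi 0, A.indicator 1 (t, s) ∂ν := by
        refine setLIntegral_congr_fun measurableSet_Ioc fun t ht => ?_
        have e : (fun s => A.indicator (1 : ℝ × ℝ → ℝ≥0∞) (t, s))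
            = (Set.Ioc 1 t).indicator 1 := by
          ext s
          simp only [Set.indicator, hA, Set.mem_ofPred_eq, Set.mem_Ioc, Pi.one_apply]
        simp only [e]
        rw [lintegral_indicator_one measurableSet_Ioc, Measure.restrict_apply measurableSet_Ioc,
          Set.inter_eq_left.2 (show Set.Ioc 1 t ⊆ Set.Ioi 0 from fun s hs => one_pos.trans hs.1),
          hν 1 t one_pos ht.1.le]
    _ = ∫⁻ s in Set.Ioi 0, (∫⁻ t in Set.Ioc 1 x, A.indicator 1 (t, s)) ∂ν := by
        rw [lintegral_lintegral_swap]
        exact (measurable_one.indicator hAm).aemeasurable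
    _ = ∫⁻ s in Set.Ioi 0, kE x s ∂ν := by
        refine setLIntegral_congr_fun measurableSet_Ioi fun s hs => ?_
        by_cases h : s ≤ 1
        · have e : (fun t => A.indicator (1 : ℝ × ℝ → ℝ≥0∞) (t, s)) = 0 := by
            ext t
            simp [Set.indicator, hA, h.not_gt]
          simp only [e, kE, h, if_true]
          rw [ENNReal.ofReal_of_nonpos (by linarith)]
          exact lintegral_zero
        · have h' : 1 < s := not_le.1 h
          have e : (fun t => A.indicator (1 : ℝ × ℝ → ℝ≥0∞) (t, s)) = (Set.Ici s).indicator 1 := by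
            ext t
            simp [Set.indicator, hA, h']
          simp only [e, kE, h, if_false]
          rw [lintegral_indicator_one measurableSet_Ici, Measure.restrict_apply measurableSet_Ici]
          have : Set.Ici s ∩ Set.Ioc 1 x = Set.Icc s x := by
            ext t
            simp only [Set.mem_inter_iff, Set.mem_Ici, Set.mem_Ioc, Set.mem_Icc]
            exact ⟨fun h => ⟨h.1, h.2.2⟩, fun h => ⟨h.1, by linarith [h.1], h.2⟩⟩
          rw [this, Real.volume_Icc]

lemma kE_repr_le {f : ℝ → ℝ} (hf : ConvexOn ℝ (Set.Ioi 0) f) {ν : Measure ℝ}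
    (hν : IsCurvatureMeasure f ν) {x : ℝ} (hx0 : 0 < x) (hx : x ≤ 1) :
    ENNReal.ofReal (f x - f 1 - rightDeriv f 1 * (x - 1)) =
      ∫⁻ s in Set.Ioi 0, kE x s ∂ν := by
  have := curv_sigmaFinite hν
  have h1 : f x - f 1 - rightDeriv f 1 * (x - 1)
      = ∫ t in Set.Ioc x 1, (rightDeriv f 1 - rightDeriv f t) := by
    rw [← intervalIntegral.integral_of_le hx, intervalIntegral.integral_sub (by simp)
      (rightDeriv_intervalIntegrable hf hx0 hx), rightDeriv_ftc hf hx0 hx]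
    simp; ring
  have hi : IntegrableOn (fun t => rightDeriv f 1 - rightDeriv f t) (Set.Ioc x 1) := by
    rw [← intervalIntegrable_iff_integrableOn_Ioc_of_le hx]
    exact IntervalIntegrable.sub (by simp) (rightDeriv_intervalIntegrable hf hx0 hx)
  rw [h1, ofReal_integral_eq_lintegral_ofReal hi]
  swap
  · filter_upwards [ae_restrict_mem measurableSet_Ioc] with t ht
    exact sub_nonneg.2 (rightDeriv_mono hf (hx0.trans ht.1) ht.2)
  set A : Set (ℝ × ℝ) := {p | p.1 < p.2 ∧ p.2 ≤ 1} with hA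
  have hAm : MeasurableSet A :=
    (measurableSet_lt measurable_fst measurable_snd).inter
      (measurableSet_le measurable_snd measurable_const)
  calc ∫⁻ t in Set.Ioc x 1, ENNReal.ofReal (rightDeriv f 1 - rightDeriv f t)
      = ∫⁻ t in Set.Ioc x 1, ∫⁻ s in Set.Ioi 0, A.indicator 1 (t, s) ∂ν := by
        refine setLIntegral_congr_fun measurableSet_Ioc fun t ht => ?_
        have e : (fun s => A.indicator (1 : ℝ × ℝ → ℝ≥0∞) (t, s))
            = (Set.Ioc t 1).indicator 1 := by
          ext s
          simp only [Set.indicator, hA, Set.mem_ofPred_eq, Set.mem_Ioc, Pi.one_apply]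
        simp only [e]
        rw [lintegral_indicator_one measurableSet_Ioc, Measure.restrict_apply measurableSet_Ioc,
          Set.inter_eq_left.2 (show Set.Ioc t 1 ⊆ Set.Ioi 0 from
            fun s hs => (hx0.trans ht.1).trans hs.1),
          hν t 1 (hx0.trans ht.1) ht.2]
    _ = ∫⁻ s in Set.Ioi 0, (∫⁻ t in Set.Ioc x 1, A.indicator 1 (t, s)) ∂ν := by
        rw [lintegral_lintegral_swap]
        exact (measurable_one.indicator hAm).aemeasurable
    _ = ∫⁻ s in Set.Ioi 0, kE x s ∂ν := by
        refine setLIntegral_congr_fun measurableSet_Ioi fun s hs => ?_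
        by_cases h : s ≤ 1
        · have e : (fun t => A.indicator (1 : ℝ × ℝ → ℝ≥0∞) (t, s)) = (Set.Iio s).indicator 1 := by
            ext t
            simp [Set.indicator, hA, h]
          simp only [e, kE, h, if_true]
          rw [lintegral_indicator_one measurableSet_Iio, Measure.restrict_apply measurableSet_Iio]
          have : Set.Iio s ∩ Set.Ioc x 1 = Set.Ioo x s := by
            ext t
            simp only [Set.mem_inter_iff, Set.mem_Iio, Set.mem_Ioc, Set.mem_Ioo]
            exact ⟨fun h => ⟨h.2.1, h.1⟩, fun h' => ⟨h'.2, h'.1, by linarith [h'.2]⟩⟩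
          rw [this, Real.volume_Ioo]
        · have e : (fun t => A.indicator (1 : ℝ × ℝ → ℝ≥0∞) (t, s)) = 0 := by
            ext t
            simp [Set.indicator, hA, h]
          simp only [e, kE, h, if_false]
          rw [ENNReal.ofReal_of_nonpos (by linarith)]
          exact lintegral_zero

lemma kE_repr {f : ℝ → ℝ} (hf : ConvexOn ℝ (Set.Ioi 0) f) {ν : Measure ℝ}
    (hν : IsCurvatureMeasure f ν) {x : ℝ} (hx0 : 0 < x) :
    ENNReal.ofReal (f x - f 1 - rightDeriv f 1 * (x - 1)) =
      ∫⁻ s in Set.Ioi 0, kE x s ∂ν := by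
  rcases le_total x 1 with h | h
  · exact kE_repr_le hf hν hx0 h
  · exact kE_repr_ge hf hν h

lemma g_nonneg {f : ℝ → ℝ} (hf : ConvexOn ℝ (Set.Ioi 0) f) {x : ℝ} (hx0 : 0 < x) :
    0 ≤ f x - f 1 - rightDeriv f 1 * (x - 1) := by
  have hc : rightDeriv f 1 * (x - 1) = ∫ _ in (1:ℝ)..x, rightDeriv f 1 := by simp; ring
  rcases le_total x 1 with h | h
  · have h1 := rightDeriv_ftc hf hx0 h
    have h2 : ∫ t in x..1, rightDeriv f t ≤ ∫ _ in x..1, rightDeriv f 1 :=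
      intervalIntegral.integral_mono_on h (rightDeriv_intervalIntegrable hf hx0 h) (by simp)
        fun t ht => rightDeriv_mono hf (hx0.trans_le ht.1) ht.2
    simp at h2
    nlinarith
  · have h1 := rightDeriv_ftc hf one_pos h
    have h2 : ∫ _ in 1..x, rightDeriv f 1 ≤ ∫ t in 1..x, rightDeriv f t :=
      intervalIntegral.integral_mono_on h (by simp) (rightDeriv_intervalIntegrable hf one_pos h)
        fun t ht => rightDeriv_mono hf one_pos ht.1
    simp at h2
    nlinarith

lemma lint_tendsto {ι : Type*} {l : Filter ι} [l.IsCountablyGenerated] [l.NeBot] {μ : Measure ℝ}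
    {F : ι → ℝ → ℝ≥0∞} {G : ℝ → ℝ≥0∞} (hm : ∀ i, Measurable (F i))
    (hle : ∀ᶠ i in l, ∀ s, F i s ≤ G s) (hl : ∀ s, Tendsto (fun i => F i s) l (𝓝 (G s))) :
    Tendsto (fun i => ∫⁻ s, F i s ∂μ) l (𝓝 (∫⁻ s, G s ∂μ)) := by
  refine tendsto_of_le_liminf_of_limsup_le ?_ ?_
  · refine le_trans (le_of_eq ?_) (lintegral_liminf_le hm)
    exact lintegral_congr fun s => (hl s).liminf_eq.symm
  · refine limsup_le_of_le (by isBoundedDefault) ?_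
    filter_upwards [hle] with i hi
    exact lintegral_mono hi

lemma ereal_tendsto_add {ι : Type*} {l : Filter ι} {u v : ι → EReal} {a b : EReal}
    (hu : Tendsto u l (𝓝 a)) (hv : Tendsto v l (𝓝 b)) (h : a ≠ ⊤ ∨ b ≠ ⊥) (h' : a ≠ ⊥ ∨ b ≠ ⊤) :
    Tendsto (fun i => u i + v i) l (𝓝 (a + b)) :=
  (EReal.continuousAt_add (p := (a, b)) h h').tendsto.comp (hu.prodMk_nhds hv)

lemma limAtZero_eq {f : ℝ → ℝ} (hf : ConvexOn ℝ (Set.Ioi 0) f) {ν : Measure ℝ}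
    (hf1 : f 1 = 0) (hν : IsCurvatureMeasure f ν) :
    limAtZero f = ((∫⁻ s in Set.Ioi 0, kE 0 s ∂ν : ℝ≥0∞) : EReal)
      + ((-rightDeriv f 1 : ℝ) : EReal) := by
  have h1 : Tendsto (fun x => ∫⁻ s in Set.Ioi 0, kE x s ∂ν) (𝓝[>] 0)
      (𝓝 (∫⁻ s in Set.Ioi 0, kE 0 s ∂ν)) := by
    refine lint_tendsto kE_measurable_right ?_ fun s => ?_
    · have : Set.Ioo (0:ℝ) 1 ∈ 𝓝[>] (0:ℝ) := Ioo_mem_nhdsGT one_pos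
      filter_upwards [this] with x hx s
      unfold kE
      split_ifs with h
      · exact ENNReal.ofReal_le_ofReal (by linarith [hx.1])
      · rw [ENNReal.ofReal_of_nonpos (by linarith [hx.2])]; simp
    · refine Tendsto.mono_left ?_ nhdsWithin_le_nhds
      have : Continuous (fun x => kE x s) := by
        unfold kE; split_ifs <;> exact ENNReal.continuous_ofReal.comp (by fun_prop)
      exact this.tendsto 0
  have h2 : Tendsto (fun x : ℝ => ((rightDeriv f 1 * (x - 1) : ℝ) : EReal)) (𝓝[>] 0)
      (𝓝 ((-rightDeriv f 1 : ℝ) : EReal)) := by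
    refine Tendsto.mono_left ?_ nhdsWithin_le_nhds
    have : Continuous (fun x : ℝ => ((rightDeriv f 1 * (x - 1) : ℝ) : EReal)) :=
      continuous_coe_real_ereal.comp (by fun_prop)
    convert this.tendsto 0 using 2
    simp
  have h3 := (continuous_coe_ennreal_ereal.tendsto _).comp h1
  have h4 := ereal_tendsto_add h3 h2 (Or.inr (by simp)) (Or.inr (by simp))
  refine Tendsto.limsup_eq (h4.congr' ?_)
  filter_upwards [self_mem_nhdsWithin] with x hx
  have hx : 0 < x := hx
  simp only [Function.comp]
  rw [← kE_repr hf hν hx, EReal.coe_ennreal_ofReal, max_eq_left (g_nonneg hf hx),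
    ← EReal.coe_add, hf1]
  congr 1; ring

lemma derivAtTop_eq {f : ℝ → ℝ} (hf : ConvexOn ℝ (Set.Ioi 0) f) {ν : Measure ℝ}
    (hf1 : f 1 = 0) (hν : IsCurvatureMeasure f ν) :
    derivAtTop f = ((∫⁻ s in Set.Ioi 0, (Set.Ioi (1:ℝ)).indicator 1 s ∂ν : ℝ≥0∞) : EReal)
      + ((rightDeriv f 1 : ℝ) : EReal) := by
  have h1 : Tendsto (fun x => ∫⁻ s in Set.Ioi 0, ENNReal.ofReal x⁻¹ * kE x s ∂ν) atTop
      (𝓝 (∫⁻ s in Set.Ioi 0, (Set.Ioi (1:ℝ)).indicator 1 s ∂ν)) := by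
    refine lint_tendsto (fun x => (kE_measurable_right x).const_mul _) ?_ fun s => ?_
    · filter_upwards [eventually_ge_atTop 1] with x hx s
      unfold kE
      split_ifs with h
      · rw [ENNReal.ofReal_of_nonpos (p := s - x) (by linarith)]; simp
      · have h' : 1 < s := not_le.1 h
        rw [← ENNReal.ofReal_mul (by positivity)]
        simp only [Set.indicator, Set.mem_Ioi, h', if_true, Pi.one_apply]
        rw [ENNReal.ofReal_le_one, inv_mul_le_iff₀ (by linarith)]
        linarith
    · by_cases h : s ≤ 1
      · simp only [Set.indicator, Set.mem_Ioi, not_lt.2 h, if_false]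
        refine tendsto_const_nhds.congr' ?_
        filter_upwards [eventually_ge_atTop 1] with x hx
        simp only [kE, h, if_true]
        rw [ENNReal.ofReal_of_nonpos (p := s - x) (by linarith)]; simp
      · simp only [Set.indicator, Set.mem_Ioi, not_le.1 h, if_true, Pi.one_apply]
        have t1 : Tendsto (fun x : ℝ => 1 - s * x⁻¹) atTop (𝓝 (1 - s * 0)) :=
          tendsto_const_nhds.sub (tendsto_inv_atTop_zero.const_mul s)
        have t2 := (ENNReal.continuous_ofReal.tendsto _).comp t1
        simp only [mul_zero, sub_zero, ENNReal.ofReal_one] at t2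
        refine t2.congr' ?_
        filter_upwards [eventually_ge_atTop 1] with x hx
        simp only [kE, h, if_false, Function.comp]
        rw [← ENNReal.ofReal_mul (by positivity)]
        congr 1
        have : x ≠ 0 := by positivity
        field_simp
  have h2 : Tendsto (fun x : ℝ => ((rightDeriv f 1 * (1 - x⁻¹) : ℝ) : EReal)) atTop
      (𝓝 ((rightDeriv f 1 : ℝ) : EReal)) := by
    have t1 : Tendsto (fun x : ℝ => rightDeriv f 1 * (1 - x⁻¹)) atTop
        (𝓝 (rightDeriv f 1 * (1 - 0))) :=
      (tendsto_const_nhds.sub tendsto_inv_atTop_zero).const_mul _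
    have := (continuous_coe_real_ereal.tendsto _).comp t1
    simpa using! this
  have h3 := (continuous_coe_ennreal_ereal.tendsto _).comp h1
  have h4 := ereal_tendsto_add h3 h2 (Or.inr (by simp)) (Or.inr (by simp))
  refine Tendsto.limsup_eq (h4.congr' ?_)
  filter_upwards [eventually_ge_atTop 1] with x hx
  have hx0 : 0 < x := by linarith
  simp only [Function.comp]
  rw [lintegral_const_mul _ (kE_measurable_right x), ← kE_repr hf hν hx0,
    ← ENNReal.ofReal_mul (by positivity), EReal.coe_ennreal_ofReal,
    max_eq_left (mul_nonneg (by positivity) (g_nonneg hf hx0)), ← EReal.coe_add, hf1]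
  congr 1
  field_simp
  ring

/-- The `ψ` function of a pair of measures. -/
def psiR {Ω : Type*} [MeasurableSpace Ω] (P Q : Measure Ω) (s : ℝ) : ℝ :=
  ∫ x, min (P.rnDeriv Q x).toReal (max s 0) ∂Q

section FD

variable {Ω : Type*} [MeasurableSpace Ω] (P Q : Measure Ω) [IsProbabilityMeasure P]
  [IsProbabilityMeasure Q]

lemma rn_sum : (∫⁻ x, P.rnDeriv Q x ∂Q) + P.singularPart Q Set.univ = 1 := by
  have h := congrArg (fun μ => μ Set.univ) (P.haveLebesgueDecomposition_add Q)
  simp only [measure_univ, Measure.add_apply, withDensity_apply _ MeasurableSet.univ,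
    Measure.restrict_univ] at h
  rw [add_comm, ← h]

lemma rn_integrable : Integrable (fun x => (P.rnDeriv Q x).toReal) Q :=
  Measure.integrable_toReal_rnDeriv

lemma rn_sum_real :
    (∫ x, (P.rnDeriv Q x).toReal ∂Q) + (P.singularPart Q Set.univ).toReal = 1 := by
  rw [integral_toReal (P.measurable_rnDeriv Q).aemeasurable (P.rnDeriv_lt_top Q),
    ← ENNReal.toReal_add]
  · rw [rn_sum]; simp
  · intro h; have := rn_sum P Q; simp [h] at this
  · intro h; have := rn_sum P Q; simp [h] at this

lemma min_integrable (s : ℝ) :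
    Integrable (fun x => min (P.rnDeriv Q x).toReal (max s 0)) Q :=
  (rn_integrable P Q).inf (integrable_const _)

lemma psiR_mem : psiR P Q ∈ Cclass := by
  refine ⟨fun s hs => ?_, ⟨convex_Ici 0, ?_⟩, ?_, fun s hs => ?_, fun s hs => ?_⟩
  · exact integral_nonneg fun x => le_min ENNReal.toReal_nonneg (le_max_right _ _)
  · intro x hx y hy a b ha hb hab
    have hx : 0 ≤ x := hx
    have hy : 0 ≤ y := hy
    simp only [smul_eq_mul, psiR]
    rw [← integral_const_mul, ← integral_const_mul,
      ← integral_add ((min_integrable P Q x).const_mul a) ((min_integrable P Q y).const_mul b)]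
    refine integral_mono (((min_integrable P Q x).const_mul a).add
      ((min_integrable P Q y).const_mul b)) (min_integrable P Q _) fun w => ?_
    simp only
    have hz : 0 ≤ a * x + b * y := by positivity
    rw [max_eq_left hx, max_eq_left hy, max_eq_left hz]
    set r := (P.rnDeriv Q w).toReal
    refine le_min ?_ ?_
    · calc _ ≤ a * r + b * r := by gcongr <;> exact min_le_left _ _
        _ = r := by rw [← add_mul, hab, one_mul]
    · gcongr <;> exact min_le_right _ _
  · intro x hx y hy hxy
    refine integral_mono (min_integrable P Q x) (min_integrable P Q y) fun w => ?_
    exact min_le_min le_rfl (max_le_max hxy le_rfl)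
  · refine le_min ?_ ?_
    · have h := rn_sum_real P Q
      have h2 : psiR P Q s ≤ ∫ x, (P.rnDeriv Q x).toReal ∂Q :=
        integral_mono (min_integrable P Q s) (rn_integrable P Q) fun w => min_le_left _ _
      have := ENNReal.toReal_nonneg (a := P.singularPart Q Set.univ)
      linarith
    · have h2 : psiR P Q s ≤ ∫ _, s ∂Q :=
        integral_mono (min_integrable P Q s) (integrable_const _) fun w => by
          simp only
          rw [max_eq_left hs]
          exact min_le_right _ _
      simpa using h2
  · unfold psiR
    rw [max_eq_right hs.le]
    simp

lemma kE_int {s : ℝ} (hs : 0 < s) :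
    (∫⁻ x, kE (P.rnDeriv Q x).toReal s ∂Q) +
      (Set.Ioi (1:ℝ)).indicator 1 s * P.singularPart Q Set.univ
      = ENNReal.ofReal (min 1 s - psiR P Q s) := by
  have hi := min_integrable P Q s
  rw [max_eq_left hs.le] at hi
  have hψ : psiR P Q s = ∫ x, min (P.rnDeriv Q x).toReal s ∂Q := by
    unfold psiR; rw [max_eq_left hs.le]
  by_cases h : s ≤ 1
  · simp only [kE, h, if_true, Set.indicator, Set.mem_Ioi, not_lt.2 h, if_false, zero_mul,
      add_zero, min_eq_right]
    have e : s - psiR P Q s = ∫ x, (s - min (P.rnDeriv Q x).toReal s) ∂Q := by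
      rw [integral_sub (integrable_const _) hi, hψ]; simp
    rw [e, ofReal_integral_eq_lintegral_ofReal
      (f := fun x => s - min (P.rnDeriv Q x).toReal s) ((integrable_const _).sub hi)
      (Eventually.of_forall fun x => sub_nonneg.2 (min_le_right _ _))]
    refine lintegral_congr fun x => ?_
    rcases le_total (P.rnDeriv Q x).toReal s with h1 | h1
    · rw [min_eq_left h1]
    · rw [min_eq_right h1, sub_self, ENNReal.ofReal_of_nonpos (by linarith)]; simp
  · have h' := not_le.1 h
    simp only [kE, h, if_false, Set.indicator, Set.mem_Ioi, h', if_true, Pi.one_apply, one_mul]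
    rw [min_eq_left h'.le]
    have hσ : P.singularPart Q Set.univ ≠ ⊤ := by
      intro h; have := rn_sum P Q; simp [h] at this
    have e0 : ∫⁻ x, ENNReal.ofReal ((P.rnDeriv Q x).toReal - s) ∂Q
        = ENNReal.ofReal (∫ x, ((P.rnDeriv Q x).toReal - min (P.rnDeriv Q x).toReal s) ∂Q) := by
      rw [ofReal_integral_eq_lintegral_ofReal
        (f := fun x => (P.rnDeriv Q x).toReal - min (P.rnDeriv Q x).toReal s) ((rn_integrable P Q).sub hi)
        (Eventually.of_forall fun x => sub_nonneg.2 (min_le_left _ _))]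
      refine lintegral_congr fun x => ?_
      rcases le_total (P.rnDeriv Q x).toReal s with h1 | h1
      · rw [min_eq_left h1, sub_self, ENNReal.ofReal_of_nonpos (by linarith)]; simp
      · rw [min_eq_right h1]
    have hnn : 0 ≤ ∫ x, ((P.rnDeriv Q x).toReal - min (P.rnDeriv Q x).toReal s) ∂Q :=
      integral_nonneg fun x => sub_nonneg.2 (min_le_left _ _)
    rw [e0, ← ENNReal.ofReal_toReal hσ, ← ENNReal.ofReal_add hnn ENNReal.toReal_nonneg,
      integral_sub (rn_integrable P Q) hi, hψ, ← rn_sum_real P Q]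
    congr 1; ring

lemma G_measurable {ν : Measure ℝ} [SFinite (ν.restrict (Set.Ioi 0))] :
    Measurable (fun y => ∫⁻ s in Set.Ioi 0, kE y s ∂ν) :=
  Measurable.lintegral_prod_right kE_measurable

lemma Ifun_psiR {ν : Measure ℝ} [SFinite (ν.restrict (Set.Ioi 0))] :
    Ifun ν (psiR P Q) = (∫⁻ x, ∫⁻ s in Set.Ioi 0, kE (P.rnDeriv Q x).toReal s ∂ν ∂Q) +
      (∫⁻ s in Set.Ioi 0, (Set.Ioi (1:ℝ)).indicator 1 s ∂ν) * P.singularPart Q Set.univ := by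
  have hm : Measurable (Function.uncurry fun (x : Ω) (s : ℝ) =>
      kE (P.rnDeriv Q x).toReal s) := by
    have h1 : Measurable fun p : Ω × ℝ => ((P.rnDeriv Q p.1).toReal, p.2) :=
      (((P.measurable_rnDeriv Q).comp measurable_fst).ennreal_toReal).prodMk measurable_snd
    exact kE_measurable.comp h1
  rw [lintegral_lintegral_swap hm.aemeasurable, ← lintegral_mul_const,
    ← lintegral_add_left]
  · refine setLIntegral_congr_fun measurableSet_Ioi fun s hs => ?_
    exact (kE_int P Q hs).symm
  · exact hm.lintegral_prod_left'
  · exact measurable_one.indicator measurableSet_Ioi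

lemma ereal_distrib (K : ℝ≥0∞) (c : ℝ) (q : ℝ≥0∞) (hq : q ≠ ⊤) :
    ((K : EReal) + (c : EReal)) * (q : EReal) = ((K * q : ℝ≥0∞) : EReal) + ((c * q.toReal : ℝ) : EReal) := by
  rw [EReal.right_distrib_of_nonneg_of_ne_top (EReal.coe_ennreal_nonneg q) (by simpa using hq),
    EReal.coe_ennreal_mul, EReal.coe_mul]
  congr 2
  exact (EReal.coe_ennreal_toReal hq).symm

lemma fDiv_eq {f : ℝ → ℝ} (hf : ConvexOn ℝ (Set.Ioi 0) f) (hf1 : f 1 = 0) {ν : Measure ℝ}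
    (hν : IsCurvatureMeasure f ν) :
    fDiv f P Q = ((Ifun ν (psiR P Q) : ℝ≥0∞) : EReal) := by
  have := curv_sigmaFinite hν
  set G : ℝ → ℝ≥0∞ := fun y => ∫⁻ s in Set.Ioi 0, kE y s ∂ν with hG
  have hGm : Measurable G := G_measurable
  set c := rightDeriv f 1 with hc
  set r : Ω → ℝ := fun x => (P.rnDeriv Q x).toReal with hr
  have hrm : Measurable r := (P.measurable_rnDeriv Q).ennreal_toReal
  set E : Set Ω := {x | P.rnDeriv Q x ≠ 0} with hE
  have hEm : MeasurableSet E := (measurableSet_eq_fun (P.measurable_rnDeriv Q)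
    measurable_const).compl
  have hEc : Eᶜ = {x | P.rnDeriv Q x = 0} := by ext x; simp [hE]
  set L := ∫⁻ x in E, G (r x) ∂Q with hL
  have hpos : ∀ᵐ x ∂(Q.restrict E), 0 < r x := by
    filter_upwards [ae_restrict_mem hEm, ae_restrict_of_ae (P.rnDeriv_lt_top Q)] with x h1 h2
    exact ENNReal.toReal_pos h1 h2.ne
  have hfr : ∀ᵐ x ∂(Q.restrict E), f (r x) = (G (r x)).toReal + c * (r x - 1) := by
    filter_upwards [hpos] with x hx
    rw [hG]
    simp only
    rw [← kE_repr hf hν hx, ENNReal.toReal_ofReal (g_nonneg hf hx), hf1]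
    ring
  have hGfin : ∀ᵐ x ∂(Q.restrict E), G (r x) < ⊤ := by
    filter_upwards [hpos] with x hx
    rw [hG]
    simp only
    rw [← kE_repr hf hν hx]
    exact ENNReal.ofReal_lt_top
  have hintg : Integrable (fun x => c * (r x - 1)) (Q.restrict E) :=
    ((((rn_integrable P Q).sub (integrable_const 1)).const_mul c)).restrict
  have hR : ∫ x in E, r x ∂Q = ∫ x, r x ∂Q := by
    refine setIntegral_eq_integral_of_forall_compl_eq_zero fun x hx => ?_
    have : P.rnDeriv Q x = 0 := by simpa [hE] using hx
    simp [hr, this]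
  have hT1 : (if Integrable (fun x => f (r x)) (Q.restrict E)
      then ((∫ x in E, f (r x) ∂Q : ℝ) : EReal) else (⊤ : EReal))
      = (L : EReal) + ((c * ((∫ x, r x ∂Q) - (Q E).toReal) : ℝ) : EReal) := by
    by_cases hLt : L = ⊤
    · rw [if_neg, hLt]
      · rw [EReal.coe_ennreal_top, EReal.top_add_coe]
      · intro hi
        have h2 : Integrable (fun x => (G (r x)).toReal) (Q.restrict E) := by
          refine (hi.sub hintg).congr ?_
          filter_upwards [hfr] with x hx
          simp [hx]
        have h3 := h2.lintegral_lt_top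
        refine h3.ne (Eq.trans ?_ hLt)
        refine lintegral_congr_ae ?_
        filter_upwards [hGfin] with x hx
        exact ENNReal.ofReal_toReal hx.ne
    · have h2 : Integrable (fun x => (G (r x)).toReal) (Q.restrict E) :=
        integrable_toReal_of_lintegral_ne_top (hGm.comp hrm).aemeasurable hLt
      have h3 : Integrable (fun x => f (r x)) (Q.restrict E) :=
        (h2.add hintg).congr (by filter_upwards [hfr] with x hx; simp [hx])
      rw [if_pos h3, integral_congr_ae hfr, integral_add h2 hintg,
        integral_toReal (f := fun x => G (r x)) (hGm.comp hrm).aemeasurable hGfin, integral_const_mul,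
        integral_sub (rn_integrable P Q).restrict (integrable_const 1), hR, EReal.coe_add,
        EReal.coe_ennreal_toReal hLt]
      simp [Measure.real]
  have hσ : P.singularPart Q Set.univ ≠ ⊤ := by
    intro h; have := rn_sum P Q; simp [h] at this
  have hsplit : ∫⁻ x, G (r x) ∂Q = L + G 0 * Q Eᶜ := by
    rw [← lintegral_add_compl _ hEm, hL]
    congr 1
    rw [← setLIntegral_const]
    refine setLIntegral_congr_fun hEm.compl fun x hx => ?_
    have : P.rnDeriv Q x = 0 := by simpa [hE] using hx
    simp [hr, this]
  have hq : (Q E).toReal + (Q Eᶜ).toReal = 1 := by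
    rw [← ENNReal.toReal_add (measure_ne_top _ _) (measure_ne_top _ _), measure_add_measure_compl hEm]
    simp
  have hs1 := rn_sum_real P Q
  unfold fDiv
  rw [← hEc, hT1, limAtZero_eq hf hf1 hν, derivAtTop_eq hf hf1 hν,
    ereal_distrib _ _ _ (measure_ne_top _ _), ereal_distrib _ _ _ hσ, Ifun_psiR]
  have hz : c * ((∫ x, r x ∂Q) - (Q E).toReal) + -c * (Q Eᶜ).toReal
      + c * (P.singularPart Q Set.univ).toReal = 0 := by
    linear_combination c * hs1 - c * hq
  have key : ∀ (a b d : EReal) (x y z : ℝ), x + y + z = 0 →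
      (a + (x:EReal)) + (b + (y:EReal)) + (d + (z:EReal)) = a + b + d := by
    intro a b d x y z h
    calc (a + (x:EReal)) + (b + (y:EReal)) + (d + (z:EReal))
        = (a + b + d) + ((x:EReal) + y + z) := by ac_rfl
      _ = a + b + d := by
        rw [← EReal.coe_add, ← EReal.coe_add, h]; simp
  rw [key _ _ _ _ _ _ hz, ← EReal.coe_ennreal_add, ← EReal.coe_ennreal_add]
  change _ = (((∫⁻ x, G (r x) ∂Q) + _ : ℝ≥0∞) : EReal)
  rw [hsplit]

end FD

/-- Global antitone version of the right derivative of `ψ`. -/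
def HH (ψ : ℝ → ℝ) (t : ℝ) : ℝ := if t ≤ 0 then 1 else -rightDeriv (-ψ) t

lemma neg_convex {ψ : ℝ → ℝ} (h : ψ ∈ Cclass) : ConvexOn ℝ (Set.Ioi 0) (-ψ) :=
  (h.2.1.subset Set.Ioi_subset_Ici_self (convex_Ioi 0)).neg

lemma HH_bounds {ψ : ℝ → ℝ} (h : ψ ∈ Cclass) {t : ℝ} (ht : 0 < t) :
    0 ≤ -rightDeriv (-ψ) t ∧ -rightDeriv (-ψ) t ≤ 1 := by
  have hc := neg_convex h
  constructor
  · have h1 := rightDeriv_ftc hc ht (show t ≤ t + 1 by linarith)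
    have h2 : ∫ _ in t..(t+1), rightDeriv (-ψ) t ≤ ∫ x in t..(t+1), rightDeriv (-ψ) x :=
      intervalIntegral.integral_mono_on (by linarith) (by simp)
        (rightDeriv_intervalIntegrable hc ht (by linarith))
        fun x hx => rightDeriv_mono hc ht hx.1
    have h3 := Cclass_monotone h (show t ≤ t + 1 by linarith)
    simp at h2 h1
    linarith
  · by_contra hcon
    push Not at hcon
    set H := -rightDeriv (-ψ) t with hH
    set a := (H - 1) * t / (2 * H) with ha
    have hH0 : 0 < H := by linarith
    have ha0 : 0 < a := by
      have : 0 < H - 1 := by linarith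
      positivity
    have haH : a * (2 * H) = (H - 1) * t := by rw [ha]; field_simp
    have hat : a ≤ t := by nlinarith
    have h1 := rightDeriv_ftc hc ha0 hat
    have h2 : ∫ x in a..t, rightDeriv (-ψ) x ≤ ∫ _ in a..t, rightDeriv (-ψ) t :=
      intervalIntegral.integral_mono_on hat (rightDeriv_intervalIntegrable hc ha0 hat) (by simp)
        fun x hx => rightDeriv_mono hc (ha0.trans_le hx.1) hx.2
    have h3 := h.1 a ha0.le
    have h4 := (h.2.2.2.1 t ht.le).trans (min_le_right _ _)
    simp at h2 h1
    have h5 : rightDeriv (-ψ) t = -H := by rw [hH]; ring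
    rw [h5] at h2
    nlinarith

lemma HH_mem {ψ : ℝ → ℝ} (h : ψ ∈ Cclass) (t : ℝ) : 0 ≤ HH ψ t ∧ HH ψ t ≤ 1 := by
  unfold HH
  split_ifs with ht
  · simp
  · exact HH_bounds h (not_le.1 ht)

lemma HH_antitone {ψ : ℝ → ℝ} (h : ψ ∈ Cclass) : Antitone (HH ψ) := by
  intro a b hab
  by_cases ha : a ≤ 0
  · rw [show HH ψ a = 1 by simp [HH, ha]]
    exact (HH_mem h b).2
  · have ha' := not_le.1 ha
    have hb : ¬ b ≤ 0 := not_le.2 (ha'.trans_le hab)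
    simp only [HH, ha, hb, if_false]
    exact neg_le_neg (rightDeriv_mono (neg_convex h) ha' hab)

lemma HH_int {ψ : ℝ → ℝ} (h : ψ ∈ Cclass) {s : ℝ} (hs : 0 ≤ s) :
    ∫⁻ t in Set.Ioc 0 s, ENNReal.ofReal (HH ψ t) = ENNReal.ofReal (ψ s) := by
  have hii : IntervalIntegrable (HH ψ) volume 0 s := (HH_antitone h).intervalIntegrable
  have e : ∫ t in (0:ℝ)..s, HH ψ t = ψ s - ψ 0 := by
    apply intervalIntegral.integral_eq_sub_of_hasDeriv_right
    · rw [uIcc_of_le hs]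
      intro x hx
      rcases hx.1.eq_or_lt with h0 | h0
      · rw [← h0]
        refine ContinuousWithinAt.mono (t := Set.Ici 0) ?_ (fun y hy => hy.1)
        unfold ContinuousWithinAt
        rw [Cclass_zero h]
        have t1 : Tendsto (fun x : ℝ => x) (𝓝[Set.Ici 0] 0) (𝓝 0) :=
          tendsto_id.mono_left nhdsWithin_le_nhds
        refine tendsto_of_tendsto_of_tendsto_of_le_of_le' tendsto_const_nhds t1 ?_ ?_
        · filter_upwards [self_mem_nhdsWithin] with y hy using h.1 y hy
        · filter_upwards [self_mem_nhdsWithin] with y hy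
          exact (h.2.2.2.1 y hy).trans (min_le_right _ _)
      · exact (Cclass_continuousAt h h0).continuousWithinAt
    · intro x hx
      rw [min_eq_left hs] at hx
      have h1 := (rightDeriv_hasDeriv (neg_convex h) hx.1).neg
      rw [neg_neg] at h1
      simpa [HH, not_le.2 hx.1] using h1
    · exact hii
  rw [Cclass_zero h, sub_zero, intervalIntegral.integral_of_le hs] at e
  rw [← e, ofReal_integral_eq_lintegral_ofReal]
  · exact (intervalIntegrable_iff_integrableOn_Ioc_of_le hs).1 hii
  · exact Eventually.of_forall fun t => (HH_mem h t).1

/-- The quantile function. -/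
def qf (ψ : ℝ → ℝ) (u : ℝ) : ℝ≥0∞ := volume (Set.Ioi 0 ∩ {t | u < HH ψ t})

lemma qf_measurable (ψ : ℝ → ℝ) : Measurable (qf ψ) := by
  apply Antitone.measurable
  intro u v huv
  refine measure_mono fun t ht => ⟨ht.1, ?_⟩
  exact lt_of_le_of_lt huv ht.2

lemma qf_min {ψ : ℝ → ℝ} (h : ψ ∈ Cclass) (u s : ℝ) :
    min (qf ψ u) (ENNReal.ofReal s) = volume (Set.Ioc 0 s ∩ {t | u < HH ψ t}) := by
  have hv : volume (Set.Ioc 0 s) = ENNReal.ofReal s := by simp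
  by_cases hall : ∀ t ∈ Set.Ioc 0 s, u < HH ψ t
  · have e : Set.Ioc 0 s ∩ {t | u < HH ψ t} = Set.Ioc 0 s := Set.inter_eq_left.2 hall
    rw [e, hv]
    apply min_eq_right
    rw [← hv]
    exact measure_mono fun t ht => ⟨ht.1, hall t ht⟩
  · push Not at hall
    obtain ⟨t, ht, hut⟩ := hall
    have e : Set.Ioi 0 ∩ {t | u < HH ψ t} = Set.Ioc 0 s ∩ {t | u < HH ψ t} := by
      ext x
      constructor
      · rintro ⟨hx, hx2⟩
        refine ⟨⟨hx, ?_⟩, hx2⟩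
        by_contra hsx
        push Not at hsx
        have h1 := HH_antitone h (ht.2.trans hsx.le)
        exact absurd hx2 (not_lt.2 (h1.trans hut))
      · rintro ⟨hx, hx2⟩
        exact ⟨hx.1, hx2⟩
    unfold qf
    rw [e]
    apply min_eq_left
    rw [← hv]
    exact measure_mono Set.inter_subset_left

lemma qf_int {ψ : ℝ → ℝ} (h : ψ ∈ Cclass) {s : ℝ} (hs : 0 ≤ s) :
    ∫⁻ u in Set.Ioc (0:ℝ) 1, min (qf ψ u) (ENNReal.ofReal s) = ENNReal.ofReal (ψ s) := by
  have hHm : Measurable (HH ψ) := (HH_antitone h).measurable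
  set A : Set (ℝ × ℝ) := {p | p.1 < HH ψ p.2} with hA
  have hAm : MeasurableSet A := measurableSet_lt measurable_fst (hHm.comp measurable_snd)
  calc ∫⁻ u in Set.Ioc (0:ℝ) 1, min (qf ψ u) (ENNReal.ofReal s)
      = ∫⁻ u in Set.Ioc (0:ℝ) 1, ∫⁻ t in Set.Ioc 0 s, A.indicator 1 (u, t) := by
        refine lintegral_congr fun u => ?_
        have hm : MeasurableSet {t | u < HH ψ t} := measurableSet_lt measurable_const hHm
        have e : (fun t => A.indicator (1 : ℝ × ℝ → ℝ≥0∞) (u, t))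
            = {t | u < HH ψ t}.indicator 1 := by
          ext t
          simp [Set.indicator, hA]
        simp only [e]
        rw [lintegral_indicator_one hm, Measure.restrict_apply hm, qf_min h, Set.inter_comm]
    _ = ∫⁻ t in Set.Ioc 0 s, ∫⁻ u in Set.Ioc (0:ℝ) 1, A.indicator 1 (u, t) := by
        rw [lintegral_lintegral_swap]
        exact (measurable_one.indicator hAm).aemeasurable
    _ = ∫⁻ t in Set.Ioc 0 s, ENNReal.ofReal (HH ψ t) := by
        refine lintegral_congr fun t => ?_
        have e : (fun u => A.indicator (1 : ℝ × ℝ → ℝ≥0∞) (u, t))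
            = (Set.Iio (HH ψ t)).indicator 1 := by
          ext u
          simp [Set.indicator, hA]
        simp only [e]
        rw [lintegral_indicator_one measurableSet_Iio, Measure.restrict_apply measurableSet_Iio]
        have : Set.Iio (HH ψ t) ∩ Set.Ioc 0 1 = Set.Ioo 0 (HH ψ t) := by
          ext u
          simp only [Set.mem_inter_iff, Set.mem_Iio, Set.mem_Ioc, Set.mem_Ioo]
          exact ⟨fun h => ⟨h.2.1, h.1⟩,
            fun h' => ⟨h'.2, h'.1, by linarith [h'.2, (HH_mem h t).2]⟩⟩
        rw [this, Real.volume_Ioo, sub_zero]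
    _ = ENNReal.ofReal (ψ s) := HH_int h hs

lemma qf_le_one {ψ : ℝ → ℝ} (h : ψ ∈ Cclass) : ∫⁻ u in Set.Ioc (0:ℝ) 1, qf ψ u ≤ 1 := by
  have ht : Tendsto (fun n : ℕ => ∫⁻ u in Set.Ioc (0:ℝ) 1, min (qf ψ u) (ENNReal.ofReal n)) atTop
      (𝓝 (∫⁻ u in Set.Ioc (0:ℝ) 1, qf ψ u)) := by
    refine lint_tendsto (fun n => (qf_measurable ψ).min measurable_const)
      (Eventually.of_forall fun n u => min_le_left _ _) fun u => ?_
    have h1 : Tendsto (fun n : ℕ => ENNReal.ofReal n) atTop (𝓝 ⊤) :=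
      ENNReal.tendsto_ofReal_atTop.comp tendsto_natCast_atTop_atTop
    have h2 := (tendsto_const_nhds (x := qf ψ u)).min h1
    simpa using h2
  refine le_of_tendsto' ht fun n => ?_
  rw [qf_int h (Nat.cast_nonneg n)]
  exact ENNReal.ofReal_le_one.2 (Cclass_mem_Icc h n).2

lemma exists_pair {ψ : ℝ → ℝ} (h : ψ ∈ Cclass) :
    ∃ pp : PMPair, IsProbabilityMeasure pp.P ∧ IsProbabilityMeasure pp.Q ∧
      psiR pp.P pp.Q = ψ := by
  set Q : Measure ℝ := volume.restrict (Set.Ioc (0:ℝ) 1) with hQ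
  have hQp : IsProbabilityMeasure Q := ⟨by simp [hQ]⟩
  set R := ∫⁻ u, qf ψ u ∂Q with hR
  have hR1 : R ≤ 1 := qf_le_one h
  set S : Measure ℝ := (1 - R) • Measure.dirac 2 with hS
  set P : Measure ℝ := S + Q.withDensity (qf ψ) with hP
  have hPp : IsProbabilityMeasure P := by
    constructor
    rw [hP, Measure.add_apply, withDensity_apply _ MeasurableSet.univ, Measure.restrict_univ, ← hR,
      hS]
    simp [tsub_add_cancel_of_le hR1]
  have hsing : S ⟂ₘ Q := by
    refine ⟨{2}ᶜ, (measurableSet_singleton 2).compl, ?_, ?_⟩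
    · simp [hS]
    · rw [compl_compl, hQ, Measure.restrict_apply (measurableSet_singleton 2)]
      exact measure_mono_null Set.inter_subset_left (by simp)
  have hrn : qf ψ =ᵐ[Q] P.rnDeriv Q := Measure.eq_rnDeriv (qf_measurable ψ) hsing hP
  refine ⟨⟨ℝ, inferInstance, P, Q, hPp, hQp⟩, hPp, hQp, ?_⟩
  change psiR P Q = ψ
  funext s
  rcases lt_or_ge s 0 with hs | hs
  · rw [h.2.2.2.2 s hs, (psiR_mem P Q).2.2.2.2 s hs]
  · unfold psiR
    rw [max_eq_left hs]
    have e : ∀ᵐ u ∂Q, min (P.rnDeriv Q u).toReal s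
        = (min (qf ψ u) (ENNReal.ofReal s)).toReal := by
      filter_upwards [hrn, P.rnDeriv_lt_top Q] with u h1 h2
      rw [h1, ENNReal.toReal_min h2.ne ENNReal.ofReal_ne_top, ENNReal.toReal_ofReal hs]
    rw [integral_congr_ae e, integral_toReal
      ((qf_measurable ψ).min measurable_const).aemeasurable
      (Eventually.of_forall fun u => (min_le_right _ _).trans_lt ENNReal.ofReal_lt_top),
      qf_int h hs, ENNReal.toReal_ofReal (h.1 s hs)]

/-- **Lemma 3 (reduction to extreme points).** `A(D_1,…,D_m)` equals the supremum of `I_f(ψ)`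
over the extreme points of `∩_i C_1(f_i, D_i)`, and, if all the divergences `D_{f_i}` are
finite, `B(D_1,…,D_m)` equals the infimum of `I_f(ψ)` over the extreme points of
`∩_i C_2(f_i, D_i)`. -/
theorem reduction_to_extreme_points (m : ℕ) (f : ℝ → ℝ) (fs : Fin m → ℝ → ℝ)
    (hf : ConvexOn ℝ (Set.Ioi 0) f) (hf1 : f 1 = 0)
    (hfs : ∀ i, ConvexOn ℝ (Set.Ioi 0) (fs i)) (hfs1 : ∀ i, fs i 1 = 0)
    (ν : Measure ℝ) (hν : IsCurvatureMeasure f ν)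
    (νs : Fin m → Measure ℝ) (hνs : ∀ i, IsCurvatureMeasure (fs i) (νs i))
    (D : Fin m → ℝ) (hD : ∀ i, 0 ≤ D i) :
    (sSup {x : EReal | ∃ pp : PMPair,
        (∀ i, fDiv (fs i) pp.P pp.Q ≤ (D i : EReal)) ∧ x = fDiv f pp.P pp.Q} =
      sSup {x : EReal | ∃ ψ ∈ Set.extremePoints ℝ
          {ψ : ℝ → ℝ | ψ ∈ Cclass ∧ ∀ i, Ifun (νs i) ψ ≤ ENNReal.ofReal (D i)},
        x = ((Ifun ν ψ : ℝ≥0∞) : EReal)}) ∧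
    ((∀ i, sSup {x : EReal | ∃ pp : PMPair, x = fDiv (fs i) pp.P pp.Q} < ⊤) →
      sInf {x : EReal | ∃ pp : PMPair,
          (∀ i, (D i : EReal) ≤ fDiv (fs i) pp.P pp.Q) ∧ x = fDiv f pp.P pp.Q} =
      sInf {x : EReal | ∃ ψ ∈ Set.extremePoints ℝ
          {ψ : ℝ → ℝ | ψ ∈ Cclass ∧ ∀ i, ENNReal.ofReal (D i) ≤ Ifun (νs i) ψ},
        x = ((Ifun ν ψ : ℝ≥0∞) : EReal)}) := by
  have fwd : ∀ pp : PMPair, psiR pp.P pp.Q ∈ Cclass ∧ ∀ (g : ℝ → ℝ) (μ : Measure ℝ),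
      ConvexOn ℝ (Set.Ioi 0) g → g 1 = 0 → IsCurvatureMeasure g μ →
      fDiv g pp.P pp.Q = ((Ifun μ (psiR pp.P pp.Q) : ℝ≥0∞) : EReal) := by
    intro pp
    have := pp.probP
    have := pp.probQ
    exact ⟨psiR_mem _ _, fun g μ hg hg1 hμ => fDiv_eq _ _ hg hg1 hμ⟩
  have hDe : ∀ i, ((ENNReal.ofReal (D i) : ℝ≥0∞) : EReal) = (D i : EReal) := fun i => by
    rw [EReal.coe_ennreal_ofReal, max_eq_left (hD i)]
  constructor
  · set S : Set (ℝ → ℝ) := {ψ : ℝ → ℝ | ψ ∈ Cclass ∧ ∀ i, Ifun (νs i) ψ ≤ ENNReal.ofReal (D i)}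
      with hS
    have hSC : S ⊆ Cclass := fun ψ h => h.1
    have hSe : S = Cclass ∩ ⋂ i, {ψ : ℝ → ℝ | ψ ∈ Cclass ∧ Ifun (νs i) ψ ≤ ENNReal.ofReal (D i)} := by
      ext ψ
      simp only [hS, Set.mem_ofPred_eq, Set.mem_inter_iff, Set.mem_iInter]
      exact ⟨fun h => ⟨h.1, fun i => ⟨h.1, h.2 i⟩⟩, fun h => ⟨h.1, fun i => (h.2 i).2⟩⟩
    have hSc : IsCompact S := by
      rw [hSe]
      exact Cclass_isCompact.inter_right (isClosed_iInter fun i => Ifun_sublevel_closed _ _)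
    have hSconv : Convex ℝ S := by
      rw [hSe]
      exact Cclass_convex.inter (convex_iInter fun i => Ifun_sublevel_convex _ _)
    apply le_antisymm
    · refine sSup_le ?_
      rintro x ⟨pp, hpp, rfl⟩
      obtain ⟨hm, hfd⟩ := fwd pp
      have hψS : psiR pp.P pp.Q ∈ S := by
        refine ⟨hm, fun i => ?_⟩
        have := hpp i
        rw [hfd _ _ (hfs i) (hfs1 i) (hνs i), ← hDe i] at this
        exact EReal.coe_ennreal_le_coe_ennreal_iff.1 this
      rw [hfd _ _ hf hf1 hν]
      set M : ℝ≥0∞ := ⨆ ψ ∈ S.extremePoints ℝ, Ifun ν ψ with hM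
      have h1 : Ifun ν (psiR pp.P pp.Q) ≤ M :=
        sup_ext ν S hSC hSc hSconv M (fun ψ hψ => le_iSup₂ (f := fun ψ _ => Ifun ν ψ) ψ hψ) _ hψS
      set Y := sSup {x : EReal | ∃ ψ ∈ S.extremePoints ℝ, x = ((Ifun ν ψ : ℝ≥0∞) : EReal)} with hY
      have hYle : ∀ ψ ∈ S.extremePoints ℝ, ((Ifun ν ψ : ℝ≥0∞) : EReal) ≤ Y :=
        fun ψ hψ => le_sSup ⟨ψ, hψ, rfl⟩
      obtain ⟨ψ₁, hψ₁⟩ := hSc.extremePoints_nonempty ⟨_, hψS⟩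
      have hY0 : 0 ≤ Y := (EReal.coe_ennreal_nonneg _).trans (hYle ψ₁ hψ₁)
      have hMY : M ≤ Y.toENNReal := by
        refine iSup₂_le fun ψ hψ => ?_
        have := EReal.toENNReal_le_toENNReal (hYle ψ hψ)
        simpa using this
      calc ((Ifun ν (psiR pp.P pp.Q) : ℝ≥0∞) : EReal) ≤ (Y.toENNReal : EReal) :=
            EReal.coe_ennreal_le_coe_ennreal_iff.2 (h1.trans hMY)
        _ = Y := EReal.coe_toENNReal hY0
    · refine sSup_le ?_
      rintro x ⟨ψ, hψ, rfl⟩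
      obtain ⟨pp, _, _, rfl⟩ := exists_pair hψ.1.1
      obtain ⟨hm, hfd⟩ := fwd pp
      refine le_sSup ⟨pp, fun i => ?_, (hfd _ _ hf hf1 hν).symm⟩
      rw [hfd _ _ (hfs i) (hfs1 i) (hνs i), ← hDe i]
      exact EReal.coe_ennreal_le_coe_ennreal_iff.2 (hψ.1.2 i)
  · intro hfin
    have hfin' : ∀ i, Ifun (νs i) 0 ≠ ⊤ := by
      intro i htop
      have h0 : (0 : ℝ → ℝ) ∈ Cclass :=
        ⟨fun s _ => le_rfl, concaveOn_const 0 (convex_Ici 0), fun _ _ _ _ _ => le_rfl,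
          fun s hs => le_min zero_le_one hs, fun s _ => rfl⟩
      obtain ⟨pp, _, _, hpp⟩ := exists_pair h0
      have h1 := (fwd pp).2 _ _ (hfs i) (hfs1 i) (hνs i)
      rw [hpp, htop] at h1
      have h2 : fDiv (fs i) pp.P pp.Q ≤
          sSup {x : EReal | ∃ pp : PMPair, x = fDiv (fs i) pp.P pp.Q} := le_sSup ⟨pp, rfl⟩
      have h3 := h2.trans_lt (hfin i)
      rw [h1] at h3
      simp at h3
    set S : Set (ℝ → ℝ) := {ψ : ℝ → ℝ | ψ ∈ Cclass ∧ ∀ i, ENNReal.ofReal (D i) ≤ Ifun (νs i) ψ}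
      with hS
    have hSC : S ⊆ Cclass := fun ψ h => h.1
    have hSe : S = Cclass ∩ ⋂ i, {ψ : ℝ → ℝ | ψ ∈ Cclass ∧ ENNReal.ofReal (D i) ≤ Ifun (νs i) ψ} := by
      ext ψ
      simp only [hS, Set.mem_ofPred_eq, Set.mem_inter_iff, Set.mem_iInter]
      exact ⟨fun h => ⟨h.1, fun i => ⟨h.1, h.2 i⟩⟩, fun h => ⟨h.1, fun i => (h.2 i).2⟩⟩
    have hSc : IsCompact S := by
      rw [hSe]
      exact Cclass_isCompact.inter_right
        (isClosed_iInter fun i => Ifun_superlevel_closed _ (hfin' i) _)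
    apply le_antisymm
    · refine le_sInf ?_
      rintro x ⟨ψ, hψ, rfl⟩
      obtain ⟨pp, _, _, rfl⟩ := exists_pair hψ.1.1
      obtain ⟨hm, hfd⟩ := fwd pp
      refine sInf_le ⟨pp, fun i => ?_, (hfd _ _ hf hf1 hν).symm⟩
      rw [hfd _ _ (hfs i) (hfs1 i) (hνs i), ← hDe i]
      exact EReal.coe_ennreal_le_coe_ennreal_iff.2 (hψ.1.2 i)
    · refine le_sInf ?_
      rintro x ⟨pp, hpp, rfl⟩
      obtain ⟨hm, hfd⟩ := fwd pp
      have hψS : psiR pp.P pp.Q ∈ S := by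
        refine ⟨hm, fun i => ?_⟩
        have := hpp i
        rw [hfd _ _ (hfs i) (hfs1 i) (hνs i), ← hDe i] at this
        exact EReal.coe_ennreal_le_coe_ennreal_iff.1 this
      rw [hfd _ _ hf hf1 hν]
      obtain ⟨ψ, hψ, hle⟩ := inf_ext ν S hSC hSc _ hψS
      refine le_trans (b := ((Ifun ν ψ : ℝ≥0∞) : EReal)) (sInf_le ⟨ψ, hψ, rfl⟩) ?_
      exact EReal.coe_ennreal_le_coe_ennreal_iff.2 (hle _ hψS)

end
end

section
/- Let f_1,…,f_m:(0,∞)→ℝ be convex with value 0 at 1 and D_1,…,D_m ≥ 0. Let ψ ∈ ∩_{i=1}^m C_1(f_i, D_i) and let k be the number of indices i with I_{f_i}(ψ) = D_i. If ψ is an extreme point of ∩_{i=1}^m C_1(f_i, D_i), then ψ = ψ_{P,Q} for some probability measures P, Q on the finite set {1,…,k+2}. The same conclusion holds for extreme points of ∩_{i=1}^m C_2(f_i, D_i) provided all divergences D_{f_1},…,D_{f_m} are finite. -/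
open MeasureTheory Filter Set
open scoped ENNReal NNReal Classical

noncomputable section

/-! ### The cone of concave nondecreasing functions and its faces -/

/-- The cone of concave nondecreasing functions vanishing at zero. -/
def KK : Set (ℝ → ℝ) :=
  {φ | ConcaveOn ℝ (Set.Ici 0) φ ∧ MonotoneOn φ (Set.Ici 0) ∧ φ 0 = 0 ∧ ∀ s, s < 0 → φ s = 0}

lemma KK.nonneg {φ : ℝ → ℝ} (h : φ ∈ KK) (s : ℝ) : 0 ≤ φ s := by
  obtain ⟨_, h2, h3, h4⟩ := h
  rcases lt_or_ge s 0 with hs | hs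
  · rw [h4 s hs]
  · rw [← h3]; exact h2 (by simp) hs hs

lemma KK.mono {φ : ℝ → ℝ} (h : φ ∈ KK) : Monotone φ := by
  intro s t hst
  rcases lt_or_ge s 0 with hs | hs
  · rw [h.2.2.2 s hs]; exact KK.nonneg h t
  · exact h.2.1 hs (show (0:ℝ) ≤ t by linarith) hst

lemma KK.zero : (0 : ℝ → ℝ) ∈ KK :=
  ⟨concaveOn_const 0 (convex_Ici 0), fun _ _ _ _ _ => le_rfl, rfl, fun _ _ => rfl⟩

lemma KK.add {φ χ : ℝ → ℝ} (h : φ ∈ KK) (h' : χ ∈ KK) : φ + χ ∈ KK :=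
  ⟨h.1.add h'.1, h.2.1.add h'.2.1, by simp [h.2.2.1, h'.2.2.1],
    fun s hs => by simp [h.2.2.2 s hs, h'.2.2.2 s hs]⟩

lemma KK.smul {φ : ℝ → ℝ} (h : φ ∈ KK) {c : ℝ} (hc : 0 ≤ c) : c • φ ∈ KK :=
  ⟨h.1.smul hc, fun a ha b hb hab => by
      simpa using mul_le_mul_of_nonneg_left (h.2.1 ha hb hab) hc, by simp [h.2.2.1],
    fun s hs => by simp [h.2.2.2 s hs]⟩

lemma KK.scale {φ : ℝ → ℝ} (h : φ ∈ KK) {s t : ℝ} (hs : 0 ≤ s) (hst : s ≤ t) :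
    s * φ t ≤ t * φ s := by
  rcases hs.eq_or_lt with rfl | hs
  · simp [h.2.2.1]
  have ht : 0 < t := by linarith
  have := h.1.2 (show (0:ℝ) ∈ Set.Ici 0 by simp) (show t ∈ Set.Ici (0:ℝ) from ht.le)
    (show 0 ≤ 1 - s / t by rw [sub_nonneg, div_le_one ht]; exact hst)
    (show 0 ≤ s / t by positivity) (by ring)
  simp only [smul_eq_mul, h.2.2.1, mul_zero, zero_add] at this
  rw [div_mul_cancel₀ _ ht.ne'] at this
  have h2 := mul_le_mul_of_nonneg_left this ht.le
  rwa [← mul_assoc, mul_div_cancel₀ _ ht.ne'] at h2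

lemma KK.isClosed : IsClosed KK := by
  have : KK = (⋂ x ∈ Set.Ici (0:ℝ), ⋂ y ∈ Set.Ici (0:ℝ), ⋂ a ∈ Set.Ici (0:ℝ),
      ⋂ b ∈ Set.Ici (0:ℝ), ⋂ (_ : a + b = 1),
        {φ : ℝ → ℝ | a * φ x + b * φ y ≤ φ (a * x + b * y)}) ∩
      ((⋂ x ∈ Set.Ici (0:ℝ), ⋂ y ∈ Set.Ici (0:ℝ), ⋂ (_ : x ≤ y), {φ : ℝ → ℝ | φ x ≤ φ y}) ∩
      ({φ : ℝ → ℝ | φ 0 = 0} ∩ ⋂ s ∈ Set.Iio (0:ℝ), {φ : ℝ → ℝ | φ s = 0})) := by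
    ext φ
    simp only [KK, ConcaveOn, MonotoneOn, convex_Ici, true_and, Set.mem_inter_iff, Set.mem_iInter,
      Set.mem_ofPred_eq, smul_eq_mul, Set.mem_Iio, Set.mem_Ici]
    constructor
    · rintro ⟨h1, h2, h3⟩
      exact ⟨fun x hx y hy a ha b hb hab => h1 hx hy ha hb hab,
        fun x hx y hy hxy => h2 hx hy hxy, h3⟩
    · rintro ⟨h1, h2, h3⟩
      exact ⟨fun x hx y hy a b ha hb hab => h1 x hx y hy a ha b hb hab,
        fun x hx y hy hxy => h2 x hx y hy hxy, h3⟩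
  rw [this]
  refine IsClosed.inter ?_ (IsClosed.inter ?_ (IsClosed.inter ?_ ?_))
  · refine isClosed_biInter fun x _ => isClosed_biInter fun y _ => isClosed_biInter fun a _ =>
      isClosed_biInter fun b _ => isClosed_iInter fun _ => ?_
    exact isClosed_le (by fun_prop) (by fun_prop)
  · refine isClosed_biInter fun x _ => isClosed_biInter fun y _ => isClosed_iInter fun _ => ?_
    exact isClosed_le (by fun_prop) (by fun_prop)
  · exact isClosed_eq (by fun_prop) (by fun_prop)
  · refine isClosed_biInter fun x _ => ?_
    exact isClosed_eq (by fun_prop) (by fun_prop)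

/-- The linear span of the face of `ψ` in the cone. -/
def WW (ψ : ℝ → ℝ) : Submodule ℝ (ℝ → ℝ) where
  carrier := {φ | ∃ C : ℝ, 0 ≤ C ∧ C • ψ + φ ∈ KK ∧ C • ψ - φ ∈ KK}
  zero_mem' := ⟨0, le_rfl, by simpa using KK.zero, by simpa using KK.zero⟩
  add_mem' := by
    rintro φ χ ⟨C, hC, h1, h2⟩ ⟨C', hC', h1', h2'⟩
    refine ⟨C + C', by positivity, ?_, ?_⟩
    · convert KK.add h1 h1' using 1; module
    · convert KK.add h2 h2' using 1; module
  smul_mem' := by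
    rintro c φ ⟨C, hC, h1, h2⟩
    refine ⟨|c| * C, by positivity, ?_, ?_⟩
    · rcases abs_cases c with ⟨h, _⟩ | ⟨h, _⟩
      · convert KK.smul h1 (abs_nonneg c) using 1; rw [h]; module
      · convert KK.smul h2 (abs_nonneg c) using 1; rw [h]; module
    · rcases abs_cases c with ⟨h, _⟩ | ⟨h, _⟩
      · convert KK.smul h2 (abs_nonneg c) using 1; rw [h]; module
      · convert KK.smul h1 (abs_nonneg c) using 1; rw [h]; module

/-- Subtracting a maximal multiple of `a` shrinks the face. -/
lemma exists_peel {ψ a : ℝ → ℝ} (ha : a ∈ KK) (ha0 : a ≠ 0) {ε : ℝ} (hε : 0 < ε)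
    (h : ψ - ε • a ∈ KK) :
    ∃ t : ℝ, 0 < t ∧ ψ - t • a ∈ KK ∧ WW (ψ - t • a) < WW ψ := by
  obtain ⟨s₀, hs₀⟩ : ∃ s, 0 < a s := by
    by_contra! hcon
    exact ha0 (funext fun s => le_antisymm (hcon s) (KK.nonneg ha s))
  set A : Set ℝ := {t | ψ - t • a ∈ KK} with hA
  have hAc : IsClosed A := KK.isClosed.preimage (by fun_prop)
  have hAb : BddAbove A := by
    refine ⟨ψ s₀ / a s₀, fun t ht => ?_⟩
    have := KK.nonneg ht s₀
    simp only [Pi.sub_apply, Pi.smul_apply, smul_eq_mul] at this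
    rw [le_div_iff₀ hs₀]; linarith
  have hmem : sSup A ∈ A := hAc.csSup_mem ⟨ε, h⟩ hAb
  have hle : ε ≤ sSup A := le_csSup hAb h
  have hpos : 0 < sSup A := by linarith
  refine ⟨sSup A, hpos, hmem, ?_⟩
  rw [SetLike.lt_iff_le_and_exists]
  refine ⟨?_, a, ?_, ?_⟩
  · rintro φ ⟨C, hC, h1, h2⟩
    refine ⟨C, hC, ?_, ?_⟩
    · convert KK.add h1 (KK.smul ha (mul_nonneg hC hpos.le)) using 1; module
    · convert KK.add h2 (KK.smul ha (mul_nonneg hC hpos.le)) using 1; module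
  · have hh : (1 / ε) • ψ - a ∈ KK := by
      convert KK.smul h (c := 1 / ε) (by positivity) using 1
      rw [smul_sub, smul_smul, one_div_mul_cancel hε.ne', one_smul]
    refine ⟨1 / ε, by positivity, ?_, hh⟩
    convert KK.add hh (KK.smul ha (c := 2) (by norm_num)) using 1; module
  · rintro ⟨C, hC, -, h2⟩
    have h3 : (C + 1) • (ψ - sSup A • a) - a ∈ KK := by
      convert KK.add h2 hmem using 1; module
    have h4 : ψ - (sSup A + 1 / (C + 1)) • a ∈ KK := by
      convert KK.smul h3 (c := 1 / (C + 1)) (by positivity) using 1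
      rw [smul_sub, smul_smul, one_div_mul_cancel (by positivity), one_smul]; module
    have h5 := le_csSup hAb h4
    have : 0 < 1 / (C + 1) := by positivity
    linarith

lemma exists_supergradient {ψ : ℝ → ℝ} (h : ψ ∈ KK) {b : ℝ} (hb : 0 < b) :
    ∃ d : ℝ, 0 ≤ d ∧ ∀ s, 0 ≤ s → ψ s ≤ ψ b + d * (s - b) := by
  set A : Set ℝ := Set.image (fun s => (ψ s - ψ b) / (s - b)) (Set.Ioi b) with hA
  have key : ∀ x, 0 ≤ x → x < b → ∀ y ∈ A, y ≤ (ψ b - ψ x) / (b - x) := by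
    rintro x hx hxb _ ⟨z, hz, rfl⟩
    exact h.1.slope_anti_adjacent hx (show (0:ℝ) ≤ z from (hb.trans hz).le) hxb hz
  have hAb : BddAbove A := ⟨_, key 0 le_rfl hb⟩
  have hAn : A.Nonempty := ⟨_, b + 1, by simp, rfl⟩
  refine ⟨sSup A, ?_, ?_⟩
  · have h1 : (ψ (b+1) - ψ b) / (b + 1 - b) ≤ sSup A := le_csSup hAb ⟨b + 1, by simp, rfl⟩
    have h2 := KK.mono h (show b ≤ b + 1 by linarith)
    have : (0:ℝ) ≤ (ψ (b+1) - ψ b) / (b + 1 - b) := div_nonneg (by linarith) (by linarith)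
    linarith
  · intro s hs
    rcases lt_trichotomy s b with hsb | rfl | hsb
    · have := csSup_le hAn (key s hs hsb)
      rw [le_div_iff₀ (by linarith)] at this
      nlinarith
    · simp
    · have : (ψ s - ψ b) / (s - b) ≤ sSup A := le_csSup hAb ⟨s, hsb, rfl⟩
      rw [div_le_iff₀ (by linarith)] at this
      linarith

/-- The part of `ψ` carried by `[0,b]`. -/
def TT (ψ : ℝ → ℝ) (b d : ℝ) : ℝ → ℝ :=
  fun s => if s < 0 then 0 else ψ (min s b) - d * min s b

lemma TT_mem {ψ : ℝ → ℝ} (h : ψ ∈ KK) {b d : ℝ} (hb : 0 < b)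
    (hd : ∀ s, 0 ≤ s → ψ s ≤ ψ b + d * (s - b)) : TT ψ b d ∈ KK := by
  have hconc : ConcaveOn ℝ (Set.Icc 0 b) (fun s => ψ s - d * s) := by
    refine (h.1.subset Set.Icc_subset_Ici_self (convex_Icc 0 b)).sub ?_
    exact (LinearMap.convexOn (LinearMap.mulLeft ℝ d) (convex_Icc 0 b))
  have hmono : MonotoneOn (fun s => ψ s - d * s) (Set.Icc 0 b) := by
    intro x hx y hy hxy
    rcases hxy.eq_or_lt with rfl | hxy
    · exact le_rfl
    rcases hy.2.eq_or_lt with rfl | hyb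
    · have := hd x hx.1
      simp only; linarith
    have h1 := h.1.slope_anti_adjacent (x := x) (y := y) (z := b) hx.1 hb.le hxy hyb
    have h2 := hd y hy.1
    have h3 : d ≤ (ψ b - ψ y) / (b - y) := by
      rw [le_div_iff₀ (by linarith)]; linarith
    have h4 := h3.trans h1
    rw [le_div_iff₀ (by linarith)] at h4
    simp only; linarith
  have himg : Set.image (fun s : ℝ => min s b) (Set.Ici 0) = Set.Icc 0 b := by
    ext x; constructor
    · rintro ⟨s, hs, rfl⟩; exact ⟨le_min hs hb.le, min_le_right _ _⟩
    · intro hx; exact ⟨x, hx.1, min_eq_left hx.2⟩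
  refine ⟨?_, ?_, ?_, ?_⟩
  · have hmin : ConcaveOn ℝ (Set.Ici 0) (fun s : ℝ => min s b) :=
      (concaveOn_id (convex_Ici 0)).inf (concaveOn_const b (convex_Ici 0))
    have := ConcaveOn.comp (f := fun s : ℝ => min s b) (s := Set.Ici 0)
      (by rw [himg]; exact hconc) hmin (by rw [himg]; exact hmono)
    refine this.congr fun s hs => ?_
    simp [TT, not_lt.2 hs.out]
  · intro x hx y hy hxy
    simp only [TT, not_lt.2 hx.out, not_lt.2 hy.out, if_false]
    exact hmono ⟨le_min hx hb.le, min_le_right _ _⟩ ⟨le_min hy hb.le, min_le_right _ _⟩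
      (min_le_min_right b hxy)
  · simp [TT, hb.le, h.2.2.1]
  · intro s hs; simp [TT, hs]

lemma sub_TT_mem {ψ : ℝ → ℝ} (h : ψ ∈ KK) {b d : ℝ} (hb : 0 < b) (hd0 : 0 ≤ d)
    (hd : ∀ s, 0 ≤ s → ψ s ≤ ψ b + d * (s - b)) : ψ - TT ψ b d ∈ KK := by
  have hform : ∀ s, 0 ≤ s → (ψ - TT ψ b d) s
      = (ψ (max s b) - d * max s b) + (d * s - (ψ b - d * b)) := by
    intro s hs
    simp only [TT, Pi.sub_apply, not_lt.2 hs, if_false]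
    rcases le_total s b with hsb | hsb
    · simp [hsb]
    · simp [hsb]
  have hconc : ConcaveOn ℝ (Set.Ici b) (fun s => ψ s - d * s) := by
    refine (h.1.subset (Set.Ici_subset_Ici.2 hb.le) (convex_Ici b)).sub ?_
    exact (LinearMap.convexOn (LinearMap.mulLeft ℝ d) (convex_Ici b))
  have hanti : AntitoneOn (fun s => ψ s - d * s) (Set.Ici b) := by
    intro x hx y hy hxy
    rcases hxy.eq_or_lt with rfl | hxy
    · exact le_rfl
    have hx' : b ≤ x := hx
    rcases hx'.eq_or_lt with rfl | hxb
    · have := hd y (hb.le.trans hy)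
      simp only; linarith
    have h1 := h.1.slope_anti_adjacent (x := b) (y := x) (z := y) hb.le
      (hb.le.trans hy) hxb hxy
    have h2 := hd x (hb.trans hxb).le
    have h3 : (ψ x - ψ b) / (x - b) ≤ d := by
      rw [div_le_iff₀ (by linarith)]; linarith
    have h4 := h1.trans h3
    rw [div_le_iff₀ (by linarith)] at h4
    simp only; linarith
  have himg : Set.image (fun s : ℝ => max s b) (Set.Ici 0) = Set.Ici b := by
    ext x; constructor
    · rintro ⟨s, hs, rfl⟩; exact le_max_right s b
    · intro hx; exact ⟨x, hb.le.trans hx, max_eq_left hx⟩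
  refine ⟨?_, ?_, ?_, ?_⟩
  · have hmax : ConvexOn ℝ (Set.Ici 0) (fun s : ℝ => max s b) :=
      (convexOn_id (convex_Ici 0)).sup (convexOn_const b (convex_Ici 0))
    have h1 := ConcaveOn.comp_convexOn (f := fun s : ℝ => max s b) (s := Set.Ici 0)
      (by rw [himg]; exact hconc) hmax (by rw [himg]; exact hanti)
    have h2 : ConcaveOn ℝ (Set.Ici 0) (fun s : ℝ => d * s - (ψ b - d * b)) :=
      (LinearMap.concaveOn (LinearMap.mulLeft ℝ d) (convex_Ici 0)).sub
        (convexOn_const _ (convex_Ici 0))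
    refine (h1.add h2).congr fun s hs => ?_
    rw [hform s hs]; rfl
  · intro x hx y hy hxy
    simp only [TT, Pi.sub_apply, not_lt.2 hx.out, not_lt.2 hy.out, if_false]
    rcases le_total x b with hxb | hxb <;> rcases le_total y b with hyb | hyb
    · simp only [hxb, hyb, min_eq_left]; nlinarith
    · simp only [hxb, hyb, min_eq_left, min_eq_right]
      have := KK.mono h hyb; nlinarith
    · have : x = y := by linarith
      rw [this]
    · simp only [hxb, hyb, min_eq_right]
      have := KK.mono h hxy; linarith
  · simp [TT, hb.le, h.2.2.1]
  · intro s hs; simp [TT, hs, h.2.2.2 s hs]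

/-- An atom. -/
def atm (p q : ℝ) : ℝ → ℝ := fun s => if s < 0 then 0 else min p (q * s)

lemma atm_mem {p q : ℝ} (hp : 0 ≤ p) (hq : 0 ≤ q) : atm p q ∈ KK := by
  refine ⟨?_, ?_, ?_, ?_⟩
  · have : ConcaveOn ℝ (Set.Ici 0) (fun s : ℝ => min p (q * s)) :=
      (concaveOn_const p (convex_Ici 0)).inf
        (LinearMap.concaveOn (LinearMap.mulLeft ℝ q) (convex_Ici 0))
    refine this.congr fun s hs => ?_
    simp [atm, not_lt.2 hs.out]
  · intro x hx y hy hxy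
    simp only [atm, not_lt.2 hx.out, not_lt.2 hy.out, if_false]
    exact min_le_min_left _ (mul_le_mul_of_nonneg_left hxy hq)
  · simp [atm, hp]
  · intro s hs; simp [atm, hs]

lemma atm_ne {p q : ℝ} (hp : 0 < p) (hq : 0 < q) : atm p q ≠ 0 := by
  intro h
  have := congrFun h 1
  simp only [atm, Pi.zero_apply] at this
  rw [if_neg (by norm_num)] at this
  have h2 : 0 < min p (q * 1) := lt_min hp (by linarith)
  linarith

lemma smul_atm {p q t : ℝ} (ht : 0 ≤ t) : t • atm p q = atm (t * p) (t * q) := by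
  ext s
  simp only [atm, Pi.smul_apply, smul_eq_mul]
  split_ifs
  · simp
  · rw [mul_min_of_nonneg _ _ ht, mul_assoc]

lemma sum_atm_mem {n : ℕ} {p q : Fin n → ℝ} (h : ∀ j, 0 ≤ p j ∧ 0 ≤ q j) (S : Finset (Fin n)) :
    ∑ j ∈ S, atm (p j) (q j) ∈ KK := by
  induction S using Finset.induction_on with
  | empty => simpa using KK.zero
  | insert a s ha ih =>
    rw [Finset.sum_insert ha]; exact KK.add (atm_mem (h a).1 (h a).2) ih

/-- If all truncations are proportional to `ψ`, then `ψ` is an atom. -/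
lemma eq_atm {ψ : ℝ → ℝ} (h : ψ ∈ KK) {M : ℝ} (hM : ∀ s, 0 ≤ s → ψ s ≤ M * min 1 s)
    (hM0 : 0 ≤ M)
    (hT : ∀ b d, 0 < b → 0 ≤ d → (∀ s, 0 ≤ s → ψ s ≤ ψ b + d * (s - b)) →
      ∃ c : ℝ, TT ψ b d = c • ψ) : ∃ p q : ℝ, 0 ≤ p ∧ 0 ≤ q ∧ ψ = atm p q := by
  have hB1 : BddAbove (Set.range ψ) := by
    refine ⟨M, ?_⟩
    rintro _ ⟨s, rfl⟩
    rcases lt_or_ge s 0 with hs | hs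
    · rw [h.2.2.2 s hs]; exact hM0
    · exact (hM s hs).trans (mul_le_of_le_one_right hM0 (min_le_left _ _))
  set A := Set.image (fun s => ψ s / s) (Set.Ioi 0) with hA
  have hB2 : BddAbove A := by
    refine ⟨M, ?_⟩
    rintro _ ⟨s, hs, rfl⟩
    have hs : 0 < s := hs
    simp only
    rw [div_le_iff₀ hs]
    exact (hM s hs.le).trans (mul_le_mul_of_nonneg_left (min_le_right _ _) hM0)
  have hL0 : 0 ≤ sSup (Set.range ψ) := by
    have := le_csSup hB1 ⟨0, rfl⟩
    rwa [h.2.2.1] at this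
  have hq0 : 0 ≤ sSup A := by
    have : ψ 1 / 1 ≤ sSup A := le_csSup hB2 ⟨1, by simp, rfl⟩
    have := KK.nonneg h 1
    simp at *; linarith
  refine ⟨sSup (Set.range ψ), sSup A, hL0, hq0, ?_⟩
  ext b
  simp only [atm]
  split_ifs with hb
  · exact h.2.2.2 b hb
  push Not at hb
  rcases hb.eq_or_lt with rfl | hb
  · simp [h.2.2.1, hL0]
  have le1 : ψ b ≤ sSup (Set.range ψ) := le_csSup hB1 ⟨b, rfl⟩
  have le2 : ψ b ≤ sSup A * b := by
    rw [← div_le_iff₀ hb]; exact le_csSup hB2 ⟨b, hb, rfl⟩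
  refine le_antisymm (le_min le1 le2) ?_
  obtain ⟨d, hd0, hd⟩ := exists_supergradient h hb
  obtain ⟨c, hc⟩ := hT b d hb hd0 hd
  by_cases hc0 : c = 0
  · refine (min_le_right _ _).trans ?_
    rw [hc0, zero_smul] at hc
    have hlin : ∀ s, 0 ≤ s → s ≤ b → ψ s = d * s := by
      intro s hs hsb
      have := congrFun hc s
      simp [TT, not_lt.2 hs, hsb] at this
      linarith
    rw [hlin b hb.le le_rfl]
    refine mul_le_mul_of_nonneg_right (csSup_le ⟨_, 1, by simp, rfl⟩ ?_) hb.le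
    rintro _ ⟨s, hs, rfl⟩
    have hs : 0 < s := hs
    simp only
    rw [div_le_iff₀ hs]
    rcases le_total s b with hsb | hsb
    · exact (hlin s hs.le hsb).le
    · have := hd s hs.le
      rw [hlin b hb.le le_rfl] at this
      linarith
  · refine (min_le_left _ _).trans (csSup_le ⟨_, 0, rfl⟩ ?_)
    rintro _ ⟨s, rfl⟩
    rcases le_total s b with hsb | hsb
    · exact KK.mono h hsb
    · have h1 := congrFun hc s
      have h2 := congrFun hc b
      have hs0 : 0 ≤ s := hb.le.trans hsb
      simp [TT, not_lt.2 hs0, hsb] at h1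
      simp [TT, not_lt.2 hb.le] at h2
      have : c * ψ s = c * ψ b := by linarith
      exact (mul_left_cancel₀ hc0 this).le

lemma WW_self {ψ : ℝ → ℝ} (h : ψ ∈ KK) : ψ ∈ WW ψ :=
  ⟨1, by norm_num, by simpa using KK.add h h, by simpa using KK.zero⟩

/-- Finite-dimensional faces consist of finite sums of atoms. -/
lemma finite_atoms (n : ℕ) : ∀ ψ : ℝ → ℝ, ψ ∈ KK →
    (∃ M : ℝ, 0 ≤ M ∧ ∀ s, 0 ≤ s → ψ s ≤ M * min 1 s) →
    FiniteDimensional ℝ (WW ψ) → Module.finrank ℝ (WW ψ) ≤ n →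
    ∃ p q : Fin n → ℝ, (∀ j, (0 < p j ∧ 0 < q j) ∨ (p j = 0 ∧ q j = 0)) ∧
      ψ = ∑ j, atm (p j) (q j) := by
  induction n with
  | zero =>
    intro ψ h _ hf hr
    have : WW ψ = ⊥ := Submodule.finrank_eq_zero.1 (Nat.le_zero.1 hr)
    have h2 := WW_self h
    rw [this, Submodule.mem_bot] at h2
    exact ⟨fun _ => 0, fun _ => 0, fun j => j.elim0, by simp [h2]⟩
  | succ n ih =>
    rintro ψ h ⟨M, hM0, hM⟩ hf hr
    have step : ∀ (a : ℝ → ℝ) (ε : ℝ), a ∈ KK → a ≠ 0 → 0 < ε → ψ - ε • a ∈ KK →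
        ∃ t : ℝ, 0 < t ∧ ψ - t • a ∈ KK ∧ ∃ p q : Fin n → ℝ,
          (∀ j, (0 < p j ∧ 0 < q j) ∨ (p j = 0 ∧ q j = 0)) ∧
          ψ - t • a = ∑ j, atm (p j) (q j) := by
      intro a ε ha ha0 hε hh
      obtain ⟨t, ht, hm, hlt⟩ := exists_peel ha ha0 hε hh
      refine ⟨t, ht, hm, ih _ hm ⟨M, hM0, fun s hs => ?_⟩ ?_ ?_⟩
      · have := hM s hs
        have := mul_nonneg ht.le (KK.nonneg ha s)
        simp only [Pi.sub_apply, Pi.smul_apply, smul_eq_mul]; linarith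
      · exact Submodule.finiteDimensional_of_le hlt.le
      · have := Submodule.finrank_lt_finrank_of_lt hlt
        omega
    by_cases hψ0 : ψ = 0
    · exact ⟨fun _ => 0, fun _ => 0, fun j => Or.inr ⟨rfl, rfl⟩, by
        rw [hψ0]; ext s; simp only [Finset.sum_apply, Pi.zero_apply, atm]; simp⟩
    have hatom : ∃ p q ε : ℝ, 0 < p ∧ 0 < q ∧ 0 < ε ∧ ψ - ε • atm p q ∈ KK := by
      by_cases hT : ∀ b d, 0 < b → 0 ≤ d → (∀ s, 0 ≤ s → ψ s ≤ ψ b + d * (s - b)) →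
          ∃ c : ℝ, TT ψ b d = c • ψ
      · obtain ⟨p, q, hp, hq, he⟩ := eq_atm h hM hM0 hT
        have hz : ∀ s, atm p q s ≤ p ∧ (0 ≤ s → atm p q s ≤ q * s) := by
          intro s; simp only [atm]; split_ifs with hs
          · exact ⟨hp, fun h' => absurd h' (by linarith)⟩
          · exact ⟨min_le_left _ _, fun _ => min_le_right _ _⟩
        refine ⟨p, q, 1, ?_, ?_, one_pos, ?_⟩
        · refine lt_of_le_of_ne hp fun h0 => hψ0 (funext fun s => ?_)
          refine le_antisymm ?_ (KK.nonneg h s)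
          rw [he]; simpa [← h0] using (hz s).1
        · refine lt_of_le_of_ne hq fun h0 => hψ0 (funext fun s => ?_)
          refine le_antisymm ?_ (KK.nonneg h s)
          rcases lt_or_ge s 0 with hs | hs
          · rw [h.2.2.2 s hs]; simp
          · rw [he]; simpa [← h0] using (hz s).2 hs
        · rw [← he]; simpa using KK.zero
      · push Not at hT
        obtain ⟨b, d, hb, hd0, hd, hne⟩ := hT
        have hTm := TT_mem h hb hd
        have hT0 : TT ψ b d ≠ 0 := fun h0 => hne 0 (by simp [h0])
        obtain ⟨t, ht, hm, p, q, hpq, he⟩ := step _ 1 hTm hT0 one_pos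
          (by simpa using sub_TT_mem h hb hd0 hd)
        have hex : ∃ j, 0 < p j ∧ 0 < q j := by
          by_contra! hcon
          have : ∑ j, atm (p j) (q j) = 0 := by
            refine Finset.sum_eq_zero fun j _ => ?_
            rcases hpq j with h1 | h1
            · exact absurd h1.2 (not_lt.2 (hcon j h1.1))
            · ext s; simp [atm, h1.1, h1.2]
          rw [this, sub_eq_zero] at he
          refine hne (1 / t) ?_
          conv_rhs => rw [he]
          rw [smul_smul, one_div_mul_cancel ht.ne', one_smul]
        obtain ⟨j, hj⟩ := hex
        refine ⟨p j, q j, 1, hj.1, hj.2, one_pos, ?_⟩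
        have hrest : ψ - t • TT ψ b d - atm (p j) (q j) ∈ KK := by
          rw [he, ← Finset.add_sum_erase _ _ (Finset.mem_univ j), add_sub_cancel_left]
          refine sum_atm_mem (fun j => ?_) _
          rcases hpq j with h1 | h1
          · exact ⟨h1.1.le, h1.2.le⟩
          · exact ⟨h1.1.ge, h1.2.ge⟩
        convert KK.add hrest (KK.smul hTm ht.le) using 1
        module
    obtain ⟨p, q, ε, hp, hq, hε, hh⟩ := hatom
    obtain ⟨t, ht, hm, p', q', hpq, he⟩ := step _ ε (atm_mem hp.le hq.le) (atm_ne hp hq) hε hh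
    refine ⟨Fin.cons (t * p) p', Fin.cons (t * q) q', fun j => ?_, ?_⟩
    · refine Fin.cases ?_ (fun j => ?_) j
      · left; simp only [Fin.cons_zero]; exact ⟨by positivity, by positivity⟩
      · simpa using hpq j
    · rw [Fin.sum_univ_succ]
      simp only [Fin.cons_zero, Fin.cons_succ]
      rw [← he, ← smul_atm ht.le]; abel

/-! ### Linear functionals -/

lemma exists_lim : ∃ l : (ℝ → ℝ) →ₗ[ℝ] ℝ,
    ∀ φ c, Tendsto φ atTop (nhds c) → l φ = c := by
  let E : Submodule ℝ (ℝ → ℝ) :=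
    { carrier := {φ | ∃ c, Tendsto φ atTop (nhds c)}
      zero_mem' := ⟨0, tendsto_const_nhds⟩
      add_mem' := by rintro φ χ ⟨c, hc⟩ ⟨d, hd⟩; exact ⟨c + d, hc.add hd⟩
      smul_mem' := by rintro a φ ⟨c, hc⟩; exact ⟨a * c, hc.const_mul a⟩ }
  have hE : ∀ φ : E, Tendsto (φ : ℝ → ℝ) atTop (nhds (Classical.choose φ.2)) :=
    fun φ => Classical.choose_spec φ.2
  let l : E →ₗ[ℝ] ℝ :=
    { toFun := fun φ => Classical.choose φ.2
      map_add' := fun φ χ => tendsto_nhds_unique (hE (φ + χ)) ((hE φ).add (hE χ))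
      map_smul' := fun a φ => tendsto_nhds_unique (hE (a • φ)) ((hE φ).const_mul a) }
  obtain ⟨g, hg⟩ := LinearMap.exists_extend l
  refine ⟨g, fun φ c hc => ?_⟩
  have h1 := LinearMap.congr_fun hg ⟨φ, c, hc⟩
  have h2 : l ⟨φ, c, hc⟩ = c := tendsto_nhds_unique (hE ⟨φ, c, hc⟩) hc
  rw [← h2, ← h1]; rfl

lemma exists_int (μ : Measure ℝ) : ∃ l : (ℝ → ℝ) →ₗ[ℝ] ℝ,
    ∀ φ, Integrable φ μ → l φ = ∫ x, φ x ∂μ := by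
  let E : Submodule ℝ (ℝ → ℝ) :=
    { carrier := {φ | Integrable φ μ}
      zero_mem' := integrable_zero _ _ _
      add_mem' := by intro φ χ h h'; exact Integrable.add h h'
      smul_mem' := by intro a φ h; exact Integrable.smul a h }
  let l : E →ₗ[ℝ] ℝ :=
    { toFun := fun φ => ∫ x, (φ : ℝ → ℝ) x ∂μ
      map_add' := fun φ χ => integral_add φ.2 χ.2
      map_smul' := fun a φ => integral_const_mul a _ }
  obtain ⟨g, hg⟩ := LinearMap.exists_extend l
  exact ⟨g, fun φ h => LinearMap.congr_fun hg ⟨φ, h⟩⟩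

/-- The limit at infinity. -/
def limTop : (ℝ → ℝ) →ₗ[ℝ] ℝ := Classical.choose exists_lim

lemma limTop_eq {φ : ℝ → ℝ} {c : ℝ} (h : Tendsto φ atTop (nhds c)) : limTop φ = c :=
  Classical.choose_spec exists_lim φ c h

/-- The transformation `φ ↦ u φ(1/u)`. -/
def rev : (ℝ → ℝ) →ₗ[ℝ] (ℝ → ℝ) where
  toFun φ := fun u => u * φ (1 / u)
  map_add' φ χ := by ext u; simp [mul_add]
  map_smul' a φ := by ext u; simp; ring

/-- The slope at zero. -/
def slope0 : (ℝ → ℝ) →ₗ[ℝ] ℝ := limTop ∘ₗ rev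

lemma le_limTop {χ : ℝ → ℝ} (h : Monotone χ) {M : ℝ} (hM : ∀ s, χ s ≤ M) :
    limTop χ ≤ M ∧ ∀ s, χ s ≤ limTop χ := by
  have hb : BddAbove (Set.range χ) := ⟨M, by rintro _ ⟨s, rfl⟩; exact hM s⟩
  rw [limTop_eq (tendsto_atTop_ciSup h hb)]
  exact ⟨ciSup_le hM, fun s => le_ciSup hb s⟩

lemma rev_mono {χ : ℝ → ℝ} (h : χ ∈ KK) : Monotone (rev χ) := by
  have hz : ∀ u, u ≤ 0 → rev χ u = 0 := by
    intro u hu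
    rcases hu.eq_or_lt with rfl | hu
    · simp [rev]
    · have : χ u⁻¹ = 0 := h.2.2.2 _ (by simpa using hu)
      simp [rev, this]
  intro u v huv
  rcases le_or_gt u 0 with hu | hu
  · rw [hz u hu]
    rcases le_or_gt v 0 with hv | hv
    · rw [hz v hv]
    · exact mul_nonneg hv.le (KK.nonneg h _)
  · have hv : 0 < v := by linarith
    have := KK.scale h (s := 1 / v) (t := 1 / u) (by positivity)
      (one_div_le_one_div_of_le hu huv)
    simp only [rev, LinearMap.coe_mk, AddHom.coe_mk]
    have h2 := mul_le_mul_of_nonneg_left this (mul_pos hu hv).le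
    have e1 : u * v * (1 / v * χ (1 / u)) = u * χ (1 / u) := by field_simp
    have e2 : u * v * (1 / u * χ (1 / v)) = v * χ (1 / v) := by field_simp
    rwa [e1, e2] at h2

lemma KK_limits {χ : ℝ → ℝ} (h : χ ∈ KK) {M : ℝ} (hM0 : 0 ≤ M)
    (hM : ∀ s, 0 ≤ s → χ s ≤ M * min 1 s) :
    limTop χ ≤ M ∧ slope0 χ ≤ M ∧ (∀ s, χ s ≤ limTop χ) ∧
      ∀ s, 0 ≤ s → χ s ≤ slope0 χ * s := by
  have h1 : ∀ s, χ s ≤ M := by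
    intro s
    rcases lt_or_ge s 0 with hs | hs
    · rw [h.2.2.2 s hs]; exact hM0
    · exact (hM s hs).trans (mul_le_of_le_one_right hM0 (min_le_left _ _))
  have h2 : ∀ u, rev χ u ≤ M := by
    intro u
    rcases le_or_gt u 0 with hu | hu
    · exact (rev_mono h hu).trans (by simpa [rev] using hM0)
    · have := hM (1 / u) (by positivity)
      have h3 : χ (1 / u) ≤ M * (1 / u) :=
        this.trans (mul_le_mul_of_nonneg_left (min_le_right _ _) hM0)
      have h4 := mul_le_mul_of_nonneg_left h3 hu.le
      have e : u * (M * (1 / u)) = M := by field_simp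
      rw [e] at h4; exact h4
  obtain ⟨a1, a2⟩ := le_limTop (KK.mono h) h1
  obtain ⟨b1, b2⟩ := le_limTop (rev_mono h) h2
  refine ⟨a1, b1, a2, fun s hs => ?_⟩
  rcases hs.eq_or_lt with rfl | hs
  · simp [h.2.2.1]
  have h3 : 1 / s * χ (1 / (1 / s)) ≤ slope0 χ := b2 (1 / s)
  rw [one_div_one_div] at h3
  have h4 := mul_le_mul_of_nonneg_right h3 hs.le
  have e : 1 / s * χ s * s = χ s := by field_simp
  rwa [e] at h4

lemma limits_atm {p q : ℝ} (h : (0 < p ∧ 0 < q) ∨ (p = 0 ∧ q = 0)) :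
    limTop (atm p q) = p ∧ slope0 (atm p q) = q := by
  rcases h with ⟨hp, hq⟩ | ⟨rfl, rfl⟩
  · constructor
    · refine limTop_eq (tendsto_const_nhds.congr' ?_)
      filter_upwards [eventually_ge_atTop (p / q)] with s hs
      have hs0 : 0 < s := lt_of_lt_of_le (by positivity) hs
      rw [div_le_iff₀ hq] at hs
      simp only [atm, not_lt.2 hs0.le, if_false]
      rw [min_eq_left (by linarith)]
    · refine limTop_eq (tendsto_const_nhds.congr' ?_)
      filter_upwards [eventually_ge_atTop (q / p)] with s hs
      have hs0 : 0 < s := lt_of_lt_of_le (by positivity) hs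
      rw [div_le_iff₀ hp] at hs
      have : ¬ (1 / s < 0) := not_lt.2 (by positivity)
      simp only [atm, rev, LinearMap.coe_mk, AddHom.coe_mk, this, if_false]
      rw [min_eq_right]
      · field_simp
      · rw [mul_one_div, div_le_iff₀ hs0]; linarith
  · have : atm 0 0 = 0 := by ext s; simp [atm]
    simp [this]

/-- Description of the admissible perturbation directions. -/
def Adm (ψ φ : ℝ → ℝ) (C : ℝ) : Prop :=
  C • ψ + φ ∈ KK ∧ C • ψ - φ ∈ KK ∧
    ∀ s, 0 ≤ s → |φ s| ≤ C * (min 1 s - ψ s)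

lemma exists_adm {ψ φ : ℝ → ℝ} (h : ψ ∈ KK) (hM : ∀ s, 0 ≤ s → ψ s ≤ min 1 s)
    (hφ : φ ∈ WW ψ) (h0 : slope0 ψ = 1 → slope0 φ = 0) (h1 : limTop ψ = 1 → limTop φ = 0) :
    ∃ C : ℝ, 0 < C ∧ Adm ψ φ C := by
  obtain ⟨C₁, hC₁, hp, hm⟩ := hφ
  obtain ⟨l1, l2, -, -⟩ := KK_limits h (M := 1) zero_le_one (by simpa using hM)
  have aux : ∀ a b : ℝ, a ≤ 1 → (a = 1 → b = 0) →
      0 ≤ |b| / (1 - a) ∧ |b| ≤ |b| / (1 - a) * (1 - a) := by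
    intro a b ha hab
    refine ⟨div_nonneg (abs_nonneg _) (by linarith), ?_⟩
    by_cases h1 : a = 1
    · simp [hab h1]
    · rw [div_mul_cancel₀]
      intro h2; exact h1 (by linarith)
  obtain ⟨a1, a2⟩ := aux _ _ l2 h0
  obtain ⟨b1, b2⟩ := aux _ _ l1 h1
  set x := |slope0 φ| / (1 - slope0 ψ)
  set y := |limTop φ| / (1 - limTop ψ)
  set C := C₁ + 1 + x + y with hC
  have hC0 : 0 < C := by positivity
  have hp' : C • ψ + φ ∈ KK := by
    convert KK.add hp (KK.smul h (c := 1 + x + y) (by positivity)) using 1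
    rw [hC]; module
  have hm' : C • ψ - φ ∈ KK := by
    convert KK.add hm (KK.smul h (c := 1 + x + y) (by positivity)) using 1
    rw [hC]; module
  have hs0 : |slope0 φ| ≤ C * (1 - slope0 ψ) :=
    a2.trans (mul_le_mul_of_nonneg_right (by linarith) (by linarith))
  have hs1 : |limTop φ| ≤ C * (1 - limTop ψ) :=
    b2.trans (mul_le_mul_of_nonneg_right (by linarith) (by linarith))
  have bound : ∀ χ : ℝ → ℝ, χ ∈ KK → (∀ s, 0 ≤ s → χ s ≤ (2 * C) * min 1 s) →
      slope0 χ ≤ C → limTop χ ≤ C → ∀ s, 0 ≤ s → χ s ≤ C * min 1 s := by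
    intro χ hχ hb e0 e1 s hs
    obtain ⟨-, -, k1, k2⟩ := KK_limits hχ (by positivity) hb
    rw [mul_min_of_nonneg _ _ hC0.le, mul_one]
    exact le_min ((k1 s).trans e1) ((k2 s hs).trans (mul_le_mul_of_nonneg_right e0 hs))
  have bp := bound _ hp' (fun s hs => by
      have := KK.nonneg hm' s
      have h3 := mul_le_mul_of_nonneg_left (hM s hs) hC0.le
      simp only [Pi.sub_apply, Pi.add_apply, Pi.smul_apply, smul_eq_mul] at *
      linarith)
    (by simp only [map_add, map_smul, smul_eq_mul]; have := le_abs_self (slope0 φ); linarith)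
    (by simp only [map_add, map_smul, smul_eq_mul]; have := le_abs_self (limTop φ); linarith)
  have bm := bound _ hm' (fun s hs => by
      have := KK.nonneg hp' s
      have h3 := mul_le_mul_of_nonneg_left (hM s hs) hC0.le
      simp only [Pi.sub_apply, Pi.add_apply, Pi.smul_apply, smul_eq_mul] at *
      linarith)
    (by simp only [map_sub, map_smul, smul_eq_mul]; have := neg_abs_le (slope0 φ); linarith)
    (by simp only [map_sub, map_smul, smul_eq_mul]; have := neg_abs_le (limTop φ); linarith)
  refine ⟨C, hC0, hp', hm', fun s hs => ?_⟩
  have c1 := bp s hs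
  have c2 := bm s hs
  simp only [Pi.sub_apply, Pi.add_apply, Pi.smul_apply, smul_eq_mul] at c1 c2
  rw [abs_le]; constructor <;> linarith

lemma Cclass_iff {ψ : ℝ → ℝ} : ψ ∈ Cclass ↔ ψ ∈ KK ∧ ∀ s, 0 ≤ s → ψ s ≤ min 1 s := by
  constructor
  · rintro ⟨h1, h2, h3, h4, h5⟩
    refine ⟨⟨h2, h3, ?_, h5⟩, h4⟩
    exact le_antisymm ((h4 0 le_rfl).trans (min_le_right _ _)) (h1 0 le_rfl)
  · rintro ⟨h, h4⟩
    exact ⟨fun s _ => KK.nonneg h s, h.1, h.2.1, h4, h.2.2.2⟩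

lemma adm_Cclass {ψ φ : ℝ → ℝ} {C : ℝ} (h : ψ ∈ KK) (hM : ∀ s, 0 ≤ s → ψ s ≤ min 1 s)
    (hC : 0 < C) (hA : Adm ψ φ C) : ∀ ε : ℝ, |ε| ≤ 1 / C → ψ + ε • φ ∈ Cclass := by
  intro ε hε
  obtain ⟨h1, h2, h3⟩ := hA
  have hεC : |ε| * C ≤ 1 := by rwa [le_div_iff₀ hC] at hε
  rw [Cclass_iff]
  constructor
  · rcases abs_cases ε with ⟨e, _⟩ | ⟨e, _⟩
    · convert KK.add (KK.smul h (c := 1 - |ε| * C) (by linarith)) (KK.smul h1 (abs_nonneg ε))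
        using 1
      rw [e]; module
    · convert KK.add (KK.smul h (c := 1 - |ε| * C) (by linarith)) (KK.smul h2 (abs_nonneg ε))
        using 1
      rw [e]; module
  · intro s hs
    have h4 := h3 s hs
    have h5 : 0 ≤ min 1 s - ψ s := by linarith [hM s hs]
    have h6 : ε * φ s ≤ |ε| * |φ s| := by rw [← abs_mul]; exact le_abs_self _
    have h7 := mul_le_mul_of_nonneg_left h4 (abs_nonneg ε)
    have h8 : |ε| * C * (min 1 s - ψ s) ≤ 1 * (min 1 s - ψ s) :=
      mul_le_mul_of_nonneg_right hεC h5
    simp only [Pi.add_apply, Pi.smul_apply, smul_eq_mul]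
    linarith

lemma Ifun_perturb {ψ φ : ℝ → ℝ} {C : ℝ} (h : ψ ∈ KK) (hM : ∀ s, 0 ≤ s → ψ s ≤ min 1 s)
    (hC : 0 < C) (hA : Adm ψ φ C) (ν : Measure ℝ) :
    Tendsto (fun ε : ℝ => Ifun ν (ψ + ε • φ)) (nhds 0) (nhds (Ifun ν ψ)) ∧
    (Ifun ν ψ ≠ ⊤ → Integrable φ (ν.restrict (Set.Ioi 0)) ∧
      (∫ s, φ s ∂(ν.restrict (Set.Ioi 0)) = 0 →
        ∀ᶠ ε : ℝ in nhds 0, Ifun ν (ψ + ε • φ) = Ifun ν ψ)) := by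
  obtain ⟨h1, h2, h3⟩ := hA
  have mψ : Measurable ψ := (KK.mono h).measurable
  have mφ : Measurable φ := by
    have : φ = (C • ψ + φ) - C • ψ := by abel
    rw [this]
    exact (KK.mono h1).measurable.sub (mψ.const_smul C)
  have hball : ∀ r : ℝ, 0 < r → ∀ᶠ ε : ℝ in nhds 0, |ε| < r := by
    intro r hr
    filter_upwards [Metric.ball_mem_nhds (0:ℝ) hr] with ε hε
    simpa using hε
  set δ : ℝ → ℝ := fun s => min 1 s - ψ s with hδ
  have mδ : Measurable δ := by fun_prop
  have hδ0 : ∀ s, 0 ≤ s → 0 ≤ δ s := fun s hs => by simp only [hδ]; linarith [hM s hs]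
  by_cases htop : Ifun ν ψ = ⊤
  · refine ⟨?_, fun hne => absurd htop hne⟩
    rw [htop]
    refine tendsto_const_nhds.congr' ?_
    filter_upwards [hball (1 / (2 * C)) (by positivity)] with ε hε
    symm
    rw [eq_top_iff]
    have hεC : |ε| * C ≤ 1 / 2 := by
      rw [lt_div_iff₀ (by positivity)] at hε; linarith
    calc (⊤ : ℝ≥0∞) = ENNReal.ofReal (1 / 2) * Ifun ν ψ := by
          rw [htop, ENNReal.mul_top]; simp
      _ = ∫⁻ s in Set.Ioi (0 : ℝ), ENNReal.ofReal (1 / 2) * ENNReal.ofReal (δ s) ∂ν := by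
          rw [lintegral_const_mul _ mδ.ennreal_ofReal]; rfl
      _ ≤ Ifun ν (ψ + ε • φ) := by
          refine setLIntegral_mono' measurableSet_Ioi fun s hs => ?_
          have hs : 0 < s := hs
          rw [← ENNReal.ofReal_mul (by norm_num)]
          refine ENNReal.ofReal_le_ofReal ?_
          have h6 : ε * φ s ≤ |ε| * |φ s| := by rw [← abs_mul]; exact le_abs_self _
          have h7 := mul_le_mul_of_nonneg_left (h3 s hs.le) (abs_nonneg ε)
          have h8 : |ε| * C * δ s ≤ 1 / 2 * δ s := mul_le_mul_of_nonneg_right hεC (hδ0 s hs.le)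
          simp only [Pi.add_apply, Pi.smul_apply, smul_eq_mul, hδ] at *
          linarith
  · have nn : 0 ≤ᵐ[ν.restrict (Set.Ioi 0)] δ :=
      (ae_restrict_iff' measurableSet_Ioi).2 (ae_of_all _ fun s hs => hδ0 s (le_of_lt hs))
    have iδ : Integrable δ (ν.restrict (Set.Ioi 0)) :=
      (lintegral_ofReal_ne_top_iff_integrable mδ.aestronglyMeasurable nn).1 htop
    have iφ : Integrable φ (ν.restrict (Set.Ioi 0)) := by
      refine Integrable.mono' (iδ.const_mul C) mφ.aestronglyMeasurable ?_
      exact (ae_restrict_iff' measurableSet_Ioi).2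
        (ae_of_all _ fun s hs => h3 s (le_of_lt hs))
    have form : ∀ ε : ℝ, |ε| < 1 / C → Ifun ν (ψ + ε • φ) = ENNReal.ofReal
        (∫ s, δ s ∂(ν.restrict (Set.Ioi 0)) - ε * ∫ s, φ s ∂(ν.restrict (Set.Ioi 0))) := by
      intro ε hε
      rw [← integral_const_mul, ← integral_sub iδ (iφ.const_mul ε),
        ofReal_integral_eq_lintegral_ofReal (f := fun s => δ s - ε * φ s)
          (iδ.sub (iφ.const_mul ε))]
      · refine lintegral_congr fun s => ?_
        congr 1
        simp only [Pi.add_apply, Pi.smul_apply, smul_eq_mul, hδ, Pi.sub_apply]; ring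
      · refine (ae_restrict_iff' measurableSet_Ioi).2 (ae_of_all _ fun s hs => ?_)
        have hs : 0 < s := hs
        have hεC : |ε| * C ≤ 1 := by
          rw [lt_div_iff₀ (by positivity)] at hε; linarith
        have h6 : ε * φ s ≤ |ε| * |φ s| := by rw [← abs_mul]; exact le_abs_self _
        have h7 := mul_le_mul_of_nonneg_left (h3 s hs.le) (abs_nonneg ε)
        have h8 : |ε| * C * δ s ≤ 1 * δ s := mul_le_mul_of_nonneg_right hεC (hδ0 s hs.le)
        simp only [Pi.zero_apply, Pi.sub_apply, hδ] at *
        linarith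
    have form0 : Ifun ν ψ = ENNReal.ofReal (∫ s, δ s ∂(ν.restrict (Set.Ioi 0))) := by
      simpa using form 0 (by simpa using hC)
    refine ⟨?_, fun _ => ⟨iφ, fun hz => ?_⟩⟩
    · have : Tendsto (fun ε : ℝ => ENNReal.ofReal
        (∫ s, δ s ∂(ν.restrict (Set.Ioi 0)) - ε * ∫ s, φ s ∂(ν.restrict (Set.Ioi 0))))
          (nhds 0) (nhds (Ifun ν ψ)) := by
        rw [form0]
        refine ENNReal.tendsto_ofReal ?_
        have hc : Continuous (fun ε : ℝ => ∫ s, δ s ∂(ν.restrict (Set.Ioi 0))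
          - ε * ∫ s, φ s ∂(ν.restrict (Set.Ioi 0))) := by fun_prop
        simpa using hc.tendsto 0
      refine this.congr' ?_
      filter_upwards [hball (1 / C) (by positivity)] with ε hε
      exact (form ε hε).symm
    · filter_upwards [hball (1 / C) (by positivity)] with ε hε
      rw [form ε hε, form0, hz]; simp

/-- The common core of both parts. -/
lemma extreme_core (rel : ℝ≥0∞ → ℝ≥0∞ → Prop)
    (hrel : ∀ a d, rel a d → a ≠ d → ∀ᶠ x in nhds a, rel x d)
    (m : ℕ) (νs : Fin m → Measure ℝ) (D : Fin m → ℝ) (ψ : ℝ → ℝ) (k : ℕ)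
    (hk : k = (Finset.univ.filter fun i : Fin m =>
        Ifun (νs i) ψ = ENNReal.ofReal (D i)).card)
    (hψ : ψ ∈ Set.extremePoints ℝ
        {φ : ℝ → ℝ | φ ∈ Cclass ∧ ∀ i, rel (Ifun (νs i) φ) (ENNReal.ofReal (D i))}) :
    ∃ p q : Fin (k + 2) → ℝ, (∀ j, 0 ≤ p j) ∧ (∀ j, 0 ≤ q j) ∧
        ∑ j, p j = 1 ∧ ∑ j, q j = 1 ∧
        ∀ s : ℝ, 0 ≤ s → ψ s = ∑ j, min (p j) (q j * s) := by
  obtain ⟨⟨hC, hR⟩, hext⟩ := hψ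
  obtain ⟨hK, hM⟩ := Cclass_iff.1 hC
  choose li hli using fun i => exists_int ((νs i).restrict (Set.Ioi 0))
  have kill : ∀ φ C, 0 < C → Adm ψ φ C →
      (∀ i, Ifun (νs i) ψ = ENNReal.ofReal (D i) → li i φ = 0) → φ = 0 := by
    intro φ C hC0 hA hz
    have e1 : ∀ᶠ ε : ℝ in nhds 0, ∀ i, rel (Ifun (νs i) (ψ + ε • φ)) (ENNReal.ofReal (D i)) := by
      rw [eventually_all]
      intro i
      obtain ⟨t1, t2⟩ := Ifun_perturb hK hM hC0 hA (νs i)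
      by_cases hact : Ifun (νs i) ψ = ENNReal.ofReal (D i)
      · obtain ⟨i1, i2⟩ := t2 (by rw [hact]; exact ENNReal.ofReal_ne_top)
        have hz' := hz i hact
        rw [hli i φ i1] at hz'
        filter_upwards [i2 hz'] with ε hε
        rw [hε]; exact hR i
      · exact t1.eventually (hrel _ _ (hR i) hact)
    have e2 : ∀ᶠ ε : ℝ in nhds 0, ψ + ε • φ ∈ Cclass := by
      filter_upwards [Metric.ball_mem_nhds (0:ℝ) (show 0 < 1 / C by positivity)] with ε hε
      refine adm_Cclass hK hM hC0 hA ε ?_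
      have : |ε| < 1 / C := by simpa using hε
      exact this.le
    have e3 := e2.and e1
    have hneg : Tendsto (fun x : ℝ => -x) (nhds 0) (nhds 0) := by
      simpa using (continuous_neg (G := ℝ)).tendsto 0
    have e4 := hneg.eventually e3
    have e5 := (e3.and e4).filter_mono (nhdsWithin_le_nhds (s := Set.Ioi (0:ℝ)))
    obtain ⟨ε, ⟨he1, he2⟩, hε⟩ := (e5.and self_mem_nhdsWithin).exists
    have hε : 0 < ε := hε
    have := hext he1 he2 ⟨1 / 2, 1 / 2, by norm_num, by norm_num, by norm_num, by module⟩
    have h0 : ε • φ = 0 := by simpa using this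
    exact (smul_eq_zero.1 h0).resolve_left hε.ne'
  set e0 : ℕ := if slope0 ψ = 1 then 1 else 0 with he0
  set e1 : ℕ := if limTop ψ = 1 then 1 else 0 with he1
  set A := {i : Fin m // Ifun (νs i) ψ = ENNReal.ofReal (D i)} with hA
  have hcard : Fintype.card A = k := by rw [hk, Fintype.card_subtype]
  let G : (ℝ → ℝ) →ₗ[ℝ] (A → ℝ) × (Fin e0 → ℝ) × (Fin e1 → ℝ) :=
    (LinearMap.pi fun i : A => li i.1).prod
      ((LinearMap.pi fun _ => slope0).prod (LinearMap.pi fun _ => limTop))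
  have hinj : Function.Injective (G.domRestrict (WW ψ)) := by
    rw [← LinearMap.ker_eq_bot, LinearMap.ker_eq_bot']
    rintro ⟨φ, hφ⟩ h0
    have hG : G φ = 0 := h0
    have g1 : (fun i : A => li i.1 φ) = 0 := congrArg Prod.fst hG
    have g2 : (fun _ : Fin e0 => slope0 φ) = 0 := congrArg (fun x => x.2.1) hG
    have g3 : (fun _ : Fin e1 => limTop φ) = 0 := congrArg (fun x => x.2.2) hG
    obtain ⟨C, hC0, hAdm⟩ := exists_adm hK hM hφ
      (fun ht => congrFun g2 ⟨0, by rw [he0, if_pos ht]; exact one_pos⟩)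
      (fun ht => congrFun g3 ⟨0, by rw [he1, if_pos ht]; exact one_pos⟩)
    have := kill φ C hC0 hAdm (fun i hi => congrFun g1 ⟨i, hi⟩)
    exact Subtype.ext this
  have hfd : FiniteDimensional ℝ (WW ψ) := FiniteDimensional.of_injective _ hinj
  have hrank : Module.finrank ℝ (WW ψ) ≤ k + (e0 + e1) := by
    have := LinearMap.finrank_le_finrank_of_injective hinj
    simpa [hcard] using this
  obtain ⟨p, q, hpq, hsum⟩ := finite_atoms _ ψ hK ⟨1, zero_le_one, by simpa using hM⟩ hfd hrank
  have hp0 : ∀ j, 0 ≤ p j := fun j => by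
    rcases hpq j with h1 | h1
    · exact h1.1.le
    · exact h1.1.ge
  have hq0 : ∀ j, 0 ≤ q j := fun j => by
    rcases hpq j with h1 | h1
    · exact h1.2.le
    · exact h1.2.ge
  have hlim : limTop ψ = ∑ j, p j := by
    conv_lhs => rw [hsum]
    rw [map_sum]
    exact Finset.sum_congr rfl fun j _ => (limits_atm (hpq j)).1
  have hslope : slope0 ψ = ∑ j, q j := by
    conv_lhs => rw [hsum]
    rw [map_sum]
    exact Finset.sum_congr rfl fun j _ => (limits_atm (hpq j)).2
  obtain ⟨l1, l2, -, -⟩ := KK_limits hK (M := 1) zero_le_one (by simpa using hM)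
  have hcards : Fintype.card (Fin (k + 2)) =
      Fintype.card (Fin (k + (e0 + e1)) ⊕ Fin (1 - e0) ⊕ Fin (1 - e1)) := by
    simp only [Fintype.card_fin, Fintype.card_sum]
    have : e0 ≤ 1 := by rw [he0]; split_ifs <;> simp
    have : e1 ≤ 1 := by rw [he1]; split_ifs <;> simp
    omega
  let eqv := Fintype.equivOfCardEq hcards
  let P : Fin (k + (e0 + e1)) ⊕ Fin (1 - e0) ⊕ Fin (1 - e1) → ℝ :=
    Sum.elim p (Sum.elim (fun _ => 0) (fun _ => 1 - limTop ψ))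
  let Q : Fin (k + (e0 + e1)) ⊕ Fin (1 - e0) ⊕ Fin (1 - e1) → ℝ :=
    Sum.elim q (Sum.elim (fun _ => 1 - slope0 ψ) (fun _ => 0))
  have hP0 : ∀ x, 0 ≤ P x := by
    rintro (j | j | j)
    · exact hp0 j
    · exact le_rfl
    · exact sub_nonneg.2 l1
  have hQ0 : ∀ x, 0 ≤ Q x := by
    rintro (j | j | j)
    · exact hq0 j
    · exact sub_nonneg.2 l2
    · exact le_rfl
  refine ⟨fun j => P (eqv j), fun j => Q (eqv j), fun j => hP0 _, fun j => hQ0 _, ?_, ?_, ?_⟩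
  · rw [eqv.sum_comp P]
    simp only [P, Fintype.sum_sum_type, Sum.elim_inl, Sum.elim_inr, ← hlim, Finset.sum_const,
      Finset.card_univ, Fintype.card_fin, he1]
    by_cases ht : limTop ψ = 1
    · simp [ht]
    · simp [ht]
  · rw [eqv.sum_comp Q]
    simp only [Q, Fintype.sum_sum_type, Sum.elim_inl, Sum.elim_inr, ← hslope, Finset.sum_const,
      Finset.card_univ, Fintype.card_fin, he0]
    by_cases ht : slope0 ψ = 1
    · simp [ht]
    · simp [ht]
  · intro s hs
    rw [eqv.sum_comp (fun x => min (P x) (Q x * s))]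
    simp only [P, Q, Fintype.sum_sum_type, Sum.elim_inl, Sum.elim_inr]
    have z1 : min 0 ((1 - slope0 ψ) * s) = 0 :=
      min_eq_left (mul_nonneg (sub_nonneg.2 l2) hs)
    have z2 : min (1 - limTop ψ) (0 * s) = 0 := by
      rw [zero_mul]; exact min_eq_right (sub_nonneg.2 l1)
    simp only [z1, z2, Finset.sum_const_zero, add_zero]
    have := congrFun hsum s
    rw [this, Finset.sum_apply]
    simp only [atm, not_lt.2 hs, if_false]

/-- **Theorem 3 (characterization of extreme points).** If `ψ ∈ ∩_i C_1(f_i, D_i)` is an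
extreme point and `k` is the number of indices `i` with `I_{f_i}(ψ) = D_i`, then
`ψ = ψ_{P,Q}` for probability measures `P, Q` on a set with `k + 2` points; the same holds
for extreme points of `∩_i C_2(f_i, D_i)` provided all divergences `D_{f_i}` are finite. -/
theorem extreme_point_characterization (m : ℕ) (fs : Fin m → ℝ → ℝ)
    (hfs : ∀ i, ConvexOn ℝ (Set.Ioi 0) (fs i)) (hfs1 : ∀ i, fs i 1 = 0)
    (νs : Fin m → Measure ℝ) (hνs : ∀ i, IsCurvatureMeasure (fs i) (νs i))
    (D : Fin m → ℝ) (hD : ∀ i, 0 ≤ D i) (ψ : ℝ → ℝ) (k : ℕ)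
    (hk : k = (Finset.univ.filter fun i : Fin m =>
        Ifun (νs i) ψ = ENNReal.ofReal (D i)).card) :
    (ψ ∈ Set.extremePoints ℝ
        {φ : ℝ → ℝ | φ ∈ Cclass ∧ ∀ i, Ifun (νs i) φ ≤ ENNReal.ofReal (D i)} →
      ∃ p q : Fin (k + 2) → ℝ, (∀ j, 0 ≤ p j) ∧ (∀ j, 0 ≤ q j) ∧
        ∑ j, p j = 1 ∧ ∑ j, q j = 1 ∧
        ∀ s : ℝ, 0 ≤ s → ψ s = ∑ j, min (p j) (q j * s)) ∧
    ((∀ i, sSup {x : EReal | ∃ pp : PMPair, x = fDiv (fs i) pp.P pp.Q} < ⊤) →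
      ψ ∈ Set.extremePoints ℝ
        {φ : ℝ → ℝ | φ ∈ Cclass ∧ ∀ i, ENNReal.ofReal (D i) ≤ Ifun (νs i) φ} →
      ∃ p q : Fin (k + 2) → ℝ, (∀ j, 0 ≤ p j) ∧ (∀ j, 0 ≤ q j) ∧
        ∑ j, p j = 1 ∧ ∑ j, q j = 1 ∧
        ∀ s : ℝ, 0 ≤ s → ψ s = ∑ j, min (p j) (q j * s)) := by
  refine ⟨fun h => ?_, fun _ h => ?_⟩
  · exact extreme_core (fun a d => a ≤ d)
      (fun a d had hne => by
        filter_upwards [Iio_mem_nhds (lt_of_le_of_ne had hne)] with x hx using le_of_lt hx)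
      m νs D ψ k hk h
  · exact extreme_core (fun a d => d ≤ a)
      (fun a d had hne => by
        filter_upwards [Ioi_mem_nhds (lt_of_le_of_ne had hne.symm)] with x hx using le_of_lt hx)
      m νs D ψ k hk h


end
end

section
/- Let P and Q be probability measures on a measurable space X with densities p and q with respect to a σ-finite measure λ, and let l ≥ 1. Suppose that for every decreasing sequence s_1 > … > s_l of positive real numbers, min_{1≤j≤l+1} (P(B_j) + Q(B_j)) = 0, where B_1 = {p ≥ q s_1}, B_i = {q s_i ≤ p < q s_{i−1}} for i = 2,…,l, and B_{l+1} = {p < q s_l}. Then ψ_{P,Q} = ψ_{P',Q'} for some probability measures P', Q' on the finite set {1,…,l}. -/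
open MeasureTheory Filter Set
open scoped ENNReal NNReal Classical

noncomputable section

/-- The partition sets `B_1 = {p ≥ q s_1}`, `B_i = {q s_i ≤ p < q s_{i-1}}` (for `2 ≤ i ≤ l`),
`B_{l+1} = {p < q s_l}` of Lemma 5, indexed by `j : Fin (l+1)` (0-indexed). -/
def Bset {Ω : Type*} (p q : Ω → ℝ) {l : ℕ} (s : Fin l → ℝ) (j : Fin (l + 1)) : Set Ω :=
  {x | (∀ h : (j : ℕ) < l, q x * s ⟨j, h⟩ ≤ p x) ∧
       (∀ _ : 0 < (j : ℕ), p x < q x * s ⟨(j : ℕ) - 1, by have := j.isLt; omega⟩)}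

/-- The support of the law of `p / (p + q)` has at most `l` points. -/
theorem support_encard_le {Ω : Type*} [MeasurableSpace Ω]
    (p q : Ω → ℝ) (hp0 : ∀ x, 0 ≤ p x) (hq0 : ∀ x, 0 ≤ q x)
    (hp : Measurable p) (hq : Measurable q)
    (R : Measure Ω) (hR : R {x | p x + q x = 0} = 0) (l : ℕ)
    (hmin : ∀ s : Fin l → ℝ, (∀ i, 0 < s i) → StrictAnti s →
      ∃ j : Fin (l + 1), R (Bset p q s j) = 0) :
    (R.map (fun x => p x / (p x + q x))).support.encard ≤ l := by
  set u : Ω → ℝ := fun x => p x / (p x + q x) with hu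
  have hum : Measurable u := hp.div (hp.add hq)
  have hu01 : ∀ x, u x ∈ Icc (0:ℝ) 1 := fun x =>
    ⟨div_nonneg (hp0 x) (add_nonneg (hp0 x) (hq0 x)),
      div_le_one_of_le₀ (by linarith [hq0 x]) (add_nonneg (hp0 x) (hq0 x))⟩
  have hsub : (R.map u).support ⊆ Icc 0 1 := by
    apply Measure.support_subset_of_isClosed isClosed_Icc
    rw [mem_ae_map_iff hum.aemeasurable measurableSet_Icc]
    exact Filter.univ_mem' hu01
  by_contra hcon
  push Not at hcon
  have h1 : ((l + 1 : ℕ) : ℕ∞) ≤ (R.map u).support.encard := by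
    have := Order.add_one_le_of_lt hcon
    exact_mod_cast this
  obtain ⟨T, hTs, hTc⟩ := Set.exists_subset_encard_eq h1
  have hTf : T.Finite := Set.finite_of_encard_eq_coe hTc
  have hcard : hTf.toFinset.card = l + 1 := by
    rw [hTf.encard_eq_coe_toFinset_card] at hTc
    exact_mod_cast hTc
  set e : Fin (l + 1) → ℝ := fun j => hTf.toFinset.orderEmbOfFin hcard j.rev with he
  have heS : ∀ j, e j ∈ (R.map u).support := fun j =>
    hTs (hTf.mem_toFinset.1 (Finset.orderEmbOfFin_mem _ hcard _))
  have heanti : StrictAnti e := by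
    intro a b hab
    exact (hTf.toFinset.orderEmbOfFin hcard).strictMono (Fin.rev_lt_rev.2 hab)
  have he01 := fun j => hsub (heS j)
  set c : Fin l → ℝ := fun i => (e i.castSucc + e i.succ) / 2 with hc
  have hlt : ∀ i : Fin l, e i.succ < e i.castSucc := fun i => heanti Fin.castSucc_lt_succ
  have hc0 : ∀ i, 0 < c i := fun i => by
    have := (he01 i.succ).1; have := hlt i; simp only [hc]; linarith
  have hc1 : ∀ i, c i < 1 := fun i => by
    have := (he01 i.castSucc).2; have := hlt i; simp only [hc]; linarith
  have hcanti : StrictAnti c := by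
    intro a b hab
    have h1 := heanti (Fin.castSucc_lt_castSucc_iff.2 hab)
    have h2 := heanti (Fin.succ_lt_succ_iff.2 hab)
    simp only [hc]; linarith
  obtain ⟨j, hj⟩ := hmin (fun i => c i / (1 - c i))
    (fun i => div_pos (hc0 i) (by linarith [hc1 i])) (by
      intro a b hab
      have := hcanti hab
      have h1 := hc1 a
      have h2 := hc1 b
      show c b / (1 - c b) < c a / (1 - c a)
      rw [div_lt_div_iff₀ (by linarith) (by linarith)]
      nlinarith)
  have hpos : ∀ U ∈ nhds (e j), 0 < R.map u U :=
    (Measure.mem_support_iff_forall _).1 (heS j)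
  set U : Set ℝ := {t | (∀ h : (j : ℕ) < l, c ⟨j, h⟩ < t) ∧
    (∀ _ : 0 < (j : ℕ), t < c ⟨(j : ℕ) - 1, by have := j.isLt; omega⟩)} with hU
  have hUo : IsOpen U := by
    rw [hU, setOf_and]
    refine IsOpen.inter ?_ ?_
    · by_cases h : (j : ℕ) < l
      · simp only [h, forall_true_left]; exact isOpen_Ioi
      · simp [h]
    · by_cases h : 0 < (j : ℕ)
      · simp only [h, forall_true_left]; exact isOpen_Iio
      · simp [h]
  have hmem : e j ∈ U := by
    constructor
    · intro h
      have h1 := hlt ⟨j, h⟩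
      have h2 : (⟨j, h⟩ : Fin l).castSucc = j := rfl
      simp only [hc, h2] at h1 ⊢
      linarith
    · intro h
      have hj' : (j : ℕ) - 1 < l := by have := j.isLt; omega
      have h1 := hlt ⟨(j : ℕ) - 1, hj'⟩
      have h2 : (⟨(j : ℕ) - 1, hj'⟩ : Fin l).succ = j := by
        ext; simp; omega
      simp only [hc, h2] at h1 ⊢
      linarith
  have := hpos U (hUo.mem_nhds hmem)
  rw [Measure.map_apply hum hUo.measurableSet] at this
  refine this.ne' (measure_mono_null ?_ (measure_union_null hj hR))
  intro x hx
  by_cases h0 : p x + q x = 0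
  · exact Or.inr h0
  left
  have hpq : 0 < p x + q x := lt_of_le_of_ne (add_nonneg (hp0 x) (hq0 x)) (Ne.symm h0)
  refine ⟨fun h => ?_, fun h => ?_⟩
  · have h1 := hx.1 h
    have h2 := hc1 ⟨j, h⟩
    simp only [hu] at h1
    rw [lt_div_iff₀ hpq] at h1
    rw [mul_div_assoc', div_le_iff₀ (by linarith)]
    nlinarith
  · have h1 := hx.2 h
    have h2 := hc1 ⟨(j : ℕ) - 1, by have := j.isLt; omega⟩
    simp only [hu] at h1
    rw [div_lt_iff₀ hpq] at h1
    rw [mul_div_assoc', lt_div_iff₀ (by linarith)]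
    nlinarith

/-- **Lemma 5.** If for every decreasing sequence `s_1 > … > s_l > 0` one of the sets `B_j` is
`(P+Q)`-null, then `ψ_{P,Q} = ψ_{P',Q'}` for probability measures `P', Q'` on `{1,…,l}`. -/
theorem psi_eq_finite_psi {Ω : Type*} [MeasurableSpace Ω]
    (lam : Measure Ω) [SigmaFinite lam] (p q : Ω → ℝ)
    (hp : Measurable p) (hq : Measurable q) (hp0 : ∀ x, 0 ≤ p x) (hq0 : ∀ x, 0 ≤ q x)
    (P Q : Measure Ω)
    (hP : P = lam.withDensity fun x => ENNReal.ofReal (p x))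
    (hQ : Q = lam.withDensity fun x => ENNReal.ofReal (q x))
    [IsProbabilityMeasure P] [IsProbabilityMeasure Q]
    (l : ℕ) (hl : 1 ≤ l)
    (hmin : ∀ s : Fin l → ℝ, (∀ i, 0 < s i) → StrictAnti s →
      ∃ j : Fin (l + 1), P (Bset p q s j) + Q (Bset p q s j) = 0) :
    ∃ p' q' : Fin l → ℝ, (∀ i, 0 ≤ p' i) ∧ (∀ i, 0 ≤ q' i) ∧
      ∑ i, p' i = 1 ∧ ∑ i, q' i = 1 ∧
      ∀ s : ℝ, 0 ≤ s →
        ∫ x, min (p x) (q x * s) ∂lam = ∑ i, min (p' i) (q' i * s) := by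
  set u : Ω → ℝ := fun x => p x / (p x + q x) with hu
  have hum : Measurable u := hp.div (hp.add hq)
  have hPn : ∀ A : Set Ω, P A = 0 ↔ ∀ᵐ x ∂lam, x ∈ A → p x = 0 := by
    intro A
    rw [hP, withDensity_apply_eq_zero hp.ennreal_ofReal, ae_iff]
    congr! 2
    ext x
    simp only [mem_inter_iff, mem_setOf_eq, ne_eq, ENNReal.ofReal_eq_zero, not_le, Classical.not_imp]
    rw [and_comm, (hp0 x).lt_iff_ne']
  have hQn : ∀ A : Set Ω, Q A = 0 ↔ ∀ᵐ x ∂lam, x ∈ A → q x = 0 := by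
    intro A
    rw [hQ, withDensity_apply_eq_zero hq.ennreal_ofReal, ae_iff]
    congr! 2
    ext x
    simp only [mem_inter_iff, mem_setOf_eq, ne_eq, ENNReal.ofReal_eq_zero, not_le, Classical.not_imp]
    rw [and_comm, (hq0 x).lt_iff_ne']
  have hR : (P + Q) {x | p x + q x = 0} = 0 := by
    rw [Measure.add_apply, (hPn _).2, (hQn _).2, add_zero]
    · exact Filter.Eventually.of_forall fun x (hx : p x + q x = 0) => by linarith [hp0 x, hq0 x]
    · exact Filter.Eventually.of_forall fun x (hx : p x + q x = 0) => by linarith [hp0 x, hq0 x]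
  have hcard := support_encard_le p q hp0 hq0 hp hq (P + Q) hR l
    (by simpa only [Measure.add_apply] using hmin)
  rw [← hu] at hcard
  set S := ((P + Q).map u).support with hS
  have hSf : S.Finite := Set.finite_of_encard_le_coe hcard
  have : Nonempty (Fin l) := ⟨⟨0, hl⟩⟩
  obtain ⟨f, -, hf⟩ := hSf.exists_injOn_of_encard_le (t := (univ : Set (Fin l)))
    (by simpa using hcard)
  have hnull : (P + Q) (u ⁻¹' Sᶜ) = 0 := by
    rw [← Measure.map_apply hum Measure.isClosed_support.measurableSet.compl]
    exact Measure.measure_compl_support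
  rw [Measure.add_apply, add_eq_zero, hPn, hQn] at hnull
  set A : Fin l → Set Ω := fun i => u ⁻¹' {t | t ∈ S ∧ f t = i} with hA
  have hAm : ∀ i, MeasurableSet (A i) := fun i =>
    hum (hSf.subset fun t ht => ht.1).measurableSet
  have hAd : Pairwise (Function.onFun Disjoint A) := by
    intro i k hik
    refine Set.disjoint_left.2 fun x hx hy => hik ?_
    exact hx.2.symm.trans hy.2
  have hAU : ⋃ i, A i = u ⁻¹' S := by
    ext x; simp [hA]
  have hpi : Integrable p lam := by
    refine ⟨hp.aestronglyMeasurable, ?_⟩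
    rw [hasFiniteIntegral_iff_ofReal (Filter.Eventually.of_forall hp0)]
    have : P univ = 1 := measure_univ
    rw [hP, withDensity_apply _ MeasurableSet.univ, Measure.restrict_univ] at this
    rw [this]; exact ENNReal.one_lt_top
  have hqi : Integrable q lam := by
    refine ⟨hq.aestronglyMeasurable, ?_⟩
    rw [hasFiniteIntegral_iff_ofReal (Filter.Eventually.of_forall hq0)]
    have : Q univ = 1 := measure_univ
    rw [hQ, withDensity_apply _ MeasurableSet.univ, Measure.restrict_univ] at this
    rw [this]; exact ENNReal.one_lt_top
  have hp1 : ∫ x, p x ∂lam = 1 := by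
    rw [integral_eq_lintegral_of_nonneg_ae (Filter.Eventually.of_forall hp0)
      hp.aestronglyMeasurable]
    have : P univ = 1 := measure_univ
    rw [hP, withDensity_apply _ MeasurableSet.univ, Measure.restrict_univ] at this
    rw [this]; rfl
  have hq1 : ∫ x, q x ∂lam = 1 := by
    rw [integral_eq_lintegral_of_nonneg_ae (Filter.Eventually.of_forall hq0)
      hq.aestronglyMeasurable]
    have : Q univ = 1 := measure_univ
    rw [hQ, withDensity_apply _ MeasurableSet.univ, Measure.restrict_univ] at this
    rw [this]; rfl
  have hsplit : ∀ g : Ω → ℝ, Integrable g lam → (∀ x, p x = 0 → q x = 0 → g x = 0) →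
      ∫ x, g x ∂lam = ∑ i, ∫ x in A i, g x ∂lam := by
    intro g hg hg0
    rw [← integral_iUnion_fintype hAm hAd (fun i => hg.integrableOn), hAU]
    symm
    apply setIntegral_eq_integral_of_ae_compl_eq_zero
    filter_upwards [hnull.1, hnull.2] with x h1 h2 hx
    exact hg0 x (h1 hx) (h2 hx)
  refine ⟨fun i => ∫ x in A i, p x ∂lam, fun i => ∫ x in A i, q x ∂lam,
    fun i => integral_nonneg hp0, fun i => integral_nonneg hq0, ?_, ?_, ?_⟩
  · rw [← hsplit p hpi (fun x h _ => h), hp1]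
  · rw [← hsplit q hqi (fun x _ h => h), hq1]
  intro s hs
  rw [hsplit (fun x => min (p x) (q x * s)) (hpi.inf (hqi.mul_const s)) (fun x h h' => by simp [h, h'])]
  refine Finset.sum_congr rfl fun i _ => ?_
  have hpu : ∀ x, p x = u x * (p x + q x) := by
    intro x
    by_cases h : p x + q x = 0
    · rw [h, mul_zero]; linarith [hp0 x, hq0 x]
    · simp only [hu]; field_simp
  have hconst : ∀ x ∈ A i, ∀ y ∈ A i, u x = u y := fun x hx y hy =>
    hf hx.1 hy.1 (hx.2.trans hy.2.symm)
  have hdich : (∀ x ∈ A i, p x ≤ q x * s) ∨ (∀ x ∈ A i, q x * s ≤ p x) := by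
    rcases (A i).eq_empty_or_nonempty with h | ⟨y, hy⟩
    · left; simp [h]
    rcases le_total (u y * (1 + s)) s with h | h
    · left
      intro x hx
      have h1 := hpu x
      rw [hconst x hx y hy] at h1
      have h2 := mul_le_mul_of_nonneg_right h (add_nonneg (hp0 x) (hq0 x))
      have h3 : u y * (1 + s) * (p x + q x) = (1 + s) * p x := by linear_combination -(1 + s) * h1
      linarith
    · right
      intro x hx
      have h1 := hpu x
      rw [hconst x hx y hy] at h1
      have h2 := mul_le_mul_of_nonneg_right h (add_nonneg (hp0 x) (hq0 x))
      have h3 : u y * (1 + s) * (p x + q x) = (1 + s) * p x := by linear_combination -(1 + s) * h1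
      linarith
  show _ = min (∫ x in A i, p x ∂lam) ((∫ x in A i, q x ∂lam) * s)
  rw [← integral_mul_const]
  rcases hdich with h | h
  · rw [min_eq_left (setIntegral_mono_on hpi.integrableOn (hqi.mul_const s).integrableOn (hAm i) h)]
    exact setIntegral_congr_fun (hAm i) fun x hx => min_eq_left (h x hx)
  · rw [min_eq_right (setIntegral_mono_on (hqi.mul_const s).integrableOn hpi.integrableOn (hAm i) h)]
    exact setIntegral_congr_fun (hAm i) fun x hx => min_eq_right (h x hx)

end
end

section
/- For every m ≥ 1 and convex functions f_1,…,f_m:(0,∞)→ℝ with value 0 at 1, the joint range equals the joint range over (m+2)-point spaces: R(f_1,…,f_m) = R_{m+2}(f_1,…,f_m). That is, every vector of the form (D_{f_1}(P‖Q),…,D_{f_m}(P‖Q)) for some pair of probability measures P, Q on some measurable space is already attained by a pair of probability measures on the finite set {1,…,m+2}. -/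
open MeasureTheory Filter Set
open scoped ENNReal NNReal Classical

noncomputable section

/-- In finite dimension, a probability average of points of a convex set lies in the set
(no closedness needed). -/
theorem convex_integral_mem_fd (n : ℕ) : ∀ {E : Type} [NormedAddCommGroup E] [NormedSpace ℝ E]
    [FiniteDimensional ℝ E] (_ : Module.finrank ℝ E = n) {Ω : Type} [MeasurableSpace Ω]
    (μ : Measure Ω) [IsProbabilityMeasure μ] (C : Set E) (_ : Convex ℝ C) (g : Ω → E)
    (_ : Integrable g μ) (_ : ∀ᵐ ω ∂μ, g ω ∈ C), ∫ ω, g ω ∂μ ∈ C := by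
  induction n using Nat.strong_induction_on with
  | _ n ih =>
  intro E _ _ _ hn Ω _ μ _ C hC g hg hgC
  by_contra hx
  set x := ∫ ω, g ω ∂μ with hxdef
  have key : ∃ l : E →L[ℝ] ℝ, l ≠ 0 ∧ ∀ᵐ ω ∂μ, l (g ω) = l x := by
    by_cases hCint : (interior C).Nonempty
    · obtain ⟨l, hl⟩ := geometric_hahn_banach_open_point hC.interior isOpen_interior
        (fun h => hx (interior_subset h))
      have hcl : ∀ a ∈ C, l a ≤ l x := by
        intro a ha
        have h1 : a ∈ closure (interior C) := by
          rw [hC.closure_interior_eq_closure_of_nonempty_interior hCint]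
          exact subset_closure ha
        have h2 : closure (interior C) ⊆ {a | l a ≤ l x} :=
          closure_minimal (fun a ha => (hl a ha).le)
            (isClosed_le l.continuous continuous_const)
        exact h2 h1
      refine ⟨l, ?_, ?_⟩
      · rintro rfl
        obtain ⟨a, ha⟩ := hCint
        simpa using hl a ha
      · have hi : Integrable (fun ω => l x - l (g ω)) μ :=
          (integrable_const _).sub (l.integrable_comp hg)
        have h0 : ∫ ω, (l x - l (g ω)) ∂μ = 0 := by
          rw [integral_sub (integrable_const _) (l.integrable_comp hg), l.integral_comp_comm hg]
          simp [hxdef]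
        have hnn : 0 ≤ᵐ[μ] fun ω => l x - l (g ω) := by
          filter_upwards [hgC] with ω h
          simpa using hcl _ h
        have := (integral_eq_zero_iff_of_nonneg_ae hnn hi).1 h0
        filter_upwards [this] with ω h
        simp only [Pi.zero_apply] at h
        linarith
    · rw [hC.interior_nonempty_iff_affineSpan_eq_top] at hCint
      obtain ⟨ω0, h0⟩ := hgC.exists
      have hne : (affineSpan ℝ C).direction ≠ ⊤ := by
        intro h
        apply hCint
        rw [AffineSubspace.direction_eq_top_iff_of_nonempty] at h
        · exact h
        · exact ⟨_, subset_affineSpan ℝ C h0⟩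
      obtain ⟨l, hl, hle⟩ := Submodule.exists_le_ker_of_lt_top _ (lt_top_iff_ne_top.2 hne)
      have hc : ∀ a ∈ C, l a = l (g ω0) := by
        intro a ha
        have : a -ᵥ g ω0 ∈ (affineSpan ℝ C).direction :=
          AffineSubspace.vsub_mem_direction (subset_affineSpan ℝ C ha) (subset_affineSpan ℝ C h0)
        have := hle this
        simp only [vsub_eq_sub, LinearMap.mem_ker, map_sub] at this
        linarith
      let l' : E →L[ℝ] ℝ := LinearMap.toContinuousLinearMap l
      have hl' : ∀ a, l' a = l a := fun a => rfl
      have hlx : l' x = l (g ω0) := by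
        rw [hxdef, ← l'.integral_comp_comm hg]
        have : (fun ω => l' (g ω)) =ᵐ[μ] fun _ => l (g ω0) := by
          filter_upwards [hgC] with ω h
          exact hc _ h
        rw [integral_congr_ae this]
        simp
      refine ⟨l', ?_, ?_⟩
      · intro h
        apply hl
        ext a
        rw [← hl', h]; rfl
      · filter_upwards [hgC] with ω h
        rw [hlx]; exact hc _ h
  obtain ⟨l, hl, hae⟩ := key
  let K : Submodule ℝ E := LinearMap.ker (l : E →ₗ[ℝ] ℝ)
  have hKlt : Module.finrank ℝ K < n := by
    rw [← hn]
    apply Submodule.finrank_lt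
    intro h
    apply hl
    ext a
    have : a ∈ K := by rw [show K = ⊤ from h]; trivial
    simpa [K] using this
  obtain ⟨π, hπ⟩ := K.subtype.exists_leftInverse_of_injective (by simp)
  have hπ' : ∀ y : K, π y = y := fun y => by
    have := LinearMap.congr_fun hπ y
    simpa using this
  let p : E →L[ℝ] K := LinearMap.toContinuousLinearMap π
  have hp : ∀ y : K, p y = y := hπ'
  have hi2 : Integrable (fun ω => g ω - x) μ := hg.sub (integrable_const _)
  have hC' : Convex ℝ {y : K | x + (y : E) ∈ C} := by
    intro a ha b hb s t hs ht hst
    have := hC ha hb hs ht hst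
    simp only [mem_ofPred_eq, Submodule.coe_add, Submodule.coe_smul] at *
    convert this using 1
    have h1 : x = s • x + t • x := by rw [← add_smul, hst, one_smul]
    conv_lhs => rw [h1]
    simp only [smul_add]; abel
  have := ih _ hKlt (E := K) rfl μ {y : K | x + (y : E) ∈ C} hC' (fun ω => p (g ω - x))
    (p.integrable_comp hi2) (by
      filter_upwards [hgC, hae] with ω h1 h2
      have hk : g ω - x ∈ K := by simp [K, h2]
      have := hp ⟨g ω - x, hk⟩
      change x + ((p (g ω - x) : K) : E) ∈ C
      rw [this]
      simpa using h1)
  rw [p.integral_comp_comm hi2, integral_sub hg (integrable_const _)] at this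
  simp at this
  exact hx (by simpa [hxdef] using this)

theorem limAtZero_ne_bot (f : ℝ → ℝ) (hf : ConvexOn ℝ (Set.Ioi 0) f) (h1 : f 1 = 0) :
    limAtZero f ≠ ⊥ := by
  have : ((-|f 2| : ℝ) : EReal) ≤ limAtZero f := by
    unfold limAtZero
    refine le_limsup_of_frequently_le' ?_
    apply Eventually.frequently
    have : Ioo (0:ℝ) 1 ∈ nhdsWithin (0:ℝ) (Ioi 0) := Ioo_mem_nhdsGT one_pos
    filter_upwards [this] with x hx
    have := hf.slope_mono_adjacent (x := x) (y := 1) (z := 2) hx.1 (by simp) hx.2 (by norm_num)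
    rw [h1, div_le_iff₀ (by linarith [hx.2])] at this
    norm_cast
    have h2 := le_abs_self (f 2)
    have h3 := abs_nonneg (f 2)
    norm_num at this
    nlinarith [hx.1, hx.2]
  intro h
  rw [h] at this
  exact EReal.coe_ne_bot _ (le_bot_iff.1 this)

theorem derivAtTop_ne_bot (f : ℝ → ℝ) (hf : ConvexOn ℝ (Set.Ioi 0) f) (h1 : f 1 = 0) :
    derivAtTop f ≠ ⊥ := by
  have : ((-(2 * |f (1/2)|) : ℝ) : EReal) ≤ derivAtTop f := by
    unfold derivAtTop
    refine le_limsup_of_frequently_le' ?_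
    apply Eventually.frequently
    filter_upwards [eventually_gt_atTop (1:ℝ)] with x hx
    have := hf.slope_mono_adjacent (x := 1/2) (y := 1) (z := x) (by simp)
      (by simp; linarith) (by norm_num) hx
    rw [h1, le_div_iff₀ (by linarith)] at this
    norm_cast
    rw [le_div_iff₀ (by linarith)]
    have h2 := le_abs_self (f (1/2))
    have h3 := abs_nonneg (f (1/2))
    have h4 : -f (1 / 2) / (1 - 1 / 2) = -2 * f (1/2) := by ring
    rw [zero_sub, h4] at this
    nlinarith
  intro h
  rw [h] at this
  exact EReal.coe_ne_bot _ (le_bot_iff.1 this)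

/-- The perspective function of `f` (with its boundary values). -/
def persp (f : ℝ → ℝ) (p q : ℝ) : ℝ :=
  if q = 0 then p * (derivAtTop f).toReal
  else if p = 0 then q * (limAtZero f).toReal else q * f (p / q)

theorem persp_smul (f : ℝ → ℝ) (c p q : ℝ) : persp f (c * p) (c * q) = c * persp f p q := by
  unfold persp
  by_cases hc : c = 0
  · simp [hc]
  by_cases hq : q = 0
  · simp [hq]; ring
  by_cases hp : p = 0
  · simp [hq, hp, hc]; ring
  · simp [hq, hp, hc, mul_div_mul_left]; ring

theorem ereal_mul_aux (a : EReal) (q : ℝ≥0∞) (ha : a ≠ ⊥) (hq : q ≠ ⊤) (h : q ≠ 0 → a ≠ ⊤) :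
    a * (q : EReal) = ((a.toReal * q.toReal : ℝ) : EReal) := by
  by_cases h0 : q = 0
  · simp [h0]
  · have h1 : a = (a.toReal : EReal) := (EReal.coe_toReal (h h0) ha).symm
    have h2 : (q : EReal) = (q.toReal : EReal) := by
      rw [EReal.coe_ennreal_toReal hq]
    rw [h2, EReal.coe_mul, ← h1]

theorem ereal_mul_ne_bot_aux (a : EReal) (q : ℝ≥0∞) (ha : a ≠ ⊥) (hq : q ≠ ⊤) :
    a * (q : EReal) ≠ ⊥ := by
  by_cases h : q ≠ 0 → a ≠ ⊤
  · rw [ereal_mul_aux a q ha hq h]; exact EReal.coe_ne_bot _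
  · push Not at h
    rw [h.2, EReal.top_mul_of_pos]
    · simp
    · exact_mod_cast pos_iff_ne_zero.2 h.1

theorem ereal_mul_eq_top_aux (a : EReal) (q : ℝ≥0∞)
    (h : ¬ (q ≠ 0 → a ≠ ⊤)) : a * (q : EReal) = ⊤ := by
  push Not at h
  rw [h.2, EReal.top_mul_of_pos]
  exact_mod_cast pos_iff_ne_zero.2 h.1

theorem fDiv_extract (f : ℝ → ℝ) (hl : limAtZero f ≠ ⊥) (hd : derivAtTop f ≠ ⊥)
    {Ω : Type} [MeasurableSpace Ω] (P Q : Measure Ω) [IsProbabilityMeasure P]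
    [IsProbabilityMeasure Q] (v : ℝ) (h : fDiv f P Q = (v : EReal)) :
    Integrable (fun x => f ((Measure.rnDeriv P Q x).toReal))
      (Q.restrict {x | Measure.rnDeriv P Q x ≠ 0}) ∧
    (Q {x | Measure.rnDeriv P Q x = 0} ≠ 0 → limAtZero f ≠ ⊤) ∧
    (Measure.singularPart P Q Set.univ ≠ 0 → derivAtTop f ≠ ⊤) ∧
    v = (∫ x in {x | Measure.rnDeriv P Q x ≠ 0}, f ((Measure.rnDeriv P Q x).toReal) ∂Q)
      + (limAtZero f).toReal * (Q {x | Measure.rnDeriv P Q x = 0}).toReal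
      + (derivAtTop f).toReal * (Measure.singularPart P Q Set.univ).toReal := by
  unfold fDiv at h
  have hq : Q {x | Measure.rnDeriv P Q x = 0} ≠ ⊤ := measure_ne_top _ _
  have hs : Measure.singularPart P Q Set.univ ≠ ⊤ := measure_ne_top _ _
  have b1 := ereal_mul_ne_bot_aux _ _ hl hq
  have b2 := ereal_mul_ne_bot_aux _ _ hd hs
  by_cases hI : Integrable (fun x => f ((Measure.rnDeriv P Q x).toReal))
      (Q.restrict {x | Measure.rnDeriv P Q x ≠ 0})
  swap
  · rw [if_neg hI, EReal.top_add_of_ne_bot b1, EReal.top_add_of_ne_bot b2] at h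
    exact absurd h.symm (EReal.coe_ne_top _)
  rw [if_pos hI] at h
  by_cases h1 : (Q {x | Measure.rnDeriv P Q x = 0} ≠ 0 → limAtZero f ≠ ⊤)
  swap
  · rw [ereal_mul_eq_top_aux _ _ h1, EReal.add_top_of_ne_bot (EReal.coe_ne_bot _),
      EReal.top_add_of_ne_bot b2] at h
    exact absurd h.symm (EReal.coe_ne_top _)
  rw [ereal_mul_aux _ _ hl hq h1] at h
  by_cases h2 : (Measure.singularPart P Q Set.univ ≠ 0 → derivAtTop f ≠ ⊤)
  swap
  · rw [ereal_mul_eq_top_aux _ _ h2, EReal.add_top_of_ne_bot] at h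
    · exact absurd h.symm (EReal.coe_ne_top _)
    · rw [← EReal.coe_add]; exact EReal.coe_ne_bot _
  rw [ereal_mul_aux _ _ hd hs h2] at h
  refine ⟨hI, h1, h2, ?_⟩
  exact_mod_cast h.symm

/-- The measure on `Fin n` with point masses `p`. -/
def finMeas {n : ℕ} (p : Fin n → ℝ≥0) : Measure (Fin n) :=
  ∑ j, (p j : ℝ≥0∞) • Measure.dirac j

theorem finMeas_singleton {n : ℕ} (p : Fin n → ℝ≥0) (j : Fin n) : finMeas p {j} = p j := by
  simp [finMeas, Measure.finsetSum_apply, Set.indicator_apply, Finset.sum_ite_eq']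

theorem fin_measure_eq_sum {n : ℕ} (μ : Measure (Fin n)) (A : Set (Fin n)) :
    μ A = ∑ j, if j ∈ A then μ {j} else 0 := by
  rw [← Finset.sum_filter, sum_measure_singleton]
  congr 1
  ext; simp

theorem finMeas_prob {n : ℕ} (p : Fin n → ℝ≥0) (h : ∑ j, p j = 1) :
    IsProbabilityMeasure (finMeas p) := by
  constructor
  rw [fin_measure_eq_sum]
  simp only [mem_univ, if_true, finMeas_singleton]
  exact_mod_cast h

theorem fDiv_fin (f : ℝ → ℝ) (hl : limAtZero f ≠ ⊥) (hd : derivAtTop f ≠ ⊥) {n : ℕ}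
    (p q : Fin n → ℝ≥0) (hp : ∑ j, p j = 1) (hq : ∑ j, q j = 1)
    (h0 : ∀ j, p j = 0 → q j ≠ 0 → limAtZero f ≠ ⊤)
    (h1 : ∀ j, q j = 0 → p j ≠ 0 → derivAtTop f ≠ ⊤) :
    fDiv f (finMeas p) (finMeas q) = ((∑ j, persp f (p j) (q j) : ℝ) : EReal) := by
  have := finMeas_prob p hp
  have := finMeas_prob q hq
  set P := finMeas p with hP
  set Q := finMeas q with hQ
  set r := Measure.rnDeriv P Q with hr
  set s := Measure.singularPart P Q with hs
  have hdec : ∀ j, (p j : ℝ≥0∞) = s {j} + r j * q j := by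
    intro j
    have h := Measure.haveLebesgueDecomposition_add P Q
    have h2 := congrArg (fun μ : Measure (Fin n) => μ {j}) h
    simp only [Measure.add_apply] at h2
    rw [withDensity_apply _ (measurableSet_singleton j), lintegral_singleton] at h2
    rw [hP, finMeas_singleton, ← hP, hQ, finMeas_singleton, ← hQ] at h2
    exact h2
  have hsing : ∀ j, q j ≠ 0 → s {j} = 0 := by
    intro j hj
    obtain ⟨S, -, hS1, hS2⟩ := Measure.mutuallySingular_singularPart P Q
    have : j ∈ S := by
      by_contra hjS
      have h3 : Q {j} ≤ Q Sᶜ := measure_mono (by simpa using hjS)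
      rw [hS2, hQ, finMeas_singleton] at h3
      simp at h3
      exact hj h3
    exact measure_mono_null (by simpa using this) hS1
  have hsing' : ∀ j, q j = 0 → s {j} = p j := by
    intro j hj
    rw [hdec j, hj]; simp
  have hrj : ∀ j, q j ≠ 0 → r j = p j / q j := by
    intro j hj
    rw [hdec j, hsing j hj, zero_add, ENNReal.mul_div_cancel_right]
    · simpa using hj
    · simp
  have hr0 : ∀ j, q j ≠ 0 → (r j = 0 ↔ p j = 0) := by
    intro j hj
    rw [hrj j hj, ENNReal.div_eq_zero_iff]; simp
  have e1 : Q {x | r x = 0} = ∑ j, if p j = 0 then (q j : ℝ≥0∞) else 0 := by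
    rw [fin_measure_eq_sum]
    refine Finset.sum_congr rfl fun j _ => ?_
    rw [hQ, finMeas_singleton]
    by_cases hj : q j = 0
    · simp [hj]
    · simp [hr0 j hj]
  have e2 : s univ = ∑ j, if q j = 0 then (p j : ℝ≥0∞) else 0 := by
    rw [fin_measure_eq_sum]
    refine Finset.sum_congr rfl fun j _ => ?_
    by_cases hj : q j = 0
    · simp [hj, hsing' j hj]
    · simp [hj, hsing j hj]
  have e3 : ∫ x in {x | r x ≠ 0}, f (r x).toReal ∂Q =
      ∑ j, if p j = 0 then 0 else (q j : ℝ) * f (p j / q j) := by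
    rw [← integral_indicator (MeasurableSet.of_discrete), integral_fintype Integrable.of_finite]
    refine Finset.sum_congr rfl fun j _ => ?_
    rw [Measure.real, hQ, finMeas_singleton]
    by_cases hj : q j = 0
    · simp [hj]
    · by_cases hpj : p j = 0
      · have : r j = 0 := (hr0 j hj).2 hpj
        simp [hpj, this]
      · have : r j ≠ 0 := fun h => hpj ((hr0 j hj).1 h)
        simp [hpj, this, hrj j hj]
  have f1 : Q {x | r x = 0} ≠ 0 → limAtZero f ≠ ⊤ := by
    intro h
    rw [e1] at h
    obtain ⟨j, -, hj⟩ := Finset.exists_ne_zero_of_sum_ne_zero h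
    by_cases hpj : p j = 0
    · exact h0 j hpj (by simpa [hpj] using hj)
    · simp [hpj] at hj
  have f2 : s univ ≠ 0 → derivAtTop f ≠ ⊤ := by
    intro h
    rw [e2] at h
    obtain ⟨j, -, hj⟩ := Finset.exists_ne_zero_of_sum_ne_zero h
    by_cases hqj : q j = 0
    · exact h1 j hqj (by simpa [hqj] using hj)
    · simp [hqj] at hj
  unfold fDiv
  rw [if_pos Integrable.of_finite, ereal_mul_aux _ _ hl (measure_ne_top _ _) f1,
    ereal_mul_aux _ _ hd (measure_ne_top _ _) f2, ← EReal.coe_add, ← EReal.coe_add]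
  congr 1
  rw [e3, e1, e2, ENNReal.toReal_sum (by intro j _; split_ifs <;> simp),
    ENNReal.toReal_sum (by intro j _; split_ifs <;> simp), Finset.mul_sum, Finset.mul_sum,
    ← Finset.sum_add_distrib, ← Finset.sum_add_distrib]
  refine Finset.sum_congr rfl fun j _ => ?_
  unfold persp
  by_cases hqj : q j = 0
  · by_cases hpj : p j = 0
    · simp [hqj, hpj]
    · simp [hqj, hpj, mul_comm]
  · by_cases hpj : p j = 0
    · simp [hqj, hpj, mul_comm]
    · simp [hqj, hpj]

/-- Carathéodory with exactly `N` (possibly zero-weight) points. -/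
theorem caratheodory_fin {E : Type} [AddCommGroup E] [Module ℝ E] [FiniteDimensional ℝ E]
    (N : ℕ) (hN : Module.finrank ℝ E + 1 ≤ N) (S : Set E) (x : E) (hx : x ∈ convexHull ℝ S) :
    ∃ (W : Fin N → ℝ) (Z : Fin N → E), (∀ j, 0 ≤ W j) ∧ (∀ j, Z j ∈ S) ∧ ∑ j, W j = 1 ∧
      ∑ j, W j • Z j = x := by
  obtain ⟨ι, _, z, w, hz, haff, hw, hw1, hwx⟩ := eq_pos_convex_span_of_mem_convexHull hx
  have hcard : Fintype.card ι ≤ Fintype.card (Fin N) := by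
    have h1 := haff.card_le_finrank_succ
    have h2 := Submodule.finrank_le (vectorSpan ℝ (Set.range z))
    simp only [Fintype.card_fin]
    omega
  obtain ⟨e⟩ := Function.Embedding.nonempty_of_card_le hcard
  obtain ⟨s0, hs0⟩ : S.Nonempty := convexHull_nonempty_iff.1 ⟨x, hx⟩
  have hW : ∀ i, Function.extend e w 0 (e i) = w i := fun i => e.injective.extend_apply _ _ _
  have hZ : ∀ i, Function.extend e z (fun _ => s0) (e i) = z i :=
    fun i => e.injective.extend_apply _ _ _
  have hW' : ∀ j, j ∉ Set.image e (Finset.univ : Finset ι) → Function.extend e w 0 j = 0 := by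
    intro j hj
    rw [Function.extend_apply' _ _ _ (by simpa using hj)]; rfl
  refine ⟨Function.extend e w 0, Function.extend e z (fun _ => s0), ?_, ?_, ?_, ?_⟩
  · intro j
    by_cases h : ∃ i, e i = j
    · obtain ⟨i, rfl⟩ := h
      rw [hW]; exact (hw i).le
    · rw [Function.extend_apply' _ _ _ h]; simp
  · intro j
    by_cases h : ∃ i, e i = j
    · obtain ⟨i, rfl⟩ := h
      rw [hZ]; exact hz ⟨i, rfl⟩
    · rw [Function.extend_apply' _ _ _ h]; exact hs0
  · rw [← hw1]
    symm
    exact Finset.sum_of_injOn e e.injective.injOn (by simp [MapsTo]) (fun j _ hj => hW' j hj)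
      (fun i _ => (hW i).symm)
  · rw [← hwx]
    symm
    exact Finset.sum_of_injOn e e.injective.injOn (by simp [MapsTo])
      (fun j _ hj => by rw [hW' j hj, zero_smul])
      (fun i _ => by rw [hW, hZ])

/-- The vector `(p, q, f_1-perspective, …)`. -/
def perspVec {m : ℕ} (fs : Fin m → ℝ → ℝ) (p q : ℝ) : ℝ × ℝ × (Fin m → ℝ) :=
  (p, q, fun i => persp (fs i) p q)

theorem perspVec_smul {m : ℕ} (fs : Fin m → ℝ → ℝ) (c p q : ℝ) :
    perspVec fs (c * p) (c * q) = c • perspVec fs p q := by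
  simp only [perspVec, persp_smul]
  rfl

/-- The normalized generators. -/
def genSet {m : ℕ} (fs : Fin m → ℝ → ℝ) (A0 A1 : Prop) : Set (ℝ × ℝ × (Fin m → ℝ)) :=
  {z | ∃ a : ℝ, 0 ≤ a ∧ a ≤ 1 ∧ (a = 0 → A0) ∧ (a = 1 → A1) ∧ z = perspVec fs a (1 - a)}

/-- The convex cone they generate. -/
def genCone {m : ℕ} (fs : Fin m → ℝ → ℝ) (A0 A1 : Prop) : Set (ℝ × ℝ × (Fin m → ℝ)) :=
  {y | ∃ c : ℝ, 0 ≤ c ∧ ∃ z ∈ convexHull ℝ (genSet fs A0 A1), y = c • z}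

theorem genCone_zero {m : ℕ} (fs : Fin m → ℝ → ℝ) (A0 A1 : Prop) :
    (0 : ℝ × ℝ × (Fin m → ℝ)) ∈ genCone fs A0 A1 := by
  refine ⟨0, le_rfl, perspVec fs (1/2) (1 - 1/2), subset_convexHull ℝ _ ⟨1/2, ?_⟩, by simp⟩
  norm_num

theorem genCone_smul {m : ℕ} (fs : Fin m → ℝ → ℝ) (A0 A1 : Prop) (c : ℝ) (hc : 0 ≤ c)
    (y : ℝ × ℝ × (Fin m → ℝ)) (hy : y ∈ genCone fs A0 A1) : c • y ∈ genCone fs A0 A1 := by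
  obtain ⟨d, hd, z, hz, rfl⟩ := hy
  exact ⟨c * d, mul_nonneg hc hd, z, hz, smul_smul _ _ _⟩

theorem genCone_add {m : ℕ} (fs : Fin m → ℝ → ℝ) (A0 A1 : Prop)
    (x y : ℝ × ℝ × (Fin m → ℝ)) (hx : x ∈ genCone fs A0 A1) (hy : y ∈ genCone fs A0 A1) :
    x + y ∈ genCone fs A0 A1 := by
  obtain ⟨c, hc, z, hz, rfl⟩ := hx
  obtain ⟨d, hd, w, hw, rfl⟩ := hy
  rcases (add_nonneg hc hd).eq_or_lt with h | h
  · have h1 : c = 0 := by linarith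
    have h2 : d = 0 := by linarith
    simpa [h1, h2] using genCone_zero fs A0 A1
  · refine ⟨c + d, h.le, (c / (c + d)) • z + (d / (c + d)) • w,
      convex_convexHull ℝ _ hz hw (by positivity) (by positivity) (by field_simp), ?_⟩
    rw [smul_add, smul_smul, smul_smul, mul_div_cancel₀ _ h.ne', mul_div_cancel₀ _ h.ne']

theorem perspVec_mem_cone {m : ℕ} (fs : Fin m → ℝ → ℝ) (A0 A1 : Prop) (p q : ℝ)
    (hp : 0 ≤ p) (hq : 0 ≤ q) (h0 : p = 0 → q ≠ 0 → A0) (h1 : q = 0 → p ≠ 0 → A1) :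
    perspVec fs p q ∈ genCone fs A0 A1 := by
  rcases (add_nonneg hp hq).eq_or_lt with h | h
  · have e1 : p = 0 := by linarith
    have e2 : q = 0 := by linarith
    have := perspVec_smul fs 0 0 0
    simp only [mul_zero, zero_smul] at this
    rw [e1, e2, this]
    exact genCone_zero fs A0 A1
  · refine ⟨p + q, h.le, perspVec fs (p / (p + q)) (1 - p / (p + q)),
      subset_convexHull ℝ _ ⟨p / (p + q), by positivity, ?_, ?_, ?_, rfl⟩, ?_⟩
    · rw [div_le_one h]; linarith
    · intro e
      have e1 : p = 0 := by
        rcases div_eq_zero_iff.1 e with e | e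
        · exact e
        · exact absurd e h.ne'
      exact h0 e1 (by intro e2; linarith)
    · intro e
      rw [div_eq_one_iff_eq h.ne'] at e
      exact h1 (by linarith) (by intro e2; linarith)
    · rw [← perspVec_smul]
      congr 1
      · field_simp
      · field_simp; ring

theorem joint_vec_mem {m : ℕ} (fs : Fin m → ℝ → ℝ) {Ω : Type} [MeasurableSpace Ω]
    (P Q : Measure Ω) [IsProbabilityMeasure P] [IsProbabilityMeasure Q] (v : Fin m → ℝ)
    (hI : ∀ i, Integrable (fun x => fs i ((Measure.rnDeriv P Q x).toReal))
      (Q.restrict {x | Measure.rnDeriv P Q x ≠ 0}))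
    (hv : ∀ i, v i =
      (∫ x in {x | Measure.rnDeriv P Q x ≠ 0}, fs i ((Measure.rnDeriv P Q x).toReal) ∂Q)
      + (limAtZero (fs i)).toReal * (Q {x | Measure.rnDeriv P Q x = 0}).toReal
      + (derivAtTop (fs i)).toReal * (Measure.singularPart P Q Set.univ).toReal) :
    ((1 / 2, fun i => v i / 2) : ℝ × (Fin m → ℝ)) ∈ convexHull ℝ
      {z : ℝ × (Fin m → ℝ) | ∃ a : ℝ, 0 ≤ a ∧ a ≤ 1 ∧
        (a = 0 → Q {x | Measure.rnDeriv P Q x = 0} ≠ 0) ∧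
        (a = 1 → Measure.singularPart P Q Set.univ ≠ 0) ∧
        z = (a, fun i => persp (fs i) a (1 - a))} := by
  set r := Measure.rnDeriv P Q with hr
  set q0 := Q {x | r x = 0} with hq0
  set s := Measure.singularPart P Q univ with hs
  have hrm : Measurable r := Measure.measurable_rnDeriv P Q
  have hA : MeasurableSet {x | r x ≠ 0} := hrm (measurableSet_singleton 0).compl
  have hrfin : ∀ᵐ x ∂Q, r x < ⊤ := Measure.rnDeriv_lt_top P Q
  have hrI : Integrable (fun x => (r x).toReal) Q := Measure.integrable_toReal_rnDeriv
  -- the three parts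
  let G : Ω → ℝ × ℝ × (Fin m → ℝ) := {x | r x ≠ 0}.indicator
    (fun x => ((r x).toReal, 1, fun i => fs i (r x).toReal))
  have hGI' : Integrable (fun x => (((r x).toReal, 1, fun i => fs i (r x).toReal) :
      ℝ × ℝ × (Fin m → ℝ))) (Q.restrict {x | r x ≠ 0}) :=
    hrI.restrict.prodMk ((integrable_const (1 : ℝ)).prodMk (Integrable.of_eval hI))
  have hGI : Integrable G Q := (integrable_indicator_iff hA).2 hGI'
  have hGC : ∀ᵐ x ∂Q, G x ∈ genCone fs (q0 ≠ 0) (s ≠ 0) := by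
    filter_upwards [hrfin] with x hx
    by_cases h : r x = 0
    · have : G x = 0 := by simp [G, h]
      rw [this]; exact genCone_zero _ _ _
    · have hpos : (r x).toReal ≠ 0 := ENNReal.toReal_ne_zero.2 ⟨h, hx.ne⟩
      have : G x = perspVec fs (r x).toReal 1 := by
        simp [G, h, perspVec, persp, hpos]
      rw [this]
      exact perspVec_mem_cone _ _ _ _ _ ENNReal.toReal_nonneg zero_le_one
        (fun e => absurd e hpos) (fun e => absurd e one_ne_zero)
  have hconv : Convex ℝ (genCone fs (q0 ≠ 0) (s ≠ 0)) := by
    intro x hx y hy a b ha hb _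
    exact genCone_add _ _ _ _ _ (genCone_smul _ _ _ a ha _ hx) (genCone_smul _ _ _ b hb _ hy)
  have h1 := convex_integral_mem_fd _ rfl Q _ hconv G hGI hGC
  have h2 : perspVec fs 0 q0.toReal ∈ genCone fs (q0 ≠ 0) (s ≠ 0) :=
    perspVec_mem_cone _ _ _ _ _ le_rfl ENNReal.toReal_nonneg
      (fun _ e => (ENNReal.toReal_ne_zero.1 e).1) (fun _ e => absurd rfl e)
  have h3 : perspVec fs s.toReal 0 ∈ genCone fs (q0 ≠ 0) (s ≠ 0) :=
    perspVec_mem_cone _ _ _ _ _ ENNReal.toReal_nonneg le_rfl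
      (fun _ e => absurd rfl e) (fun _ e => (ENNReal.toReal_ne_zero.1 e).1)
  have h4 := genCone_add _ _ _ _ _ (genCone_add _ _ _ _ _ h1 h2) h3
  -- identify the sum
  have hcompl : {x | r x = 0}ᶜ = {x | r x ≠ 0} := rfl
  have hmassQ : Q.real {x | r x ≠ 0} + q0.toReal = 1 := by
    have := probReal_add_probReal_compl (μ := Q) hA
    have e : {x | r x ≠ 0}ᶜ = {x | r x = 0} := by ext; simp
    rw [e] at this
    exact this
  have hmassP : (∫ x in {x | r x ≠ 0}, (r x).toReal ∂Q) + s.toReal = 1 := by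
    have e1 : ∫ x in {x | r x ≠ 0}, (r x).toReal ∂Q = ∫ x, (r x).toReal ∂Q := by
      apply setIntegral_eq_integral_of_forall_compl_eq_zero
      intro x hx
      have : r x = 0 := by simpa using hx
      simp [this]
    have e2 : ∫ x, (r x).toReal ∂Q = (∫⁻ x, r x ∂Q).toReal :=
      integral_toReal hrm.aemeasurable hrfin
    have e3 := congrArg (fun μ : Measure Ω => μ univ) (Measure.haveLebesgueDecomposition_add P Q)
    simp only [Measure.add_apply, withDensity_apply _ MeasurableSet.univ, Measure.restrict_univ,
      measure_univ] at e3
    rw [e1, e2, add_comm, ← ENNReal.toReal_add (measure_ne_top _ _)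
      (Measure.lintegral_rnDeriv_lt_top P Q).ne, ← e3]
    simp
  have hGint : ∫ x, G x ∂Q = (∫ x in {x | r x ≠ 0}, (r x).toReal ∂Q, Q.real {x | r x ≠ 0},
      fun i => ∫ x in {x | r x ≠ 0}, fs i (r x).toReal ∂Q) := by
    have e0 : ∫ x, G x ∂Q = ∫ x in {x | r x ≠ 0}, (((r x).toReal, 1, fun i => fs i (r x).toReal) :
      ℝ × ℝ × (Fin m → ℝ)) ∂Q := integral_indicator hA
    rw [e0, integral_pair hrI.restrict ((integrable_const (1 : ℝ)).prodMk (Integrable.of_eval hI)),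
      integral_pair (integrable_const (1 : ℝ)) (Integrable.of_eval hI)]
    congr 2
    · simp
    · ext i
      exact eval_integral hI i
  have hsum : (∫ x, G x ∂Q) + perspVec fs 0 q0.toReal + perspVec fs s.toReal 0 = (1, 1, v) := by
    rw [hGint]
    simp only [perspVec, Prod.mk_add_mk, add_zero, hmassP, hmassQ]
    congr 2
    ext i
    simp only [Pi.add_apply]
    rw [hv i]
    have e1 : persp (fs i) 0 q0.toReal = (limAtZero (fs i)).toReal * q0.toReal := by
      unfold persp
      by_cases h : q0.toReal = 0
      · simp [h]
      · rw [if_neg h, if_pos rfl, mul_comm]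
    have e2 : persp (fs i) s.toReal 0 = (derivAtTop (fs i)).toReal * s.toReal := by
      unfold persp
      rw [if_pos rfl, mul_comm]
    rw [e1, e2]
  rw [hsum] at h4
  obtain ⟨c, hc, z, hz, hcz⟩ := h4
  have hzsum : z.1 + z.2.1 = 1 := by
    have hsub : convexHull ℝ (genSet fs (q0 ≠ 0) (s ≠ 0)) ⊆ {z | z.1 + z.2.1 = 1} := by
      apply convexHull_min
      · rintro _ ⟨a, -, -, -, -, rfl⟩
        simp [perspVec]
      · intro x hx y hy a b ha hb hab
        simp only [Set.mem_ofPred_eq, Prod.fst_add, Prod.snd_add, Prod.smul_fst, Prod.smul_snd,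
          smul_eq_mul] at *
        linear_combination a * hx + b * hy + hab
    exact hsub hz
  have hc1 : 1 = c * z.1 := by simpa using congrArg Prod.fst hcz
  have hc2 : 1 = c * z.2.1 := by simpa using congrArg (fun y => y.2.1) hcz
  have hc3 : ∀ i, v i = c * z.2.2 i := fun i => by
    simpa using congrFun (congrArg (fun y => y.2.2) hcz) i
  have hc' : c = 2 := by linear_combination (-1 : ℝ) * hc1 - hc2 - c * hzsum
  subst hc'
  let L : (ℝ × ℝ × (Fin m → ℝ)) →ₗ[ℝ] ℝ × (Fin m → ℝ) :=
    (LinearMap.fst ℝ _ _).prod ((LinearMap.snd ℝ _ _).comp (LinearMap.snd ℝ _ _))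
  have hLz : L z ∈ convexHull ℝ (Set.image L (genSet fs (q0 ≠ 0) (s ≠ 0))) := by
    rw [← LinearMap.image_convexHull]
    exact ⟨z, hz, rfl⟩
  have hLe : L z = (1 / 2, fun i => v i / 2) := by
    change (z.1, z.2.2) = _
    congr 1
    · linarith
    · ext i
      rw [hc3 i]; ring
  rw [hLe] at hLz
  refine convexHull_mono ?_ hLz
  rintro _ ⟨_, ⟨a, g1, g2, g3, g4, rfl⟩, rfl⟩
  exact ⟨a, g1, g2, g3, g4, rfl⟩

/-- **Theorem 4 (joint range).** For every `m ≥ 1`, the joint range of the divergences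
`D_{f_1}, …, D_{f_m}` (the set of all vectors in `ℝ^m` attained by some pair of probability
measures on some measurable space) equals the joint range over pairs of probability measures
on a set with `m + 2` points. -/
theorem joint_range_reduction (m : ℕ) (hm : 1 ≤ m) (fs : Fin m → ℝ → ℝ)
    (hfs : ∀ i, ConvexOn ℝ (Set.Ioi 0) (fs i)) (hfs1 : ∀ i, fs i 1 = 0) :
    {v : Fin m → ℝ | ∃ pp : PMPair, ∀ i, fDiv (fs i) pp.P pp.Q = ((v i : ℝ) : EReal)} =
    {v : Fin m → ℝ | ∃ P Q : Measure (Fin (m + 2)),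
      IsProbabilityMeasure P ∧ IsProbabilityMeasure Q ∧
      ∀ i, fDiv (fs i) P Q = ((v i : ℝ) : EReal)} := by
  ext v
  simp only [Set.mem_ofPred_eq]
  constructor
  swap
  · rintro ⟨P, Q, hP, hQ, h⟩
    exact ⟨⟨Fin (m + 2), inferInstance, P, Q, hP, hQ⟩, h⟩
  rintro ⟨⟨Ω, inst, P, Q, hP, hQ⟩, hv⟩
  simp only at hv
  have hl := fun i => limAtZero_ne_bot (fs i) (hfs i) (hfs1 i)
  have hd := fun i => derivAtTop_ne_bot (fs i) (hfs i) (hfs1 i)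
  have hex := fun i => fDiv_extract (fs i) (hl i) (hd i) P Q (v i) (hv i)
  set r := Measure.rnDeriv P Q with hr
  set q0 := Q {x | r x = 0} with hq0
  set s := Measure.singularPart P Q univ with hs
  have hmem := joint_vec_mem fs P Q v (fun i => (hex i).1) (fun i => (hex i).2.2.2)
  obtain ⟨W, Z, hW, hZ, hW1, hWZ⟩ := caratheodory_fin (m + 2) (by simp; omega) _ _ hmem
  choose a ha0 ha1 hA0 hA1 hZa using hZ
  let p : Fin (m + 2) → ℝ≥0 := fun j => ⟨2 * W j * a j, by have := hW j; have := ha0 j; positivity⟩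
  let q : Fin (m + 2) → ℝ≥0 := fun j =>
    ⟨2 * W j * (1 - a j), by have := hW j; have := sub_nonneg.2 (ha1 j); positivity⟩
  have hpc : ∀ j, (p j : ℝ) = 2 * W j * a j := fun j => rfl
  have hqc : ∀ j, (q j : ℝ) = 2 * W j * (1 - a j) := fun j => rfl
  have hWa : ∑ j, W j * a j = 1 / 2 := by
    have := congrArg Prod.fst hWZ
    rw [Prod.fst_sum] at this
    simpa [hZa] using this
  have hWp : ∀ i, ∑ j, W j * persp (fs i) (a j) (1 - a j) = v i / 2 := by
    intro i
    have := congrFun (congrArg Prod.snd hWZ) i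
    rw [Prod.snd_sum] at this
    simpa [hZa] using this
  have hp1 : ∑ j, p j = 1 := by
    rw [← NNReal.coe_inj]
    push_cast
    simp only [hpc, mul_assoc, ← Finset.mul_sum, hWa]
    norm_num
  have hq1 : ∑ j, q j = 1 := by
    rw [← NNReal.coe_inj]
    push_cast
    simp only [hqc, mul_assoc, ← Finset.mul_sum, mul_sub, Finset.sum_sub_distrib, mul_one, hWa, hW1]
    norm_num
  refine ⟨finMeas p, finMeas q, finMeas_prob p hp1, finMeas_prob q hq1, fun i => ?_⟩
  rw [fDiv_fin (fs i) (hl i) (hd i) p q hp1 hq1]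
  · congr 1
    simp only [hpc, hqc, persp_smul]
    simp only [mul_assoc, ← Finset.mul_sum, hWp]
    ring
  · intro j h1 h2
    rw [← NNReal.coe_ne_zero, hqc] at h2
    rw [← NNReal.coe_eq_zero, hpc] at h1
    have h3 : a j = 0 := by
      rcases mul_eq_zero.1 h1 with h | h
      · exact absurd (by rw [h, zero_mul]) h2
      · exact h
    exact (hex i).2.1 (hA0 j h3)
  · intro j h1 h2
    rw [← NNReal.coe_eq_zero, hqc] at h1
    rw [← NNReal.coe_ne_zero, hpc] at h2
    have h3 : 1 - a j = 0 := by
      rcases mul_eq_zero.1 h1 with h | h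
      · exact absurd (by rw [h, zero_mul]) h2
      · exact h
    exact (hex i).2.2.1 (hA1 j (by linarith))

end
end
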